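/- Let n ≥ 1, α ∈ (0, n+1), C ≥ 1 and 0 < δ₀ ≤ 1, and set k = ⌊α⌋. Let F ⊂ B_{ℝ^{n+1}}(0,1) be a finite nonempty set and μ the uniform measure on F, and assume μ(B_{ℝ^{n+1}}(x,δ)) ≤ C·δ^α for all x ∈ ℝ^{n+1} and all δ ∈ [δ₀, 1]. Then for every ε ∈ (0, min{α, n+1−α}/(10⁴ n)) there exist constants D ≥ 1 and c > 0 depending only on n and ε such that: for all δ ∈ [δ₀, 1/100] and all t ≥ D with e^{nt/2}·δ₀ ≤ δ ≤ e^{−nt/2}, there exists 𝓔 ⊂ [0,1] with |𝓔| ≤ D·e^{−cε²t} so that for every r ∈ [0,1] \ 𝓔 there exists F_r ⊂ F with μ(F \ F_r) ≤ D·e^{−cε²t}, and for all x ∈ ℝ^{n+1}: μ({w' ∈ F_r : ‖a_t·u_r·w' − x‖ ≤ δ}) ≤ D·C·e^{−t((2n−k+1)k − nα)/2}·δ^{α−ε}. -/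

import Mathlib

open MeasureTheory Real Metric

noncomputable section

/-- The `i`-th coordinate (0-indexed) of the `j`-th derivative of the curve
`ξ(r) = (r/1!, r²/2!, …, r^{n+1}/(n+1)!) ∈ ℝ^{n+1}`; the `i`-th coordinate of `ξ` is
`r^{i+1}/(i+1)!`, so its `j`-th derivative is `r^{i+1-j}/(i+1-j)!` if `j ≤ i+1` and `0`
otherwise. -/
def xiD (n j : ℕ) (r : ℝ) : EuclideanSpace ℝ (Fin (n + 1)) :=
  (EuclideanSpace.equiv (Fin (n + 1)) ℝ).symm fun i =>
    if j ≤ i.1 + 1 then r ^ (i.1 + 1 - j) / (Nat.factorial (i.1 + 1 - j) : ℝ) else 0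

/-- The action of `u_r`: `u_r·w = (w·ξ^{(1)}(r), …, w·ξ^{(n+1)}(r))`. -/
def uAct (n : ℕ) (r : ℝ) (w : EuclideanSpace ℝ (Fin (n + 1))) :
    EuclideanSpace ℝ (Fin (n + 1)) :=
  (EuclideanSpace.equiv (Fin (n + 1)) ℝ).symm fun i => ∑ l, w l * xiD n (i.1 + 1) r l

/-- The action of `a_t`: `a_t·w = (e^{nt/2} w₁, e^{(n−2)t/2} w₂, …, e^{−nt/2} w_{n+1})`. -/
def aAct (n : ℕ) (t : ℝ) (w : EuclideanSpace ℝ (Fin (n + 1))) :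
    EuclideanSpace ℝ (Fin (n + 1)) :=
  (EuclideanSpace.equiv (Fin (n + 1)) ℝ).symm fun i =>
    Real.exp ((((n : ℝ) - 2 * (i.1 : ℝ)) * t) / 2) * w i

/-- The uniform (normalized counting) measure of a set `A` with respect to a finite set `F`. -/
def mass {V : Type*} (F : Finset V) (A : Set V) : ℝ :=
  (Nat.card ↥(A ∩ (F : Set V)) : ℝ) / F.card

/-- `ϖ(α) = max{nα − ⌊α⌋(⌊α⌋+1), ⌊α⌋(2n − ⌊α⌋ + 1) − nα}`. -/
def varpi (n : ℕ) (α : ℝ) : ℝ :=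
  max ((n : ℝ) * α - (⌊α⌋ : ℝ) * ((⌊α⌋ : ℝ) + 1))
    ((⌊α⌋ : ℝ) * (2 * (n : ℝ) - (⌊α⌋ : ℝ) + 1) - (n : ℝ) * α)

set_option linter.unusedSectionVars false

namespace Dcp

/-- An orthonormal system of unimodular continuous characters on a probability space. -/
structure Chars {X G : Type*} [TopologicalSpace X] [MeasurableSpace X] [AddCommGroup G]
    (μ : Measure X) (e : G → C(X, ℂ)) : Prop where
  add : ∀ a b, e (a + b) = e a * e b
  norm_one : ∀ a x, ‖e a x‖ = 1
  integral_zero : ∀ a, a ≠ 0 → ∫ x, e a x ∂μ = 0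

theorem cint {X : Type*} [TopologicalSpace X] [CompactSpace X] [MeasurableSpace X] [BorelSpace X]
    {μ : Measure X} [IsProbabilityMeasure μ] {E : Type*} [NormedAddCommGroup E]
    [SecondCountableTopologyEither X E]
    {f : X → E} (hf : Continuous f) : Integrable f μ :=
  hf.integrable_of_hasCompactSupport (HasCompactSupport.of_compactSpace f)

section Spectrum

variable {X G : Type*} [TopologicalSpace X] [CompactSpace X] [MeasurableSpace X] [BorelSpace X]
  [AddCommGroup G] {μ : Measure X} [IsProbabilityMeasure μ] {e : G → C(X, ℂ)}

/-- Trigonometric polynomials with frequencies in `Ω`. -/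
def Spec {X G : Type*} [TopologicalSpace X] (e : G → C(X, ℂ)) (Ω : Set G) :
    Submodule ℂ C(X, ℂ) := Submodule.span ℂ (e '' Ω)

theorem Spec.mono {Ω Ω' : Set G} (h : Ω ⊆ Ω') : Spec e Ω ≤ Spec e Ω' :=
  Submodule.span_mono (Set.image_mono h)

theorem Spec.mem_of {ξ : G} {Ω : Set G} (h : ξ ∈ Ω) : e ξ ∈ Spec e Ω :=
  Submodule.subset_span ⟨ξ, h, rfl⟩

theorem Spec.eq_zero_of_empty {f : C(X, ℂ)} {Ω : Set G} (hf : f ∈ Spec e Ω) (h : Ω = ∅) :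
    f = 0 := by
  subst h; simpa [Spec] using hf

theorem Chars.zero (he : Chars μ e) : e 0 = 1 := by
  have h := he.add 0 0
  ext x
  have h1 : e 0 x = e 0 x * e 0 x := by
    conv_lhs => rw [← add_zero (0 : G), h]
    rfl
  have h2 : e 0 x ≠ 0 := by
    intro h0
    have := he.norm_one 0 x
    rw [h0] at this; simp at this
  have h3 : e 0 x * (e 0 x - 1) = 0 := by linear_combination -h1
  rcases mul_eq_zero.1 h3 with h4 | h4
  · exact absurd h4 h2
  · simpa [sub_eq_zero] using h4

theorem Chars.conj (he : Chars μ e) (a : G) (x : X) :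
    (starRingEnd ℂ) (e a x) = e (-a) x := by
  have h1 : e a x * e (-a) x = 1 := by
    rw [← ContinuousMap.mul_apply, ← he.add, add_neg_cancel, he.zero]; rfl
  have h2 : e a x * (starRingEnd ℂ) (e a x) = 1 := by
    rw [Complex.mul_conj, Complex.normSq_eq_norm_sq, he.norm_one]; simp
  have h3 : e a x ≠ 0 := by
    intro h0; rw [h0] at h1; simp at h1
  exact mul_left_cancel₀ h3 (h2.trans h1.symm)

theorem Spec.mul (he : Chars μ e) {Ω Ω' : Set G} {f g : C(X, ℂ)} (hf : f ∈ Spec e Ω)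
    (hg : g ∈ Spec e Ω') : f * g ∈ Spec e {ζ | ∃ ξ ∈ Ω, ∃ η ∈ Ω', ζ = ξ + η} := by
  have h := Submodule.mul_mem_mul hf hg
  rw [Spec, Spec, Submodule.span_mul_span] at h
  refine Submodule.span_mono ?_ h
  rintro _ ⟨_, ⟨ξ, hξ, rfl⟩, _, ⟨η, hη, rfl⟩, rfl⟩
  exact ⟨ξ + η, ⟨ξ, hξ, η, hη, rfl⟩, he.add _ _⟩

theorem Spec.pow (he : Chars μ e) {f : C(X, ℂ)} (Λ : ℕ → Set G) {Ω : Set G} (hf : f ∈ Spec e Ω)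
    (h0 : 0 ∈ Λ 0) (hs : ∀ m, ∀ ξ ∈ Λ m, ∀ η ∈ Ω, ξ + η ∈ Λ (m + 1)) (m : ℕ) :
    f ^ m ∈ Spec e (Λ m) := by
  induction m with
  | zero => rw [pow_zero, ← he.zero]; exact Spec.mem_of h0
  | succ m ih =>
    rw [pow_succ]
    refine Spec.mono ?_ (Spec.mul he ih hf)
    rintro _ ⟨ξ, hξ, η, hη, rfl⟩
    exact hs m ξ hξ η hη

theorem Spec.orthogonal (he : Chars μ e) {Ω Ω' : Set G} {f g : C(X, ℂ)} (hf : f ∈ Spec e Ω)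
    (hg : g ∈ Spec e Ω') (h : ∀ ξ ∈ Ω, ξ ∉ Ω') : ∫ x, f x * (starRingEnd ℂ) (g x) ∂μ = 0 := by
  induction hf using Submodule.span_induction with
  | zero => simp
  | add f₁ f₂ _ _ h1 h2 =>
    simp only [ContinuousMap.add_apply, add_mul]
    rw [integral_add (cint (by fun_prop)) (cint (by fun_prop)), h1, h2, add_zero]
  | smul c f _ h1 =>
    simp only [ContinuousMap.smul_apply, smul_eq_mul, mul_assoc]
    rw [integral_const_mul, h1, mul_zero]
  | mem f hf =>
    obtain ⟨ξ, hξ, rfl⟩ := hf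
    induction hg using Submodule.span_induction with
    | zero => simp
    | add f₁ f₂ _ _ h1 h2 =>
      simp only [ContinuousMap.add_apply, map_add, mul_add]
      rw [integral_add (cint (by fun_prop)) (cint (by fun_prop)), h1, h2, add_zero]
    | smul c f _ h1 =>
      simp only [ContinuousMap.smul_apply, smul_eq_mul, map_mul]
      have h2 : ∀ x, e ξ x * ((starRingEnd ℂ) c * (starRingEnd ℂ) (f x)) =
          (starRingEnd ℂ) c * (e ξ x * (starRingEnd ℂ) (f x)) := fun x => by ring
      simp only [h2]
      rw [integral_const_mul, h1, mul_zero]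
    | mem g hg =>
      obtain ⟨η, hη, rfl⟩ := hg
      have hne : ξ + -η ≠ 0 := by
        intro h0
        have : ξ = η := by rwa [← sub_eq_add_neg, sub_eq_zero] at h0
        exact h ξ hξ (this ▸ hη)
      rw [← he.integral_zero _ hne]
      congr 1
      ext x
      rw [he.conj, he.add]; rfl

/-- Almost orthogonality: if `g i` and `g j` are orthogonal unless `|i - j| < N`, then
`‖∑ g i‖² ≤ 2 N ∑ ‖g i‖²`. -/
theorem almost_orthogonal (s : Finset ℕ) (g : ℕ → C(X, ℂ)) (N : ℕ)
    (h : ∀ i ∈ s, ∀ j ∈ s, (i + N ≤ j ∨ j + N ≤ i) →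
      ∫ x, g i x * (starRingEnd ℂ) (g j x) ∂μ = 0) :
    ∫ x, ‖(∑ i ∈ s, g i) x‖ ^ 2 ∂μ ≤ 2 * N * ∑ i ∈ s, ∫ x, ‖g i x‖ ^ 2 ∂μ := by
  have hre : ∀ i j, (∫ x, g i x * (starRingEnd ℂ) (g j x) ∂μ).re ≤
      (∫ x, ‖g i x‖ ^ 2 ∂μ + ∫ x, ‖g j x‖ ^ 2 ∂μ) / 2 := by
    intro i j
    rw [← integral_add (cint (by fun_prop)) (cint (by fun_prop)), ← integral_div]
    have := (integral_re (μ := μ) (𝕜 := ℂ) (f := fun x => g i x * (starRingEnd ℂ) (g j x))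
      (cint (by fun_prop)))
    simp only [RCLike.re_to_complex] at this
    rw [← this]
    refine integral_mono (cint ?_) (cint (by fun_prop)) fun x => ?_
    · exact Complex.continuous_re.comp (by fun_prop)
    · show (g i x * (starRingEnd ℂ) (g j x)).re ≤ _
      refine (Complex.re_le_norm _).trans ?_
      rw [norm_mul, RCLike.norm_conj]
      nlinarith [sq_nonneg (‖g i x‖ - ‖g j x‖)]
  have hexp : ∫ x, ‖(∑ i ∈ s, g i) x‖ ^ 2 ∂μ =
      ∑ i ∈ s, ∑ j ∈ s, (∫ x, g i x * (starRingEnd ℂ) (g j x) ∂μ).re := by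
    have h1 : ∀ x, ‖(∑ i ∈ s, g i) x‖ ^ 2 =
        ∑ i ∈ s, ∑ j ∈ s, (g i x * (starRingEnd ℂ) (g j x)).re := by
      intro x
      rw [← Complex.normSq_eq_norm_sq, ← Complex.ofReal_re (Complex.normSq _),
        ← Complex.mul_conj, ContinuousMap.sum_apply, map_sum, Finset.sum_mul_sum, Complex.re_sum]
      simp only [Complex.re_sum]
    simp only [h1]
    have hc : ∀ i j, Continuous fun x => (g i x * (starRingEnd ℂ) (g j x)).re := fun i j =>
      Complex.continuous_re.comp (by fun_prop)
    rw [integral_finsetSum _ fun i _ => cint (by fun_prop)]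
    refine Finset.sum_congr rfl fun i _ => ?_
    rw [integral_finsetSum _ fun j _ => cint (hc i j)]
    refine Finset.sum_congr rfl fun j _ => ?_
    have := (integral_re (μ := μ) (𝕜 := ℂ) (f := fun x => g i x * (starRingEnd ℂ) (g j x))
      (cint (by fun_prop)))
    simpa only [RCLike.re_to_complex] using this
  set A : ℕ → ℝ := fun i => ∫ x, ‖g i x‖ ^ 2 ∂μ with hA
  have hA0 : ∀ i, 0 ≤ A i := fun i => integral_nonneg fun x => by positivity
  rw [hexp]
  have h2 : ∀ i ∈ s, ∀ j ∈ s, (∫ x, g i x * (starRingEnd ℂ) (g j x) ∂μ).re ≤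
      (if i < j + N ∧ j < i + N then A i / 2 else 0) +
      (if i < j + N ∧ j < i + N then A j / 2 else 0) := by
    intro i hi j hj
    by_cases hc : i < j + N ∧ j < i + N
    · rw [if_pos hc, if_pos hc]; linarith [hre i j]
    · rw [if_neg hc, if_neg hc, h i hi j hj (by omega)]; simp
  have hcard : ∀ i, ((s.filter fun j => i < j + N ∧ j < i + N).card : ℝ) ≤ 2 * N := by
    intro i
    have : (s.filter fun j => i < j + N ∧ j < i + N) ⊆ Finset.Ico (i + 1 - N) (i + N) := by
      intro j hj
      simp only [Finset.mem_filter] at hj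
      simp only [Finset.mem_Ico]; omega
    have h3 := Finset.card_le_card this
    rw [Nat.card_Ico] at h3
    have : (s.filter fun j => i < j + N ∧ j < i + N).card ≤ 2 * N := by omega
    exact_mod_cast this
  calc _ ≤ ∑ i ∈ s, ∑ j ∈ s, ((if i < j + N ∧ j < i + N then A i / 2 else 0) +
      (if i < j + N ∧ j < i + N then A j / 2 else 0)) :=
        Finset.sum_le_sum fun i hi => Finset.sum_le_sum fun j hj => h2 i hi j hj
    _ = ∑ i ∈ s, ∑ j ∈ s, (if i < j + N ∧ j < i + N then A i / 2 else 0) +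
        ∑ i ∈ s, ∑ j ∈ s, (if i < j + N ∧ j < i + N then A i / 2 else 0) := by
        simp only [Finset.sum_add_distrib]
        congr 1
        rw [Finset.sum_comm]
        simp only [and_comm]
    _ = ∑ i ∈ s, ((s.filter fun j => i < j + N ∧ j < i + N).card : ℝ) * A i := by
        rw [← Finset.sum_add_distrib]
        refine Finset.sum_congr rfl fun i _ => ?_
        rw [← Finset.sum_filter, Finset.sum_const, nsmul_eq_mul]; ring
    _ ≤ ∑ i ∈ s, 2 * N * A i :=
        Finset.sum_le_sum fun i _ => mul_le_mul_of_nonneg_right (hcard i) (hA0 i)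
    _ = _ := by rw [Finset.mul_sum]

end Spectrum

section Jets

open Polynomial

/-- The value at `x` of the `j`-th derivative of `p`. -/
def dv (j : ℕ) (p : ℝ[X]) (x : ℝ) : ℝ := (derivative^[j] p).eval x

theorem dv_add (j : ℕ) (p q : ℝ[X]) (x : ℝ) : dv j (p + q) x = dv j p x + dv j q x := by
  simp [dv]

theorem dv_sub (j : ℕ) (p q : ℝ[X]) (x : ℝ) : dv j (p - q) x = dv j p x - dv j q x := by
  simp [dv]

theorem dv_neg (j : ℕ) (p : ℝ[X]) (x : ℝ) : dv j (-p) x = -dv j p x := by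
  simp [dv]

theorem dv_zero_poly (j : ℕ) (x : ℝ) : dv j 0 x = 0 := by
  simp [dv]

theorem dv_C_mul (j : ℕ) (c : ℝ) (p : ℝ[X]) (x : ℝ) : dv j (C c * p) x = c * dv j p x := by
  simp [dv, iterate_derivative_C_mul]

theorem dv_iterate (i j : ℕ) (p : ℝ[X]) (x : ℝ) : dv j (derivative^[i] p) x = dv (j + i) p x := by
  simp [dv, Function.iterate_add_apply]

theorem dv_derivative (j : ℕ) (p : ℝ[X]) (x : ℝ) : dv j (derivative p) x = dv (j + 1) p x := by
  simpa using dv_iterate 1 j p x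

theorem dv_comp (j : ℕ) (p : ℝ[X]) (a ρ x : ℝ) :
    dv j (p.comp (C a + C ρ * X)) x = ρ ^ j * dv j p (a + ρ * x) := by
  induction j generalizing p with
  | zero => simp [dv]
  | succ j ih =>
    rw [← dv_derivative, derivative_comp]
    have : derivative (C a + C ρ * X : ℝ[X]) = C ρ := by simp
    rw [this, dv_C_mul, ih, dv_derivative]; ring

theorem hasDerivAt_dv (j : ℕ) (p : ℝ[X]) (x : ℝ) : HasDerivAt (dv j p) (dv (j + 1) p x) x := by
  have h := (derivative^[j] p).hasDerivAt x
  have e1 : dv (j + 1) p x = (derivative (derivative^[j] p)).eval x := by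
    rw [dv, Function.iterate_succ_apply']
  rw [e1]
  exact h

theorem dv_ge {j : ℕ} {p : ℝ[X]} {u z A : ℝ} (huz : u ≤ z)
    (h : ∀ w ∈ Set.Icc u z, A ≤ dv (j + 1) p w) : dv j p u + A * (z - u) ≤ dv j p z := by
  have hc : ContinuousOn (fun w => dv j p w - A * w) (Set.Icc u z) := fun w _ =>
    ((hasDerivAt_dv j p w).continuousAt.sub (by fun_prop)).continuousWithinAt
  have hm : MonotoneOn (fun w => dv j p w - A * w) (Set.Icc u z) := by
    refine monotoneOn_of_hasDerivWithinAt_nonneg (f' := fun w => dv (j + 1) p w - A * 1)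
      (convex_Icc u z) hc ?_ ?_
    · intro w _
      exact ((hasDerivAt_dv j p w).sub ((hasDerivAt_id w).const_mul A)).hasDerivWithinAt
    · intro w hw
      have := h w (interior_subset hw)
      linarith
  have := hm (Set.left_mem_Icc.2 huz) (Set.right_mem_Icc.2 huz) huz
  simp only at this
  linarith

theorem abs_dv_sub_le {j : ℕ} {p : ℝ[X]} {u z A : ℝ}
    (h : ∀ w ∈ Set.uIcc u z, |dv (j + 1) p w| ≤ A) : |dv j p z - dv j p u| ≤ A * |z - u| := by
  have := Convex.norm_image_sub_le_of_norm_hasDerivWithin_le (f := dv j p)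
    (f' := fun w => dv (j + 1) p w) (s := Set.uIcc u z) (C := A) (x := u) (y := z)
    (fun w _ => (hasDerivAt_dv j p w).hasDerivWithinAt) (fun w hw => by simpa using h w hw)
    (convex_uIcc u z) Set.left_mem_uIcc Set.right_mem_uIcc
  simpa using this

theorem abs_dv_le {m : ℕ} {p : ℝ[X]} {u r A : ℝ} (hr : 0 ≤ r) (hA : 0 ≤ A) {y : ℝ}
    (hy : |y - u| ≤ r)
    (h1 : ∀ j < m, |dv j p u| ≤ A * r ^ (m - j)) (h2 : ∀ z ∈ Set.uIcc u y, |dv m p z| ≤ A) :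
    ∀ j ≤ m, |dv j p y| ≤ 2 ^ m * A * r ^ (m - j) := by
  have key : ∀ i ≤ m, ∀ z ∈ Set.uIcc u y, |dv (m - i) p z| ≤ 2 ^ i * A * r ^ i := by
    intro i
    induction i with
    | zero => intro _ z hz; simpa using h2 z hz
    | succ i ih =>
      intro hi z hz
      have e1 : m - (i + 1) + 1 = m - i := by omega
      have hb := abs_dv_sub_le (j := m - (i + 1)) (p := p) (u := u) (z := z)
        (A := 2 ^ i * A * r ^ i) (fun w hw => by
          rw [e1]
          exact ih (by omega) w (Set.uIcc_subset_uIcc_left hz hw))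
      have h3 := h1 (m - (i + 1)) (by omega)
      have e2 : m - (m - (i + 1)) = i + 1 := by omega
      rw [e2] at h3
      have h4 : |z - u| ≤ r := (Set.abs_sub_left_of_mem_uIcc hz).trans (by
        exact hy)
      have h5 : |dv (m - (i + 1)) p z| ≤ |dv (m - (i + 1)) p u| +
          |dv (m - (i + 1)) p z - dv (m - (i + 1)) p u| := by
        have := abs_add_le (dv (m - (i + 1)) p u) (dv (m - (i + 1)) p z - dv (m - (i + 1)) p u)
        simpa using this
      have h6 : 2 ^ i * A * r ^ i * |z - u| ≤ 2 ^ i * A * r ^ i * r := by gcongr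
      have h7 : A * r ^ (i + 1) ≤ 2 ^ i * (A * r ^ (i + 1)) := by
        refine le_mul_of_one_le_left (by positivity) (one_le_pow₀ (by norm_num))
      calc _ ≤ A * r ^ (i + 1) + 2 ^ i * A * r ^ i * r := by linarith
        _ ≤ 2 ^ (i + 1) * A * r ^ (i + 1) := by
          rw [pow_succ, pow_succ (2 : ℝ)]; rw [pow_succ] at h7; nlinarith
  intro j hj
  have h := key (m - j) (by omega) y Set.right_mem_uIcc
  have e1 : m - (m - j) = j := by omega
  rw [e1] at h
  refine h.trans ?_
  gcongr
  · norm_num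
  · omega

theorem dv_lower {m : ℕ} {p : ℝ[X]} {u y E A : ℝ} (hE : 0 ≤ E) (huy : u ≤ y) (hy1 : y ≤ u + 1)
    (h1 : ∀ j < m, -E ≤ dv j p u) (h2 : ∀ z ∈ Set.Icc u y, A ≤ dv m p z) :
    A * (y - u) ^ m / m.factorial - m * E ≤ dv 0 p y := by
  induction m generalizing p y with
  | zero =>
    have := h2 y ⟨huy, le_rfl⟩
    simpa using this
  | succ m ih =>
    have h3 : ∀ z ∈ Set.Icc u y, A * (z - u) ^ m / m.factorial - m * E ≤ dv 1 p z := by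
      intro z hz
      have := ih (p := derivative p) (y := z) hz.1 (hz.2.trans hy1)
        (fun j hj => by rw [dv_derivative]; exact h1 (j + 1) (by omega))
        (fun w hw => by rw [dv_derivative]; exact h2 w ⟨hw.1, hw.2.trans hz.2⟩)
      rwa [dv_derivative] at this
    set h : ℝ → ℝ := fun z => dv 0 p z - A * (z - u) ^ (m + 1) / (m + 1).factorial + m * E * (z - u)
      with hh
    have hd : ∀ z, HasDerivAt h (dv 1 p z - A * (z - u) ^ m / m.factorial + m * E) z := by
      intro z
      have e1 := (((hasDerivAt_id z).sub_const u).pow (m + 1)).const_mul A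
      have e2 := ((hasDerivAt_dv 0 p z).sub (e1.div_const ((m + 1).factorial : ℝ))).add
        (((hasDerivAt_id z).sub_const u).const_mul (m * E))
      refine HasDerivAt.congr_deriv e2 ?_
      have : ((m + 1).factorial : ℝ) = (m + 1) * m.factorial := by
        rw [Nat.factorial_succ]; push_cast; ring
      have h0 : (m.factorial : ℝ) ≠ 0 := by positivity
      have h0' : (m + 1 : ℝ) ≠ 0 := by positivity
      rw [this]
      simp only [id, Nat.cast_add, Nat.cast_one, Nat.add_sub_cancel]
      field_simp
    have hm : MonotoneOn h (Set.Icc u y) := by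
      refine monotoneOn_of_hasDerivWithinAt_nonneg
        (f' := fun z => dv 1 p z - A * (z - u) ^ m / m.factorial + m * E)
        (convex_Icc u y) (fun z _ => (hd z).continuousAt.continuousWithinAt)
        (fun z _ => (hd z).hasDerivWithinAt) ?_
      intro w hw
      have := h3 w (interior_subset hw)
      linarith
    have h4 := hm (Set.left_mem_Icc.2 huy) (Set.right_mem_Icc.2 huy) huy
    have h5 := h1 0 (by omega)
    simp only [hh, sub_self] at h4
    rw [zero_pow (by omega)] at h4
    have h6 : m * E * (y - u) ≤ m * E * 1 := by
      gcongr; linarith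
    push_cast
    simp only [mul_zero, zero_div] at h4
    linarith

theorem sep_right {k : ℕ} (hk : 1 ≤ k) {q q' : ℝ[X]} {u u' y γ E c₀ : ℝ} (hE : 0 ≤ E) (hγ : 0 ≤ γ)
    (hc : 0 ≤ c₀) (huu : u' ≤ u) (huy : u + c₀ ≤ y) (hy : y ≤ u' + 1)
    (hq : ∀ j < k, |dv j q u| ≤ E) (hq' : ∀ j < k, |dv j q' u'| ≤ E)
    (h1 : ∀ z ∈ Set.Icc u' y, γ ≤ dv k q' z)
    (h2 : ∀ z ∈ Set.Icc u y, dv k q z - E ≤ dv k q' z) :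
    γ * c₀ ^ (k - 1) / (k - 1).factorial * (u - u') - (k + 2) ^ 2 * E ≤ dv 0 q' y - dv 0 q y := by
  have huy' : u ≤ y := by linarith
  have hj : ∀ j < k, γ * (u - u') ^ (k - j) / (k - j).factorial - k * E ≤ dv j q' u := by
    intro j hj
    have := dv_lower (m := k - j) (p := derivative^[j] q') (u := u') (y := u) (E := E) (A := γ) hE
      huu (by linarith)
      (fun i hi => by rw [dv_iterate]; exact (abs_le.1 (hq' _ (by omega))).1)
      (fun z hz => by
        rw [dv_iterate, show k - j + j = k by omega]
        exact h1 z ⟨hz.1, hz.2.trans huy'⟩)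
    rw [dv_iterate, zero_add] at this
    refine le_trans ?_ this
    have : ((k - j : ℕ) : ℝ) ≤ k := by exact_mod_cast Nat.sub_le k j
    nlinarith
  have hpos : ∀ j, 0 ≤ γ * (u - u') ^ (k - j) / (k - j).factorial := by
    intro j
    have : 0 ≤ u - u' := by linarith
    positivity
  set p := q' - q with hp
  have hp1 : ∀ j < k, -((k + 1) * E) ≤ dv j p u := by
    intro j hjk
    rw [hp, dv_sub]
    have e1 := hj j hjk
    have e2 := hpos j
    have e3 := (abs_le.1 (hq j hjk)).2
    linarith
  have hp2 : γ * (u - u') - (k + 1) * E ≤ dv (k - 1) p u := by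
    rw [hp, dv_sub]
    have e1 := hj (k - 1) (by omega)
    rw [show k - (k - 1) = 1 by omega] at e1
    simp only [pow_one, Nat.factorial_one, Nat.cast_one, div_one] at e1
    have e3 := (abs_le.1 (hq (k - 1) (by omega))).2
    linarith
  have hp3 : ∀ z ∈ Set.Icc u y, γ * (u - u') - (k + 2) * E ≤ dv (k - 1) p z := by
    intro z hz
    have := dv_ge (j := k - 1) (p := p) (u := u) (z := z) (A := -E) hz.1 (fun w hw => by
      rw [show k - 1 + 1 = k by omega, hp, dv_sub]
      have := h2 w ⟨hw.1, hw.2.trans hz.2⟩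
      linarith)
    have e2 : E * (z - u) ≤ E * 1 := by
      have := hz.2
      gcongr; linarith
    linarith
  have h3 := dv_lower (m := k - 1) (p := p) (u := u) (y := y) (E := (k + 1) * E)
    (A := γ * (u - u') - (k + 2) * E) (by positivity) huy' (by linarith)
    (fun j hj => hp1 j (by omega)) hp3
  rw [show dv 0 p y = dv 0 q' y - dv 0 q y from by rw [hp, dv_sub]] at h3
  refine le_trans ?_ h3
  set N : ℝ := ((k - 1).factorial : ℝ) with hN
  have hN1 : 1 ≤ N := by
    rw [hN]; exact_mod_cast Nat.succ_le_of_lt (Nat.factorial_pos _)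
  have hk1 : ((k - 1 : ℕ) : ℝ) = k - 1 := by
    rw [Nat.cast_sub hk]; simp
  rw [hk1]
  have e1 : γ * (u - u') * c₀ ^ (k - 1) / N ≤ γ * (u - u') * (y - u) ^ (k - 1) / N := by
    have : 0 ≤ u - u' := by linarith
    gcongr; linarith
  have e2 : (k + 2) * E * (y - u) ^ (k - 1) / N ≤ (k + 2) * E := by
    rw [div_le_iff₀ (by linarith)]
    have : (y - u) ^ (k - 1) ≤ 1 := pow_le_one₀ (by linarith) (by linarith)
    have : (k + 2) * E * (y - u) ^ (k - 1) ≤ (k + 2) * E * 1 := by gcongr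
    have : (k + 2) * E * 1 ≤ (k + 2) * E * N := by gcongr
    linarith
  have e3 : (γ * (u - u') - (k + 2) * E) * (y - u) ^ (k - 1) / N =
      γ * (u - u') * (y - u) ^ (k - 1) / N - (k + 2) * E * (y - u) ^ (k - 1) / N := by ring
  have e4 : γ * c₀ ^ (k - 1) / N * (u - u') = γ * (u - u') * c₀ ^ (k - 1) / N := by ring
  rw [e3, e4]
  have hk0 : (1 : ℝ) ≤ k := by exact_mod_cast hk
  nlinarith

theorem sep_aux {k : ℕ} (hk : 1 ≤ k) {q q' : ℝ[X]} {g : ℝ → ℝ} {a b u u' y γ E c₀ : ℝ} (hE : 0 ≤ E)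
    (hγ : E ≤ γ) (hc : 0 ≤ c₀) (hab : b ≤ a + 1)
    (hu : u ∈ Set.Icc a b) (hu' : u' ∈ Set.Icc a b) (hy : y ∈ Set.Icc a b)
    (hg : ∀ x ∈ Set.Icc a b, 2 * γ ≤ g x)
    (hside : (u + c₀ ≤ y ∧ u' ≤ u) ∨ (y + c₀ ≤ u ∧ u ≤ u'))
    (hq : ∀ j < k, |dv j q u| ≤ E) (hq' : ∀ j < k, |dv j q' u'| ≤ E)
    (h1 : ∀ x ∈ Set.Icc a b, |dv k q x - g x| ≤ E)
    (h2 : ∀ x ∈ Set.Icc a b, |dv k q' x - g x| ≤ E) :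
    γ * c₀ ^ (k - 1) / (k - 1).factorial * |u - u'| - 2 * (k + 2) ^ 2 * E ≤
      |dv 0 q' y - dv 0 q y| := by
  have hγ0 : 0 ≤ γ := hE.trans hγ
  rcases hside with ⟨h3, h4⟩ | ⟨h3, h4⟩
  · have := sep_right (E := 2 * E) hk (by linarith) hγ0 hc h4 h3 (by linarith [hy.2, hu'.1])
      (fun j hj => (hq j hj).trans (by linarith)) (fun j hj => (hq' j hj).trans (by linarith))
      (fun z hz => by
        have hz' : z ∈ Set.Icc a b := ⟨hu'.1.trans hz.1, hz.2.trans hy.2⟩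
        have e1 := hg z hz'
        have e2 := abs_le.1 (h2 z hz')
        linarith)
      (fun z hz => by
        have hz' : z ∈ Set.Icc a b := ⟨hu.1.trans hz.1, hz.2.trans hy.2⟩
        have e1 := abs_le.1 (h1 z hz')
        have e2 := abs_le.1 (h2 z hz')
        linarith)
    rw [abs_of_nonneg (by linarith : 0 ≤ u - u')]
    refine le_trans ?_ (le_abs_self _)
    linarith
  · set R : ℝ[X] → ℝ[X] := fun p => C ((-1) ^ k) * p.comp (C 0 + C (-1) * X) with hR
    have hRd : ∀ j p x, dv j (R p) x = (-1) ^ k * ((-1) ^ j * dv j p (-x)) := by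
      intro j p x
      rw [hR]
      simp only
      rw [dv_C_mul, dv_comp]; simp
    have hRa : ∀ j p x, |dv j (R p) x| = |dv j p (-x)| := by
      intro j p x
      rw [hRd, abs_mul, abs_mul, abs_pow, abs_pow]; simp
    have hRk : ∀ p x, dv k (R p) x = dv k p (-x) := by
      intro p x
      rw [hRd, ← mul_assoc, ← mul_pow]; simp
    have := sep_right (q := R q) (q' := R q') (u := -u) (u' := -u') (y := -y) (γ := γ) (c₀ := c₀)
      (E := 2 * E) hk (by linarith) hγ0 hc (by linarith) (by linarith)
      (by linarith [hy.1, hu'.2])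
      (fun j hj => by rw [hRa, neg_neg]; exact (hq j hj).trans (by linarith))
      (fun j hj => by rw [hRa, neg_neg]; exact (hq' j hj).trans (by linarith))
      (fun z hz => by
        have hz' : -z ∈ Set.Icc a b := ⟨by linarith [hz.2, hy.1], by linarith [hz.1, hu'.2]⟩
        have e1 := hg _ hz'
        have e2 := abs_le.1 (h2 _ hz')
        rw [hRk]
        linarith)
      (fun z hz => by
        have hz' : -z ∈ Set.Icc a b := ⟨by linarith [hz.2, hy.1], by linarith [hz.1, hu.2]⟩
        have e1 := abs_le.1 (h1 _ hz')
        have e2 := abs_le.1 (h2 _ hz')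
        rw [hRk, hRk]
        linarith)
    rw [abs_of_nonpos (by linarith : u - u' ≤ 0)]
    rw [hRd, hRd, neg_neg] at this
    have e5 : (-1 : ℝ) ^ k * ((-1) ^ 0 * dv 0 q' y) - (-1) ^ k * ((-1) ^ 0 * dv 0 q y) ≤
        |dv 0 q' y - dv 0 q y| := by
      refine (le_abs_self _).trans (le_of_eq ?_)
      rw [pow_zero, one_mul, one_mul, ← mul_sub, abs_mul, abs_pow]; simp
    refine le_trans ?_ (this.trans e5)
    linarith

theorem sep {k : ℕ} (hk : 1 ≤ k) {q q' : ℝ[X]} {g : ℝ → ℝ} {a b u u' y γ E c₀ : ℝ} (hE : 0 ≤ E)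
    (hγ : E ≤ γ) (hc : 0 ≤ c₀) (hab : b ≤ a + 1)
    (hu : u ∈ Set.Icc a b) (hu' : u' ∈ Set.Icc a b) (hy : y ∈ Set.Icc a b)
    (hg : ∀ x ∈ Set.Icc a b, 2 * γ ≤ g x)
    (hside : (u + c₀ ≤ y ∧ u' + c₀ ≤ y) ∨ (y + c₀ ≤ u ∧ y + c₀ ≤ u'))
    (hq : ∀ j < k, |dv j q u| ≤ E) (hq' : ∀ j < k, |dv j q' u'| ≤ E)
    (h1 : ∀ x ∈ Set.Icc a b, |dv k q x - g x| ≤ E)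
    (h2 : ∀ x ∈ Set.Icc a b, |dv k q' x - g x| ≤ E) :
    γ * c₀ ^ (k - 1) / (k - 1).factorial * |u - u'| - 2 * (k + 2) ^ 2 * E ≤
      |dv 0 q' y - dv 0 q y| := by
  rcases hside with ⟨h3, h4⟩ | ⟨h3, h4⟩ <;> rcases le_total u u' with h5 | h5
  · rw [abs_sub_comm, abs_sub_comm (dv 0 q' y)]
    exact sep_aux hk hE hγ hc hab hu' hu hy hg (Or.inl ⟨h4, h5⟩) hq' hq h2 h1
  · exact sep_aux hk hE hγ hc hab hu hu' hy hg (Or.inl ⟨h3, h5⟩) hq hq' h1 h2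
  · exact sep_aux hk hE hγ hc hab hu hu' hy hg (Or.inr ⟨h3, h5⟩) hq hq' h1 h2
  · rw [abs_sub_comm, abs_sub_comm (dv 0 q' y)]
    exact sep_aux hk hE hγ hc hab hu' hu hy hg (Or.inr ⟨h4, h5⟩) hq' hq h2 h1

/-- The operator `p ↦ (X - u) p' - m p`. -/
def tilt (u : ℝ) (m : ℕ) (p : ℝ[X]) : ℝ[X] := (X - C u) * derivative p - C (m : ℝ) * p

theorem dv_tilt (u : ℝ) (m j : ℕ) (p : ℝ[X]) (x : ℝ) :
    dv j (tilt u m p) x = (x - u) * dv (j + 1) p x + ((j : ℝ) - m) * dv j p x := by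
  have h : ∀ j (q : ℝ[X]), dv j ((X - C u) * q) x = (x - u) * dv j q x + j * dv (j - 1) q x := by
    intro j
    induction j with
    | zero => intro q; simp [dv]
    | succ j ih =>
      intro q
      rw [← dv_derivative, derivative_mul, dv_add, ih, dv_derivative]
      have : derivative (X - C u : ℝ[X]) = 1 := by simp
      rw [this, one_mul]
      rcases j with _ | j
      · simp
        ring
      · simp only [Nat.add_sub_cancel, dv_derivative]
        push_cast; ring
  rw [tilt, dv_sub, h, dv_derivative, dv_C_mul]
  rcases j with _ | j
  · simp; ring
  · simp only [Nat.add_sub_cancel, dv_derivative]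
    ring

end Jets

section Families

open Polynomial

variable {X G : Type*} [TopologicalSpace X] [CompactSpace X] [MeasurableSpace X] [BorelSpace X]
  [AddCommGroup G] {μ : Measure X} [IsProbabilityMeasure μ] {e : G → C(X, ℂ)}

/-- Frequencies in the anisotropic neighbourhood of the point of the curve with parameter `u`. -/
def Adm (k : ℕ) (Φ : G →+ ℝ[X]) (δ B a b : ℝ) (g : ℝ → ℝ) (u : ℝ) : Set G :=
  {ξ | (∀ j < k, |dv j (Φ ξ) u| ≤ B * δ ^ (k - j)) ∧
    ∀ x ∈ Set.Icc a b, |dv k (Φ ξ) x - g x| ≤ B * δ ^ k}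

/-- Frequencies whose polynomial is negligible at scale `δ ^ k`. -/
def Thin (k : ℕ) (Φ : G →+ ℝ[X]) (δ B a b : ℝ) : Set G :=
  {ξ | ∀ j ≤ k, ∀ x ∈ Set.Icc a b, |dv j (Φ ξ) x| ≤ B * δ ^ k}

/-- The scale, the interval, the phase and the weight shared by the families below. -/
structure Setup (e : G → C(X, ℂ)) (k : ℕ) (B : ℝ) where
  (δ a b : ℝ)
  Φ : G →+ ℝ[X]
  g : ℝ → ℝ
  H : C(X, ℂ)
  δ_pos : 0 < δ
  δ_le : δ ≤ 1
  hab : a ≤ b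
  hab' : b ≤ a + 1
  hg : ∀ x ∈ Set.Icc a b, 1 / B ≤ g x ∧ g x ≤ B
  hH : H ∈ Spec e (Thin k Φ δ B a b)

/-- A family of functions with frequencies near a `δ`-separated set of points of the curve. -/
structure Fam {e : G → C(X, ℂ)} {k : ℕ} {B : ℝ} (S : Setup e k B) where
  s : Finset ℕ
  u : ℕ → ℝ
  f : ℕ → C(X, ℂ)
  hu : ∀ i ∈ s, u i ∈ Set.Icc S.a S.b
  sep : ∀ i ∈ s, ∀ j ∈ s, i ≠ j → S.δ ≤ |u i - u j|
  hf : ∀ i ∈ s, f i ∈ Spec e (Adm k S.Φ S.δ B S.a S.b S.g (u i))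

variable {k : ℕ} {B : ℝ} {S : Setup e k B}

namespace Fam

def sum (T : Fam S) : C(X, ℂ) := ∑ i ∈ T.s, T.f i

def W (μ : Measure X) (P : ℕ) (T : Fam S) : ℝ :=
  ∑ i ∈ T.s, ∫ x, ‖T.f i x‖ ^ P * ‖S.H x‖ ^ 2 ∂μ

def In (T : Fam S) (a b : ℝ) : Prop := ∀ i ∈ T.s, T.u i ∈ Set.Icc a b

theorem W_nonneg (T : Fam S) (P : ℕ) : 0 ≤ T.W μ P :=
  Finset.sum_nonneg fun _ _ => integral_nonneg fun _ => by positivity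

/-- The members of the family whose parameter lies in the `m`-th interval of length `ρ`. -/
def cell (T : Fam S) (a ρ : ℝ) (m : ℕ) : Fam S where
  s := T.s.filter fun i => ⌊(T.u i - a) / ρ⌋₊ = m
  u := T.u
  f := T.f
  hu i hi := T.hu i (Finset.mem_filter.1 hi).1
  sep i hi j hj := T.sep i (Finset.mem_filter.1 hi).1 j (Finset.mem_filter.1 hj).1
  hf i hi := T.hf i (Finset.mem_filter.1 hi).1

theorem cell_mem_range {T : Fam S} {a b ρ ρ' : ℝ} (hT : T.In a b) (hb : b - a ≤ ρ) (hρ' : 0 < ρ')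
    {i : ℕ} (hi : i ∈ T.s) : ⌊(T.u i - a) / ρ'⌋₊ ∈ Finset.range (⌊ρ / ρ'⌋₊ + 1) := by
  rw [Finset.mem_range, Nat.lt_succ_iff]
  apply Nat.floor_le_floor
  have := (hT i hi).2
  gcongr
  linarith

theorem sum_cell {T : Fam S} {a b ρ ρ' : ℝ} (hT : T.In a b) (hb : b - a ≤ ρ) (hρ' : 0 < ρ') :
    T.sum = ∑ m ∈ Finset.range (⌊ρ / ρ'⌋₊ + 1), (T.cell a ρ' m).sum :=
  (Finset.sum_fiberwise_of_maps_to (fun _ hi => cell_mem_range hT hb hρ' hi) _).symm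

theorem W_cell {T : Fam S} {a b ρ ρ' : ℝ} (hT : T.In a b) (hb : b - a ≤ ρ) (hρ' : 0 < ρ') (P : ℕ) :
    T.W μ P = ∑ m ∈ Finset.range (⌊ρ / ρ'⌋₊ + 1), (T.cell a ρ' m).W μ P :=
  (Finset.sum_fiberwise_of_maps_to (fun _ hi => cell_mem_range hT hb hρ' hi) _).symm

theorem cell_In {T : Fam S} {a b ρ' : ℝ} (hT : T.In a b) (hρ' : 0 < ρ') (m : ℕ) :
    (T.cell a ρ' m).In (min b (a + m * ρ')) (min b (a + (m + 1) * ρ')) := by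
  intro i hi
  obtain ⟨hi, hm⟩ := Finset.mem_filter.1 hi
  have h0 : 0 ≤ (T.u i - a) / ρ' := by
    have := (hT i hi).1
    apply div_nonneg <;> linarith
  have h1 := Nat.floor_le h0
  have h2 := Nat.lt_floor_add_one ((T.u i - a) / ρ')
  rw [hm] at h1 h2
  rw [le_div_iff₀ hρ'] at h1
  rw [div_lt_iff₀ hρ'] at h2
  exact ⟨(min_le_right _ _).trans (by simp only [cell]; linarith),
    le_min (hT i hi).2 (by simp only [cell]; linarith)⟩

theorem cell_len {a b ρ' : ℝ} (hρ' : 0 < ρ') (m : ℕ) :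
    min b (a + m * ρ') ≤ min b (a + (m + 1) * ρ') ∧
    min b (a + (m + 1) * ρ') - min b (a + m * ρ') ≤ ρ' := by
  have h : a + (m + 1) * ρ' = a + m * ρ' + ρ' := by ring
  rw [h]
  constructor
  · exact min_le_min le_rfl (by linarith)
  · rcases le_total b (a + m * ρ') with h1 | h1
    · rw [min_eq_left h1, min_eq_left (by linarith)]; linarith
    · rw [min_eq_right h1]
      linarith [min_le_right b (a + m * ρ' + ρ')]

theorem cell_left {a b ρ' : ℝ} (hρ' : 0 < ρ') (hab : a ≤ b) (m : ℕ) : a ≤ min b (a + m * ρ') :=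
  le_min hab (by have : 0 ≤ m * ρ' := by positivity
                 linarith)

end Fam

theorem card_cells {ρ ρ' : ℝ} (hρ' : 0 < ρ') (h : ρ' ≤ ρ) :
    ((Finset.range (⌊ρ / ρ'⌋₊ + 1)).card : ℝ) ≤ 2 * (ρ / ρ') := by
  rw [Finset.card_range]
  push_cast
  have h1 : 1 ≤ ρ / ρ' := by rwa [le_div_iff₀ hρ', one_mul]
  have := Nat.floor_le (by linarith : 0 ≤ ρ / ρ')
  linarith

theorem Fam.card_le (T : Fam S) : (T.s.card : ℝ) ≤ 2 / S.δ := by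
  have hIn : T.In S.a S.b := T.hu
  have h1 : T.s.card ≤ (Finset.range (⌊1 / S.δ⌋₊ + 1)).card := by
    refine Finset.card_le_card_of_injOn (fun i => ⌊(T.u i - S.a) / S.δ⌋₊)
      (fun i hi => cell_mem_range hIn (by linarith [S.hab']) S.δ_pos hi) ?_
    intro i hi j hj hij
    by_contra hne
    have hsep := T.sep i hi j hj hne
    simp only at hij
    have hp : ∀ i ∈ T.s, 0 ≤ (T.u i - S.a) / S.δ := fun i hi =>
      div_nonneg (by linarith [(T.hu i hi).1]) S.δ_pos.le
    have a1 := Nat.floor_le (hp i hi)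
    have a2 := Nat.lt_floor_add_one ((T.u i - S.a) / S.δ)
    have b1 := Nat.floor_le (hp j hj)
    have b2 := Nat.lt_floor_add_one ((T.u j - S.a) / S.δ)
    rw [hij] at a1 a2
    rw [le_div_iff₀ S.δ_pos] at a1 b1
    rw [div_lt_iff₀ S.δ_pos] at a2 b2
    have : |T.u i - T.u j| < S.δ := by
      rw [abs_lt]; constructor <;> linarith
    linarith
  have h2 := card_cells S.δ_pos S.δ_le
  have h3 : (T.s.card : ℝ) ≤ ((Finset.range (⌊1 / S.δ⌋₊ + 1)).card : ℝ) := by exact_mod_cast h1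
  refine (h3.trans h2).trans (le_of_eq ?_)
  ring

/-- Jensen's inequality in the form used for averages over cells. -/
theorem avg_pow_le {ι : Type*} (s : Finset ι) (z : ι → ℝ) (hz : ∀ i ∈ s, 0 ≤ z i) {c K : ℝ} (hc : 0 ≤ c)
    (hK : c * s.card ≤ K) {P : ℕ} (hP : 1 ≤ P) :
    (c * ∑ i ∈ s, z i) ^ P ≤ K ^ (P - 1) * (c * ∑ i ∈ s, z i ^ P) := by
  obtain ⟨p, rfl⟩ : ∃ p, P = p + 1 := ⟨P - 1, by omega⟩
  have h := pow_sum_le_card_mul_sum_pow hz p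
  have h0 : 0 ≤ ∑ i ∈ s, z i ^ (p + 1) := Finset.sum_nonneg fun i hi => pow_nonneg (hz i hi) _
  calc (c * ∑ i ∈ s, z i) ^ (p + 1) = c ^ (p + 1) * (∑ i ∈ s, z i) ^ (p + 1) := mul_pow _ _ _
    _ ≤ c ^ (p + 1) * (s.card ^ p * ∑ i ∈ s, z i ^ (p + 1)) := by gcongr
    _ = (c * s.card) ^ p * (c * ∑ i ∈ s, z i ^ (p + 1)) := by ring
    _ ≤ K ^ p * (c * ∑ i ∈ s, z i ^ (p + 1)) := by gcongr
    _ = _ := by simp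

theorem integral_avg_pow_le {ι : Type*} (s : Finset ι) (f : ι → C(X, ℂ)) {w : X → ℝ}
    (hw : Continuous w) (hw0 : ∀ x, 0 ≤ w x) {c K : ℝ} (hc : 0 ≤ c)
    (hK : c * s.card ≤ K) {P : ℕ} (hP : 1 ≤ P) :
    ∫ x, (c * ‖(∑ i ∈ s, f i) x‖) ^ P * w x ∂μ ≤
      K ^ (P - 1) * (c * ∑ i ∈ s, ∫ x, ‖f i x‖ ^ P * w x ∂μ) := by
  rw [← integral_finsetSum _ fun i _ => cint (by fun_prop), ← integral_const_mul,
    ← integral_const_mul]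
  refine integral_mono (cint (by fun_prop)) (cint (by fun_prop)) fun x => ?_
  have h1 := avg_pow_le s (fun i => ‖f i x‖) (fun i _ => norm_nonneg _) hc hK hP
  have h2 : c * ‖(∑ i ∈ s, f i) x‖ ≤ c * ∑ i ∈ s, ‖f i x‖ := by
    rw [ContinuousMap.sum_apply]
    gcongr
    exact norm_sum_le _ _
  calc (c * ‖(∑ i ∈ s, f i) x‖) ^ P * w x ≤ (c * ∑ i ∈ s, ‖f i x‖) ^ P * w x := by
        have := hw0 x
        gcongr
    _ ≤ K ^ (P - 1) * (c * ∑ i ∈ s, ‖f i x‖ ^ P) * w x :=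
        mul_le_mul_of_nonneg_right h1 (hw0 x)
    _ = _ := by simp only [← Finset.sum_mul]; ring

/-- The phase `ξ ↦ c p_ξ(a + ρ x)`. -/
def scalePhase (Φ : G →+ ℝ[X]) (c a ρ : ℝ) : G →+ ℝ[X] where
  toFun ξ := C c * (Φ ξ).comp (C a + C ρ * Polynomial.X)
  map_zero' := by simp
  map_add' := by intro x y; simp [mul_add]

theorem dv_scalePhase (Φ : G →+ ℝ[X]) (c a ρ : ℝ) (j : ℕ) (ξ : G) (x : ℝ) :
    dv j (scalePhase Φ c a ρ ξ) x = c * (ρ ^ j * dv j (Φ ξ) (a + ρ * x)) := by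
  show dv j (C c * (Φ ξ).comp (C a + C ρ * Polynomial.X)) x = _
  rw [dv_C_mul, dv_comp]

theorem affine_mem {a b ρ x : ℝ} (hρ : 0 < ρ) (hx : x ∈ Set.Icc 0 ((b - a) / ρ)) :
    a + ρ * x ∈ Set.Icc a b := by
  have h1 := hx.2
  rw [le_div_iff₀ hρ] at h1
  have := mul_nonneg hρ.le hx.1
  constructor <;> linarith

theorem unscale_mem {a b ρ u : ℝ} (hρ : 0 < ρ) (hu : u ∈ Set.Icc a b) :
    (u - a) / ρ ∈ Set.Icc 0 ((b - a) / ρ) :=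
  ⟨div_nonneg (by linarith [hu.1]) hρ.le, by have := hu.2; gcongr⟩

/-- Restriction to the subinterval `[a', b']` of length at most `ρ`, rescaled to unit size. -/
def Setup.rescale (S : Setup e k B) (hB : 0 ≤ B) {a' b' ρ : ℝ} (ha : S.a ≤ a') (hab : a' ≤ b')
    (hb : b' ≤ S.b) (hρ : b' - a' ≤ ρ) (hδ : S.δ ≤ ρ) (hρ1 : ρ ≤ 1) : Setup e k B :=
  have hρ0 : 0 < ρ := S.δ_pos.trans_le hδ
  have hsub : ∀ x ∈ Set.Icc 0 ((b' - a') / ρ), a' + ρ * x ∈ Set.Icc S.a S.b := fun x hx =>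
    ⟨ha.trans (affine_mem hρ0 hx).1, (affine_mem hρ0 hx).2.trans hb⟩
  { δ := S.δ / ρ
    a := 0
    b := (b' - a') / ρ
    Φ := scalePhase S.Φ (ρ ^ k)⁻¹ a' ρ
    g := fun x => S.g (a' + ρ * x)
    H := S.H
    δ_pos := div_pos S.δ_pos hρ0
    δ_le := by rwa [div_le_iff₀ hρ0, one_mul]
    hab := div_nonneg (by linarith) hρ0.le
    hab' := by rw [zero_add, div_le_iff₀ hρ0, one_mul]; exact hρ
    hg := fun x hx => S.hg _ (hsub x hx)
    hH := by
      refine Spec.mono ?_ S.hH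
      intro ξ hξ j hj x hx
      rw [dv_scalePhase, abs_mul, abs_mul, abs_of_pos (by positivity : 0 < (ρ ^ k)⁻¹),
        abs_of_pos (by positivity : 0 < ρ ^ j)]
      have h1 := hξ j hj _ (hsub x hx)
      have h2 : ρ ^ j ≤ 1 := pow_le_one₀ hρ0.le hρ1
      have h3 : 0 ≤ B * S.δ ^ k := by have := S.δ_pos; positivity
      calc (ρ ^ k)⁻¹ * (ρ ^ j * |dv j (S.Φ ξ) (a' + ρ * x)|)
          ≤ (ρ ^ k)⁻¹ * (1 * (B * S.δ ^ k)) := by gcongr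
        _ = B * (S.δ / ρ) ^ k := by rw [div_pow]; field_simp }

/-- The family transported to the rescaled setup. -/
def Fam.rescale (T : Fam S) (hB : 0 ≤ B) {a' b' ρ : ℝ} (ha : S.a ≤ a') (hab : a' ≤ b')
    (hb : b' ≤ S.b) (hρ : b' - a' ≤ ρ) (hδ : S.δ ≤ ρ) (hρ1 : ρ ≤ 1) (hT : T.In a' b') :
    Fam (S.rescale hB ha hab hb hρ hδ hρ1) :=
  have hρ0 : 0 < ρ := S.δ_pos.trans_le hδ
  { s := T.s
    u := fun i => (T.u i - a') / ρ
    f := T.f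
    hu := fun i hi => unscale_mem hρ0 (hT i hi)
    sep := fun i hi j hj hij => by
      show S.δ / ρ ≤ _
      have := T.sep i hi j hj hij
      rw [← sub_div, abs_div, abs_of_pos hρ0]
      gcongr
      simpa using this
    hf := fun i hi => by
      refine Spec.mono ?_ (T.hf i hi)
      rintro ξ ⟨h1, h2⟩
      refine ⟨fun j hj => ?_, fun x hx => ?_⟩
      · show |dv j (scalePhase S.Φ (ρ ^ k)⁻¹ a' ρ ξ) _| ≤ B * (S.δ / ρ) ^ (k - j)
        rw [dv_scalePhase, abs_mul, abs_mul, abs_of_pos (by positivity : 0 < (ρ ^ k)⁻¹),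
          abs_of_pos (by positivity : 0 < ρ ^ j)]
        have e1 : a' + ρ * ((T.u i - a') / ρ) = T.u i := by field_simp; ring
        rw [e1]
        have e2 : ρ ^ k = ρ ^ j * ρ ^ (k - j) := by rw [← pow_add]; congr 1; omega
        calc (ρ ^ k)⁻¹ * (ρ ^ j * |dv j (S.Φ ξ) (T.u i)|)
            ≤ (ρ ^ k)⁻¹ * (ρ ^ j * (B * S.δ ^ (k - j))) := by
              have := h1 j hj
              gcongr
          _ = B * (S.δ / ρ) ^ (k - j) := by rw [div_pow, e2]; field_simp
      · show |dv k (scalePhase S.Φ (ρ ^ k)⁻¹ a' ρ ξ) x - S.g (a' + ρ * x)| ≤ B * (S.δ / ρ) ^ k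
        have hm := affine_mem hρ0 (show x ∈ Set.Icc 0 ((b' - a') / ρ) from hx)
        have h3 := h2 (a' + ρ * x) ⟨ha.trans hm.1, hm.2.trans hb⟩
        rw [dv_scalePhase, ← mul_assoc, inv_mul_cancel₀ (by positivity), one_mul]
        refine h3.trans ?_
        have : S.δ ≤ S.δ / ρ := by
          rw [le_div_iff₀ hρ0]
          have := S.δ_pos
          nlinarith
        have h0 := S.δ_pos
        gcongr }

/-- The decoupling-type inequality of degree `k`, exponent `P` and gain `η`. -/
def Dec (μ : Measure X) (e : G → C(X, ℂ)) (k P : ℕ) (η : ℝ) : Prop :=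
  ∀ B : ℝ, 1 ≤ B → ∃ K : ℝ, 0 ≤ K ∧ ∀ (S : Setup e k B) (T : Fam S),
    ∫ x, (S.δ * ‖T.sum x‖) ^ P * ‖S.H x‖ ^ 2 ∂μ ≤ K * S.δ ^ η * (S.δ * T.W μ P)

theorem Dec.rescaled {P : ℕ} {η : ℝ} (h : Dec μ e k P η) {B : ℝ} (hB : 1 ≤ B) :
    ∃ K : ℝ, 0 ≤ K ∧ ∀ (S : Setup e k B) (T : Fam S) (a' b' ρ : ℝ), S.a ≤ a' → a' ≤ b' → b' ≤ S.b →
      b' - a' ≤ ρ → S.δ ≤ ρ → ρ ≤ 1 → T.In a' b' →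
      ∫ x, (S.δ / ρ * ‖T.sum x‖) ^ P * ‖S.H x‖ ^ 2 ∂μ ≤
        K * (S.δ / ρ) ^ η * (S.δ / ρ * T.W μ P) := by
  obtain ⟨K, hK, h⟩ := h B hB
  refine ⟨K, hK, fun S T a' b' ρ h1 h2 h3 h4 h5 h6 h7 => ?_⟩
  exact h (S.rescale (by linarith) h1 h2 h3 h4 h5 h6) (T.rescale (by linarith) h1 h2 h3 h4 h5 h6 h7)

theorem Dec.zero (k : ℕ) {P : ℕ} (hP : 1 ≤ P) : Dec μ e k P 0 := by
  intro B _
  refine ⟨2 ^ (P - 1), by positivity, fun S T => ?_⟩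
  rw [rpow_zero, mul_one]
  refine integral_avg_pow_le (w := fun x => ‖S.H x‖ ^ 2) T.s T.f (by fun_prop)
    (fun x => by positivity) S.δ_pos.le ?_ hP
  have := T.card_le
  rw [le_div_iff₀ S.δ_pos] at this
  linarith

/-- The transversality constant. -/
def c₀ : ℝ := 1 / 32

/-- Two families supported in separated subintervals. -/
structure BilFam {S : Setup e k B} (T₁ T₂ : Fam S) (a₁ b₁ a₂ b₂ : ℝ) : Prop where
  in₁ : T₁.In a₁ b₁
  in₂ : T₂.In a₂ b₂
  le₁ : a₁ ≤ b₁
  le₂ : a₂ ≤ b₂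
  ha₁ : S.a ≤ a₁
  ha₂ : S.a ≤ a₂
  hb₁ : b₁ ≤ S.b
  hb₂ : b₂ ≤ S.b
  sep : b₁ + c₀ ≤ a₂ ∨ b₂ + c₀ ≤ a₁

/-- The asymmetric bilinear inequality at scales `δ ^ α` and `δ ^ β`, with gain `x`. -/
def Bil (μ : Measure X) (e : G → C(X, ℂ)) (k h : ℕ) (α β x : ℝ) : Prop :=
  ∀ B : ℝ, 1 ≤ B → ∃ K : ℝ, 0 ≤ K ∧ ∀ (S : Setup e k B) (T₁ T₂ : Fam S) (a₁ b₁ a₂ b₂ : ℝ),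
    BilFam T₁ T₂ a₁ b₁ a₂ b₂ → b₁ - a₁ ≤ S.δ ^ α → b₂ - a₂ ≤ S.δ ^ β →
    ∫ y, (S.δ / S.δ ^ α * ‖T₁.sum y‖) ^ 2 * (S.δ / S.δ ^ β * ‖T₂.sum y‖) ^ (2 * h) *
      ‖S.H y‖ ^ 2 ∂μ ≤
      K * S.δ ^ x * (S.δ / S.δ ^ α * T₁.W μ (2 * h + 2) + S.δ / S.δ ^ β * T₂.W μ (2 * h + 2))

end Families

section Moves

open Polynomial

variable {X G : Type*} [TopologicalSpace X] [CompactSpace X] [MeasurableSpace X] [BorelSpace X]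
  [AddCommGroup G] {μ : Measure X} [IsProbabilityMeasure μ] {e : G → C(X, ℂ)}
  {k : ℕ} {B : ℝ} {S : Setup e k B}

theorem Fam.avg_le (T : Fam S) {a b ρ ρ' d : ℝ} (hT : T.In a b) (hb : b - a ≤ ρ) (hρ' : 0 < ρ')
    (hρ : ρ' ≤ ρ) (hd : 0 ≤ d) {P : ℕ} (hP : 1 ≤ P) {w : X → ℝ} (hw : Continuous w)
    (hw0 : ∀ x, 0 ≤ w x) :
    ∫ x, (d / ρ * ‖T.sum x‖) ^ P * w x ∂μ ≤ 2 ^ (P - 1) * (ρ' / ρ *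
      ∑ m ∈ Finset.range (⌊ρ / ρ'⌋₊ + 1), ∫ x, (d / ρ' * ‖(T.cell a ρ' m).sum x‖) ^ P * w x ∂μ) := by
  have hρ0 : 0 < ρ := hρ'.trans_le hρ
  have h := integral_avg_pow_le (μ := μ) (Finset.range (⌊ρ / ρ'⌋₊ + 1))
    (fun m => (T.cell a ρ' m).sum)
    (w := fun x => (d / ρ') ^ P * w x) (by fun_prop) (fun x => by have := hw0 x; positivity)
    (c := ρ' / ρ) (K := 2) (by positivity) (by
      have := card_cells hρ' hρ
      calc ρ' / ρ * _ ≤ ρ' / ρ * (2 * (ρ / ρ')) := by gcongr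
        _ = 2 := by field_simp) hP
  rw [← Fam.sum_cell hT hb hρ'] at h
  refine le_trans (le_of_eq ?_) (h.trans (le_of_eq ?_))
  · congr 1; ext x
    rw [← mul_assoc, ← mul_pow]
    congr 2
    field_simp
  · congr 2
    refine Finset.sum_congr rfl fun m _ => ?_
    congr 1; ext x
    rw [mul_pow]; ring

theorem Fam.W_avg (T : Fam S) {a b ρ ρ' d : ℝ} (hT : T.In a b) (hb : b - a ≤ ρ) (hρ' : 0 < ρ')
    (P : ℕ) :
    d / ρ * T.W μ P = ρ' / ρ *
      ∑ m ∈ Finset.range (⌊ρ / ρ'⌋₊ + 1), d / ρ' * (T.cell a ρ' m).W μ P := by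
  rw [Fam.W_cell hT hb hρ', Finset.mul_sum, Finset.mul_sum]
  refine Finset.sum_congr rfl fun m _ => ?_
  field_simp

theorem sum_avg_le {N : Finset ℕ} {r K W : ℝ} {I V : ℕ → ℝ} (hr : 0 ≤ r) (hN : r * N.card ≤ 2)
    (hK : 0 ≤ K) (hW : 0 ≤ W) (hV : ∀ m, 0 ≤ V m) (h : ∀ m ∈ N, I m ≤ K * (V m + W)) :
    r * ∑ m ∈ N, I m ≤ 2 * K * (r * ∑ m ∈ N, V m + W) := by
  have h0 : 0 ≤ ∑ m ∈ N, V m := Finset.sum_nonneg fun m _ => hV m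
  calc r * ∑ m ∈ N, I m ≤ r * ∑ m ∈ N, K * (V m + W) := by
        gcongr with m hm; exact h m hm
    _ = K * (r * ∑ m ∈ N, V m) + K * ((r * N.card) * W) := by
        rw [← Finset.mul_sum, Finset.sum_add_distrib, Finset.sum_const, nsmul_eq_mul]; ring
    _ ≤ K * (r * ∑ m ∈ N, V m) + K * (2 * W) := by gcongr
    _ ≤ _ := by
      have : 0 ≤ K * (r * ∑ m ∈ N, V m) := by positivity
      linarith

theorem cells_ratio {ρ ρ' : ℝ} (hρ' : 0 < ρ') (hρ : ρ' ≤ ρ) :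
    ρ' / ρ * (Finset.range (⌊ρ / ρ'⌋₊ + 1)).card ≤ 2 := by
  have hρ0 : 0 < ρ := hρ'.trans_le hρ
  have := card_cells hρ' hρ
  calc ρ' / ρ * _ ≤ ρ' / ρ * (2 * (ρ / ρ')) := by gcongr
    _ = 2 := by field_simp

theorem BilFam.cell₁ {T₁ T₂ : Fam S} {a₁ b₁ a₂ b₂ ρ : ℝ} (h : BilFam T₁ T₂ a₁ b₁ a₂ b₂) (hρ : 0 < ρ)
    (m : ℕ) : BilFam (T₁.cell a₁ ρ m) T₂ (min b₁ (a₁ + m * ρ)) (min b₁ (a₁ + (m + 1) * ρ)) a₂ b₂ where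
  in₁ := Fam.cell_In h.in₁ hρ m
  in₂ := h.in₂
  le₁ := (Fam.cell_len hρ m).1
  le₂ := h.le₂
  ha₁ := h.ha₁.trans (Fam.cell_left hρ h.le₁ m)
  ha₂ := h.ha₂
  hb₁ := (min_le_left _ _).trans h.hb₁
  hb₂ := h.hb₂
  sep := by
    have h1 := Fam.cell_left hρ h.le₁ m
    have h2 := min_le_left b₁ (a₁ + (m + 1) * ρ)
    rcases h.sep with h3 | h3
    · left; linarith
    · right; linarith

theorem BilFam.cell₂ {T₁ T₂ : Fam S} {a₁ b₁ a₂ b₂ ρ : ℝ} (h : BilFam T₁ T₂ a₁ b₁ a₂ b₂) (hρ : 0 < ρ)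
    (m : ℕ) : BilFam T₁ (T₂.cell a₂ ρ m) a₁ b₁ (min b₂ (a₂ + m * ρ)) (min b₂ (a₂ + (m + 1) * ρ)) where
  in₁ := h.in₁
  in₂ := Fam.cell_In h.in₂ hρ m
  le₁ := h.le₁
  le₂ := (Fam.cell_len hρ m).1
  ha₁ := h.ha₁
  ha₂ := h.ha₂.trans (Fam.cell_left hρ h.le₂ m)
  hb₁ := h.hb₁
  hb₂ := (min_le_left _ _).trans h.hb₂
  sep := by
    have h1 := Fam.cell_left hρ h.le₂ m
    have h2 := min_le_left b₂ (a₂ + (m + 1) * ρ)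
    rcases h.sep with h3 | h3
    · left; linarith
    · right; linarith

theorem Bil.mono {h : ℕ} {α β x x' : ℝ} (H : Bil μ e k h α β x) (hx : x' ≤ x) :
    Bil μ e k h α β x' := by
  intro B hB
  obtain ⟨K, hK, H⟩ := H B hB
  refine ⟨K, hK, fun S T₁ T₂ a₁ b₁ a₂ b₂ hf h1 h2 => (H S T₁ T₂ a₁ b₁ a₂ b₂ hf h1 h2).trans ?_⟩
  have h3 : S.δ ^ x ≤ S.δ ^ x' := rpow_le_rpow_of_exponent_ge S.δ_pos S.δ_le hx
  have h4 := T₁.W_nonneg (μ := μ) (2 * h + 2)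
  have h5 := T₂.W_nonneg (μ := μ) (2 * h + 2)
  have h6 := S.δ_pos
  gcongr

theorem Bil.shrink₁ {h : ℕ} {α α' β x : ℝ} (H : Bil μ e k h α β x) (hα : α' ≤ α) :
    Bil μ e k h α' β x := by
  intro B hB
  obtain ⟨K, hK, H⟩ := H B hB
  refine ⟨2 * (2 * K), by positivity, fun S T₁ T₂ a₁ b₁ a₂ b₂ hf h1 h2 => ?_⟩
  have hδ := S.δ_pos
  have hρ' : 0 < S.δ ^ α := by positivity
  have hρ : S.δ ^ α ≤ S.δ ^ α' := rpow_le_rpow_of_exponent_ge S.δ_pos S.δ_le hα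
  have h3 := T₁.avg_le (μ := μ) (d := S.δ) (P := 2) hf.in₁ h1 hρ' hρ hδ.le (by norm_num)
    (w := fun y => (S.δ / S.δ ^ β * ‖T₂.sum y‖) ^ (2 * h) * ‖S.H y‖ ^ 2) (by fun_prop)
    (fun y => by positivity)
  have h4 := sum_avg_le (N := Finset.range (⌊S.δ ^ α' / S.δ ^ α⌋₊ + 1)) (r := S.δ ^ α / S.δ ^ α')
    (K := K * S.δ ^ x) (W := S.δ / S.δ ^ β * T₂.W μ (2 * h + 2))
    (V := fun m => S.δ / S.δ ^ α * (T₁.cell a₁ (S.δ ^ α) m).W μ (2 * h + 2))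
    (I := fun m => ∫ y, (S.δ / S.δ ^ α * ‖(T₁.cell a₁ (S.δ ^ α) m).sum y‖) ^ 2 *
      ((S.δ / S.δ ^ β * ‖T₂.sum y‖) ^ (2 * h) * ‖S.H y‖ ^ 2) ∂μ)
    (by positivity) (cells_ratio hρ' hρ) (by positivity)
    (mul_nonneg (by positivity) (T₂.W_nonneg _))
    (fun m => mul_nonneg (by positivity) (Fam.W_nonneg _ _))
    (fun m _ => by
      have := H S _ _ _ _ _ _ (hf.cell₁ hρ' m) (Fam.cell_len hρ' m).2 h2
      simpa only [mul_assoc] using this)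
  rw [← Fam.W_avg T₁ hf.in₁ h1 hρ'] at h4
  simp only [mul_assoc] at h3 h4 ⊢
  refine h3.trans ?_
  norm_num at h3 h4 ⊢
  linarith

theorem Bil.shrink₂ {h : ℕ} (hh : 1 ≤ h) {α β β' x : ℝ} (H : Bil μ e k h α β x) (hβ : β' ≤ β) :
    Bil μ e k h α β' x := by
  intro B hB
  obtain ⟨K, hK, H⟩ := H B hB
  refine ⟨2 ^ (2 * h - 1) * (2 * K), by positivity, fun S T₁ T₂ a₁ b₁ a₂ b₂ hf h1 h2 => ?_⟩
  have hδ := S.δ_pos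
  have hρ' : 0 < S.δ ^ β := by positivity
  have hρ : S.δ ^ β ≤ S.δ ^ β' := rpow_le_rpow_of_exponent_ge S.δ_pos S.δ_le hβ
  have h3 := T₂.avg_le (μ := μ) (d := S.δ) (P := 2 * h) hf.in₂ h2 hρ' hρ hδ.le (by omega)
    (w := fun y => (S.δ / S.δ ^ α * ‖T₁.sum y‖) ^ 2 * ‖S.H y‖ ^ 2) (by fun_prop)
    (fun y => by positivity)
  have h4 := sum_avg_le (N := Finset.range (⌊S.δ ^ β' / S.δ ^ β⌋₊ + 1)) (r := S.δ ^ β / S.δ ^ β')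
    (K := K * S.δ ^ x) (W := S.δ / S.δ ^ α * T₁.W μ (2 * h + 2))
    (V := fun m => S.δ / S.δ ^ β * (T₂.cell a₂ (S.δ ^ β) m).W μ (2 * h + 2))
    (I := fun m => ∫ y, (S.δ / S.δ ^ β * ‖(T₂.cell a₂ (S.δ ^ β) m).sum y‖) ^ (2 * h) *
      ((S.δ / S.δ ^ α * ‖T₁.sum y‖) ^ 2 * ‖S.H y‖ ^ 2) ∂μ)
    (by positivity) (cells_ratio hρ' hρ) (by positivity)
    (mul_nonneg (by positivity) (T₁.W_nonneg _))
    (fun m => mul_nonneg (by positivity) (Fam.W_nonneg _ _))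
    (fun m _ => by
      have := H S _ _ _ _ _ _ (hf.cell₂ hρ' m) h1 (Fam.cell_len hρ' m).2
      rw [add_comm (S.δ / S.δ ^ α * _)] at this
      refine le_trans (le_of_eq ?_) this
      congr 1; ext y; ring)
  rw [← Fam.W_avg T₂ hf.in₂ h2 hρ'] at h4
  have h5 : ∫ y, (S.δ / S.δ ^ α * ‖T₁.sum y‖) ^ 2 * (S.δ / S.δ ^ β' * ‖T₂.sum y‖) ^ (2 * h) *
      ‖S.H y‖ ^ 2 ∂μ = ∫ y, (S.δ / S.δ ^ β' * ‖T₂.sum y‖) ^ (2 * h) *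
      ((S.δ / S.δ ^ α * ‖T₁.sum y‖) ^ 2 * ‖S.H y‖ ^ 2) ∂μ := by
    congr 1; ext y; ring
  rw [h5]
  refine h3.trans ?_
  rw [mul_assoc (2 ^ (2 * h - 1)), mul_assoc (2 ^ (2 * h - 1))]
  refine mul_le_mul_of_nonneg_left (h4.trans (le_of_eq ?_)) (by positivity)
  ring

theorem pow_split_le {x y t : ℝ} (hx : 0 ≤ x) (hy : 0 ≤ y) (ht : 0 < t) (h : ℕ) :
    x ^ 2 * y ^ (2 * h) ≤ t ^ (2 * h) * x ^ (2 * h + 2) + (t ^ 2)⁻¹ * y ^ (2 * h + 2) := by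
  have e1 : 0 ≤ t ^ (2 * h) * x ^ (2 * h + 2) := by positivity
  have e2 : 0 ≤ (t ^ 2)⁻¹ * y ^ (2 * h + 2) := by positivity
  rcases le_total y (t * x) with h1 | h1
  · have : y ^ (2 * h) ≤ (t * x) ^ (2 * h) := by gcongr
    calc x ^ 2 * y ^ (2 * h) ≤ x ^ 2 * (t * x) ^ (2 * h) := by gcongr
      _ = t ^ (2 * h) * x ^ (2 * h + 2) := by rw [mul_pow, pow_add]; ring
      _ ≤ _ := by linarith
  · have h2 : x ≤ y / t := by rw [le_div_iff₀ ht]; linarith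
    have : x ^ 2 ≤ (y / t) ^ 2 := by gcongr
    calc x ^ 2 * y ^ (2 * h) ≤ (y / t) ^ 2 * y ^ (2 * h) := by gcongr
      _ = (t ^ 2)⁻¹ * y ^ (2 * h + 2) := by rw [div_pow, pow_add]; ring
      _ ≤ _ := by linarith

/-- Termination: a linear inequality gives a bilinear one. -/
theorem Dec.toBil {h : ℕ} {η α β : ℝ} (H : Dec μ e k (2 * h + 2) η)
    (hα : 0 ≤ α) (hα1 : α ≤ 1) (hβ : 0 ≤ β) (hβ1 : β ≤ 1) :
    Bil μ e k h α β (η * (1 - β) - 2 * η * (α - β) / (2 * h + 2)) := by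
  intro B hB
  obtain ⟨K, hK, H⟩ := H.rescaled hB
  refine ⟨K, hK, fun S T₁ T₂ a₁ b₁ a₂ b₂ hf h1 h2 => ?_⟩
  have hδ := S.δ_pos
  have hle : ∀ γ : ℝ, γ ≤ 1 → S.δ ≤ S.δ ^ γ := fun γ hγ => by
    have := rpow_le_rpow_of_exponent_ge S.δ_pos S.δ_le hγ
    rwa [rpow_one] at this
  have hle1 : ∀ γ : ℝ, 0 ≤ γ → S.δ ^ γ ≤ 1 := fun γ hγ => rpow_le_one hδ.le S.δ_le hγ
  have e1 := H S T₁ a₁ b₁ (S.δ ^ α) hf.ha₁ hf.le₁ hf.hb₁ h1 (hle α hα1) (hle1 α hα) hf.in₁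
  have e2 := H S T₂ a₂ b₂ (S.δ ^ β) hf.ha₂ hf.le₂ hf.hb₂ h2 (hle β hβ1) (hle1 β hβ) hf.in₂
  set F₁ := fun y => S.δ / S.δ ^ α * ‖T₁.sum y‖ with hF₁
  set F₂ := fun y => S.δ / S.δ ^ β * ‖T₂.sum y‖ with hF₂
  have hc₁ : Continuous F₁ := by fun_prop
  have hc₂ : Continuous F₂ := by fun_prop
  set t : ℝ := S.δ ^ (η * (α - β) / (2 * h + 2)) with ht
  have ht0 : 0 < t := by positivity
  set x := η * (1 - β) - 2 * η * (α - β) / (2 * h + 2) with hx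
  have hP : (2 * (h : ℝ) + 2) ≠ 0 := by positivity
  have p1 : t ^ (2 * h) * (S.δ / S.δ ^ α) ^ η = S.δ ^ x := by
    rw [ht, ← rpow_natCast, ← rpow_mul hδ.le]
    nth_rewrite 2 [← rpow_one S.δ]
    rw [← rpow_sub hδ, ← rpow_mul hδ.le, ← rpow_add hδ, hx]
    congr 1
    push_cast
    field_simp
    ring
  have p2 : (t ^ 2)⁻¹ * (S.δ / S.δ ^ β) ^ η = S.δ ^ x := by
    rw [ht, ← rpow_natCast, ← rpow_mul hδ.le, ← rpow_neg hδ.le]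
    nth_rewrite 2 [← rpow_one S.δ]
    rw [← rpow_sub hδ, ← rpow_mul hδ.le, ← rpow_add hδ, hx]
    congr 1
    push_cast
    field_simp
    ring
  calc ∫ y, F₁ y ^ 2 * F₂ y ^ (2 * h) * ‖S.H y‖ ^ 2 ∂μ
      ≤ ∫ y, (t ^ (2 * h) * (F₁ y ^ (2 * h + 2) * ‖S.H y‖ ^ 2) +
          (t ^ 2)⁻¹ * (F₂ y ^ (2 * h + 2) * ‖S.H y‖ ^ 2)) ∂μ := by
        refine integral_mono (cint (by fun_prop)) (cint (by fun_prop)) fun y => ?_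
        have := pow_split_le (x := F₁ y) (y := F₂ y) (by positivity) (by positivity) ht0 h
        calc _ ≤ _ := mul_le_mul_of_nonneg_right this (by positivity : 0 ≤ ‖S.H y‖ ^ 2)
          _ = _ := by ring
    _ = t ^ (2 * h) * ∫ y, F₁ y ^ (2 * h + 2) * ‖S.H y‖ ^ 2 ∂μ +
          (t ^ 2)⁻¹ * ∫ y, F₂ y ^ (2 * h + 2) * ‖S.H y‖ ^ 2 ∂μ := by
        rw [integral_add (cint (by fun_prop)) (cint (by fun_prop)), integral_const_mul,
          integral_const_mul]
    _ ≤ t ^ (2 * h) * (K * (S.δ / S.δ ^ α) ^ η * (S.δ / S.δ ^ α * T₁.W μ (2 * h + 2))) +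
          (t ^ 2)⁻¹ * (K * (S.δ / S.δ ^ β) ^ η * (S.δ / S.δ ^ β * T₂.W μ (2 * h + 2))) := by
        gcongr
    _ = K * (t ^ (2 * h) * (S.δ / S.δ ^ α) ^ η) * (S.δ / S.δ ^ α * T₁.W μ (2 * h + 2)) +
        K * ((t ^ 2)⁻¹ * (S.δ / S.δ ^ β) ^ η) * (S.δ / S.δ ^ β * T₂.W μ (2 * h + 2)) := by ring
    _ = _ := by rw [p1, p2]; ring

end Moves

section Orthogonality

open Polynomial

variable {X G : Type*} [TopologicalSpace X] [CompactSpace X] [MeasurableSpace X] [BorelSpace X]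
  [AddCommGroup G] {μ : Measure X} [IsProbabilityMeasure μ] {e : G → C(X, ℂ)}
  {k : ℕ} {B : ℝ} {S : Setup e k B}

theorem c₀_pos : 0 < c₀ := by norm_num [c₀]

theorem spec_sum {T : Fam S} {Ω : Set G}
    (h : ∀ i ∈ T.s, Adm k S.Φ S.δ B S.a S.b S.g (T.u i) ⊆ Ω) : T.sum ∈ Spec e Ω :=
  Submodule.sum_mem _ fun i hi => Spec.mono (h i hi) (T.hf i hi)

theorem pow_sub_le_self {B δ : ℝ} (hB : 0 ≤ B) (hδ : 0 ≤ δ) (hδ1 : δ ≤ 1) {j k : ℕ} (hj : j < k) :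
    B * δ ^ (k - j) ≤ B * δ := by
  gcongr
  exact pow_le_of_le_one hδ hδ1 (by omega)

theorem abs_dv_le_of_adm (hB : 1 ≤ B) {u : ℝ} (hu : u ∈ Set.Icc S.a S.b) {y ρ : ℝ}
    (hy : y ∈ Set.Icc S.a S.b) (hρ : S.δ ≤ ρ) (hyu : |y - u| ≤ ρ) {ξ : G}
    (hξ : ξ ∈ Adm k S.Φ S.δ B S.a S.b S.g u) {j : ℕ} (hj : j ≤ k) :
    |dv j (S.Φ ξ) y| ≤ 2 ^ k * (2 * B) * ρ ^ (k - j) := by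
  have hδ := S.δ_pos
  have hρ0 : 0 < ρ := hδ.trans_le hρ
  refine abs_dv_le hρ0.le (by linarith) hyu (fun j hj => ?_) (fun z hz => ?_) j hj
  · refine (hξ.1 j hj).trans ?_
    have : S.δ ^ (k - j) ≤ ρ ^ (k - j) := by gcongr
    have : 0 ≤ ρ ^ (k - j) := by positivity
    nlinarith
  · have hz' : z ∈ Set.Icc S.a S.b := Set.OrdConnected.uIcc_subset Set.ordConnected_Icc hu hy hz
    have h1 := hξ.2 z hz'
    have h2 := S.hg z hz'
    have h3 : B * S.δ ^ k ≤ B * 1 := by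
      gcongr; exact pow_le_one₀ hδ.le S.δ_le
    have h4 : 0 < 1 / B := by positivity
    rw [abs_le] at h1 ⊢
    constructor <;> linarith

/-- Transversality makes the products with distinct short cells almost orthogonal. -/
theorem far_orthogonal (he : Chars μ e) (hk : 1 ≤ k) (h : ℕ) (hB : 1 ≤ B) :
    ∃ N : ℕ, ∀ (S : Setup e k B) (T₁ T₂ : Fam S) (a₁ b₁ a₂ b₂ ρ : ℝ),
      BilFam T₁ T₂ a₁ b₁ a₂ b₂ → b₂ - a₂ ≤ ρ → S.δ ≤ ρ ^ k → S.δ ≤ ρ → ∀ i j : ℕ,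
      (i : ℝ) ≤ 1 / ρ ^ k → (j : ℝ) ≤ 1 / ρ ^ k → i + N ≤ j →
      ∫ x, ((T₁.cell a₁ (ρ ^ k) i).sum * (T₂.sum ^ h * S.H)) x *
        (starRingEnd ℂ) (((T₁.cell a₁ (ρ ^ k) j).sum * (T₂.sum ^ h * S.H)) x) ∂μ = 0 := by
  set D : ℝ := (h + 1) * (2 ^ k * (2 * B)) with hD
  set γ : ℝ := 1 / (2 * B) with hγ
  have hc := c₀_pos
  have hγ0 : 0 < γ := by positivity
  set c : ℝ := γ * c₀ ^ (k - 1) / (k - 1).factorial with hcdef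
  have hc0 : 0 < c := by positivity
  obtain ⟨N₁, hN₁⟩ := exists_nat_gt ((2 * D + 2 * (k + 2) ^ 2 * B) / c)
  obtain ⟨N₂, hN₂⟩ := exists_nat_gt (2 * B ^ 2)
  refine ⟨N₁ + N₂ + 1, fun S T₁ T₂ a₁ b₁ a₂ b₂ ρ hf hρ hδρk hδρ i j hi hj hij => ?_⟩
  have hδ := S.δ_pos
  have hρ0 : 0 < ρ := hδ.trans_le hδρ
  have hρk : 0 < ρ ^ k := by positivity
  have hyI : a₂ ∈ Set.Icc S.a S.b := ⟨hf.ha₂, hf.le₂.trans hf.hb₂⟩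
  have hij' : (i : ℝ) + (N₁ + N₂ + 1) ≤ j := by exact_mod_cast hij
  have hsmall : B * S.δ ≤ γ := by
    have h1 : (N₂ : ℝ) ≤ 1 / ρ ^ k := by
      have : (0 : ℝ) ≤ i := by positivity
      have : (0 : ℝ) ≤ N₁ := by positivity
      linarith
    have h2 : 2 * B ^ 2 < 1 / S.δ :=
      hN₂.trans_le (h1.trans (one_div_le_one_div_of_le hδ hδρk))
    rw [lt_div_iff₀ hδ] at h2
    rw [hγ, le_div_iff₀ (by positivity)]
    nlinarith
  set D₁ : ℝ := 2 ^ k * (2 * B) * ρ ^ k with hD₁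
  have hspec2 : T₂.sum ∈ Spec e {ξ | |dv 0 (S.Φ ξ) a₂| ≤ D₁} := by
    refine spec_sum fun i hi ξ hξ => ?_
    have hb : |a₂ - T₂.u i| ≤ ρ := by
      have := hf.in₂ i hi
      rw [abs_sub_comm, abs_of_nonneg (by linarith [this.1])]
      linarith [this.2]
    simpa using abs_dv_le_of_adm hB (T₂.hu i hi) hyI hδρ hb hξ (Nat.zero_le k)
  have hspecp : T₂.sum ^ h ∈ Spec e {ξ | |dv 0 (S.Φ ξ) a₂| ≤ h * D₁} := by
    refine Spec.pow he (fun m => {ξ | |dv 0 (S.Φ ξ) a₂| ≤ m * D₁}) hspec2 ?_ ?_ h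
    · simp [dv_zero_poly]
    · intro m ξ hξ η hη
      simp only [Set.mem_ofPred_eq, map_add, dv_add] at *
      push_cast
      have := abs_add_le (dv 0 (S.Φ ξ) a₂) (dv 0 (S.Φ η) a₂)
      linarith
  have hspecH : S.H ∈ Spec e {ξ | |dv 0 (S.Φ ξ) a₂| ≤ D₁} := by
    refine Spec.mono (fun ξ hξ => ?_) S.hH
    have h1 := hξ 0 (Nat.zero_le k) a₂ hyI
    have h2 : S.δ ^ k ≤ ρ ^ k := by gcongr
    have h3 : (1 : ℝ) ≤ 2 ^ k := one_le_pow₀ (by norm_num)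
    refine h1.trans ?_
    rw [hD₁]
    have : B * S.δ ^ k ≤ B * ρ ^ k := by gcongr
    have h5 : 0 ≤ B * ρ ^ k := by positivity
    nlinarith
  have hspecA : T₂.sum ^ h * S.H ∈ Spec e {ξ | |dv 0 (S.Φ ξ) a₂| ≤ D * ρ ^ k} := by
    refine Spec.mono ?_ (Spec.mul he hspecp hspecH)
    rintro _ ⟨ξ, hξ, η, hη, rfl⟩
    simp only [Set.mem_ofPred_eq, map_add, dv_add] at *
    have := abs_add_le (dv 0 (S.Φ ξ) a₂) (dv 0 (S.Φ η) a₂)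
    have e1 : D * ρ ^ k = h * D₁ + D₁ := by rw [hD, hD₁]; ring
    linarith
  have hspec1 : ∀ m, (T₁.cell a₁ (ρ ^ k) m).sum ∈ Spec e
      {ξ | ∃ l ∈ (T₁.cell a₁ (ρ ^ k) m).s, ξ ∈ Adm k S.Φ S.δ B S.a S.b S.g (T₁.u l)} :=
    fun m => spec_sum fun l hl ξ hξ => ⟨l, hl, hξ⟩
  refine Spec.orthogonal he (Spec.mul he (hspec1 i) hspecA) (Spec.mul he (hspec1 j) hspecA) ?_
  rintro _ ⟨ξ, ⟨l, hl, hξ⟩, η, hη, rfl⟩ ⟨ξ', ⟨l', hl', hξ'⟩, η', hη', heq⟩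
  have hΦ : dv 0 (S.Φ ξ) a₂ + dv 0 (S.Φ η) a₂ = dv 0 (S.Φ ξ') a₂ + dv 0 (S.Φ η') a₂ := by
    rw [← dv_add, ← dv_add, ← map_add, ← map_add, heq]
  have hE : 0 ≤ B * S.δ := by positivity
  have hgk : ∀ ζ m, ζ ∈ Adm k S.Φ S.δ B S.a S.b S.g m → ∀ x ∈ Set.Icc S.a S.b,
      |dv k (S.Φ ζ) x - S.g x| ≤ B * S.δ := fun ζ m hζ x hx =>
    (hζ.2 x hx).trans (by simpa using pow_sub_le_self (j := 0) (by linarith) hδ.le S.δ_le hk)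
  have hl1 := (Finset.mem_filter.1 hl).1
  have hl1' := (Finset.mem_filter.1 hl').1
  have hsep := sep (c₀ := c₀) hk hE hsmall hc.le S.hab' (T₁.hu l hl1) (T₁.hu l' hl1') hyI
    (fun x hx => by
      refine le_trans (le_of_eq ?_) (S.hg x hx).1
      rw [hγ]; field_simp)
    (by
      have h1 := hf.in₁ l hl1
      have h2 := hf.in₁ l' hl1'
      have h3 := hf.le₂
      rcases hf.sep with h4 | h4
      · left; constructor <;> linarith [h1.2, h2.2]
      · right; constructor <;> linarith [h1.1, h2.1])
    (fun j hj => (hξ.1 j hj).trans (pow_sub_le_self (by linarith) hδ.le S.δ_le hj))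
    (fun j hj => (hξ'.1 j hj).trans (pow_sub_le_self (by linarith) hδ.le S.δ_le hj))
    (hgk ξ _ hξ) (hgk ξ' _ hξ')
  have hdiff : |dv 0 (S.Φ ξ') a₂ - dv 0 (S.Φ ξ) a₂| ≤ 2 * D * ρ ^ k := by
    have e1 : dv 0 (S.Φ ξ') a₂ - dv 0 (S.Φ ξ) a₂ = dv 0 (S.Φ η) a₂ - dv 0 (S.Φ η') a₂ := by
      linarith
    rw [e1]
    have h1 := abs_sub (dv 0 (S.Φ η) a₂) (dv 0 (S.Φ η') a₂)
    simp only [Set.mem_ofPred_eq] at hη hη'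
    linarith
  have hgap : ((N₁ : ℝ)) * ρ ^ k ≤ |T₁.u l - T₁.u l'| := by
    have m1 := Nat.lt_floor_add_one ((T₁.u l - a₁) / ρ ^ k)
    have m2 := Nat.floor_le (div_nonneg (by linarith [(hf.in₁ l' hl1').1]) hρk.le :
      0 ≤ (T₁.u l' - a₁) / ρ ^ k)
    rw [(Finset.mem_filter.1 hl).2] at m1
    rw [(Finset.mem_filter.1 hl').2] at m2
    rw [div_lt_iff₀ hρk] at m1
    rw [le_div_iff₀ hρk] at m2
    rw [abs_sub_comm]
    refine le_trans ?_ (le_abs_self _)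
    have h4 : ((i : ℝ) + (N₁ + N₂ + 1)) * ρ ^ k ≤ j * ρ ^ k := by gcongr
    have h5 : 0 ≤ (N₂ : ℝ) * ρ ^ k := by positivity
    nlinarith
  rw [div_lt_iff₀ hc0] at hN₁
  have h6 : 2 * ((k : ℝ) + 2) ^ 2 * (B * S.δ) ≤ 2 * (k + 2) ^ 2 * B * ρ ^ k := by
    rw [← mul_assoc]; gcongr
  have h7 : c * (N₁ * ρ ^ k) ≤ c * |T₁.u l - T₁.u l'| := by gcongr
  have h8 : (2 * D + 2 * (k + 2) ^ 2 * B) * ρ ^ k < N₁ * c * ρ ^ k := by gcongr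
  nlinarith

/-- Refining the first interval by `L²` orthogonality. -/
theorem Bil.refine₁ (he : Chars μ e) (hk : 1 ≤ k) {h : ℕ} {α β x : ℝ}
    (H : Bil μ e k h (k * β) β x) (hβ : 0 ≤ β) (hα0 : 0 ≤ α) (hα : α ≤ k * β) (hkβ : k * β ≤ 1) :
    Bil μ e k h α β (x + (k * β - α)) := by
  intro B hB
  obtain ⟨K, hK, H⟩ := H B hB
  obtain ⟨N, hN⟩ := far_orthogonal (μ := μ) he hk h hB
  refine ⟨2 * N * (2 * K), by positivity, fun S T₁ T₂ a₁ b₁ a₂ b₂ hf h1 h2 => ?_⟩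
  have hδ := S.δ_pos
  have hρk : (S.δ ^ β) ^ k = S.δ ^ (k * β) := by
    rw [← rpow_natCast, ← rpow_mul hδ.le, mul_comm]
  set ρ' : ℝ := S.δ ^ (k * β) with hρ'def
  set ρ : ℝ := S.δ ^ α with hρdef
  have hρ' : 0 < ρ' := by positivity
  have hρ : ρ' ≤ ρ := rpow_le_rpow_of_exponent_ge S.δ_pos S.δ_le hα
  have hρ0 : 0 < ρ := hρ'.trans_le hρ
  have hδρ' : S.δ ≤ ρ' := by
    have := rpow_le_rpow_of_exponent_ge S.δ_pos S.δ_le hkβ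
    rwa [rpow_one] at this
  have hρ'1 : ρ' ≤ 1 := rpow_le_one hδ.le S.δ_le (by positivity)
  have hδρ : S.δ ≤ S.δ ^ β := by
    have h3 : (1 : ℝ) ≤ k := by exact_mod_cast hk
    have := rpow_le_rpow_of_exponent_ge S.δ_pos S.δ_le (y := 1) (z := β) (by nlinarith)
    rwa [rpow_one] at this
  have hρ1 : ρ ≤ 1 := rpow_le_one hδ.le S.δ_le hα0
  set R := Finset.range (⌊ρ / ρ'⌋₊ + 1) with hR
  set A : C(X, ℂ) := T₂.sum ^ h * S.H with hA
  set Z : ℕ → C(X, ℂ) := fun m => (T₁.cell a₁ ρ' m).sum with hZ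
  have hRle : ∀ m ∈ R, (m : ℝ) ≤ 1 / ρ' := by
    intro m hm
    have h3 : m ≤ ⌊ρ / ρ'⌋₊ := Nat.lt_succ_iff.1 (Finset.mem_range.1 hm)
    have h4 : (m : ℝ) ≤ ⌊ρ / ρ'⌋₊ := by exact_mod_cast h3
    refine h4.trans ((Nat.floor_le (by positivity)).trans ?_)
    gcongr
  have horth : ∀ i ∈ R, ∀ j ∈ R, i + N ≤ j →
      ∫ y, (Z i * A) y * (starRingEnd ℂ) ((Z j * A) y) ∂μ = 0 := by
    intro i hi j hj hij
    have := hN S T₁ T₂ a₁ b₁ a₂ b₂ (S.δ ^ β) hf h2 (by rw [hρk]; exact hδρ') hδρ i j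
      (by rw [hρk]; exact hRle i hi) (by rw [hρk]; exact hRle j hj) hij
    rwa [hρk] at this
  have hao := almost_orthogonal (μ := μ) R (fun m => Z m * A) N (fun i hi j hj hij => by
    rcases hij with hij | hij
    · exact horth i hi j hj hij
    · have := horth j hj i hi hij
      rw [← (starRingEnd ℂ).injective.eq_iff, map_zero, ← integral_conj] at this
      rw [← this]
      congr 1; ext y
      simp [mul_comm])
  rw [← Finset.sum_mul, ← Fam.sum_cell hf.in₁ h1 hρ'] at hao
  set ρ₂ := S.δ ^ β with hρ₂
  have hρ₂0 : 0 < ρ₂ := by positivity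
  set I : ℕ → ℝ := fun m => ∫ y, (S.δ / ρ' * ‖Z m y‖) ^ 2 * (S.δ / ρ₂ * ‖T₂.sum y‖) ^ (2 * h) *
      ‖S.H y‖ ^ 2 ∂μ with hI
  have h4 := sum_avg_le (N := R) (r := ρ' / ρ)
    (K := K * S.δ ^ x) (W := S.δ / ρ₂ * T₂.W μ (2 * h + 2))
    (V := fun m => S.δ / ρ' * (T₁.cell a₁ ρ' m).W μ (2 * h + 2))
    (I := I)
    (by positivity) (cells_ratio hρ' hρ) (by positivity)
    (mul_nonneg (by positivity) (T₂.W_nonneg _))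
    (fun m => mul_nonneg (by positivity) (Fam.W_nonneg _ _))
    (fun m _ => H S _ _ _ _ _ _ (hf.cell₁ hρ' m) (Fam.cell_len hρ' m).2 h2)
  rw [← Fam.W_avg T₁ hf.in₁ h1 hρ'] at h4
  have hx : S.δ ^ (x + (k * β - α)) = S.δ ^ x * (ρ' / ρ) := by
    rw [rpow_add hδ, rpow_sub hδ]
  have hIm : ∀ m, (S.δ / ρ) ^ 2 * (S.δ / ρ₂) ^ (2 * h) * ∫ y, ‖(Z m * A) y‖ ^ 2 ∂μ =
      (ρ' / ρ) ^ 2 * I m := by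
    intro m
    rw [hI, ← integral_const_mul]
    simp only
    rw [← integral_const_mul]
    congr 1; ext y
    simp only [hA, ContinuousMap.mul_apply, ContinuousMap.pow_apply, norm_mul, norm_pow]
    have e1 : S.δ / ρ = ρ' / ρ * (S.δ / ρ') := by field_simp
    rw [e1]
    ring
  calc ∫ y, (S.δ / ρ * ‖T₁.sum y‖) ^ 2 * (S.δ / ρ₂ * ‖T₂.sum y‖) ^ (2 * h) * ‖S.H y‖ ^ 2 ∂μ
      = (S.δ / ρ) ^ 2 * (S.δ / ρ₂) ^ (2 * h) * ∫ y, ‖(T₁.sum * A) y‖ ^ 2 ∂μ := by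
        rw [← integral_const_mul]
        congr 1; ext y
        simp only [hA, ContinuousMap.mul_apply, ContinuousMap.pow_apply, norm_mul, norm_pow]
        ring
    _ ≤ (S.δ / ρ) ^ 2 * (S.δ / ρ₂) ^ (2 * h) * (2 * N * ∑ m ∈ R, ∫ y, ‖(Z m * A) y‖ ^ 2 ∂μ) := by
        gcongr
    _ = 2 * N * (ρ' / ρ * (ρ' / ρ * ∑ m ∈ R, I m)) := by
        have e1 : ρ' / ρ * (ρ' / ρ * ∑ m ∈ R, I m) = ∑ m ∈ R, (ρ' / ρ) ^ 2 * I m := by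
          rw [← Finset.mul_sum]; ring
        rw [e1]
        simp only [← hIm]
        rw [← Finset.mul_sum]; ring
    _ ≤ 2 * N * (ρ' / ρ * (2 * (K * S.δ ^ x) * (S.δ / ρ * T₁.W μ (2 * h + 2) +
          S.δ / ρ₂ * T₂.W μ (2 * h + 2)))) := by
        gcongr
    _ = _ := by rw [hx]; ring

end Orthogonality

section Descent

open Polynomial

variable {X G : Type*} [TopologicalSpace X] [CompactSpace X] [MeasurableSpace X] [BorelSpace X]
  [AddCommGroup G] {μ : Measure X} [IsProbabilityMeasure μ] {e : G → C(X, ℂ)}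
  {k m : ℕ} {B : ℝ}

/-- The phase `ξ ↦ (x - u) p_ξ' - m p_ξ`. -/
def tiltPhase (Φ : G →+ ℝ[X]) (u : ℝ) (m : ℕ) : G →+ ℝ[X] where
  toFun ξ := tilt u m (Φ ξ)
  map_zero' := by simp [tilt]
  map_add' := by intro x y; simp only [tilt, map_add]; ring

theorem tilt_thin {p : ℝ[X]} {u y A : ℝ} (hA : 0 ≤ A) (h1 : ∀ j < m, |dv j p u| ≤ A)
    (h2 : ∀ z ∈ Set.uIcc u y, |dv (m + 1) p z| ≤ A) (hy : |y - u| ≤ 1) :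
    ∀ j ≤ m, |dv j (tilt u m p) y| ≤ 2 ^ m * ((m + 1) * A) := by
  intro j hj
  have h := abs_dv_le (m := m) (p := tilt u m p) (u := u) (r := 1) (A := (m + 1) * A) zero_le_one
    (by positivity) hy (fun j hj => ?_) (fun z hz => ?_) j hj
  · simpa using h
  · rw [dv_tilt, sub_self, zero_mul, zero_add, abs_mul, one_pow, mul_one]
    have h3 : |(j : ℝ) - m| ≤ m + 1 := by
      have : (j : ℝ) ≤ m := by exact_mod_cast hj.le
      have h0 : (0 : ℝ) ≤ j := by positivity
      rw [abs_le]; constructor <;> linarith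
    have := h1 j hj
    gcongr
  · rw [dv_tilt, sub_self, zero_mul, add_zero, abs_mul]
    have h3 : |z - u| ≤ (m : ℝ) + 1 := by
      have h4 := Set.abs_sub_left_of_mem_uIcc hz
      have : (0 : ℝ) ≤ m := by positivity
      linarith
    have := h2 z hz
    gcongr

/-- Passage to the curve of lower degree seen from the first interval. -/
def lowerSetup (S : Setup e (m + 1) B) (B' a₁ a₂ b₂ ρ₂ δ' σ : ℝ) (H' : C(X, ℂ))
    (hρ₂ : 0 < ρ₂) (hδ' : 0 < δ') (hδ'1 : δ' ≤ 1) (hab : a₂ ≤ b₂) (hb : b₂ - a₂ ≤ ρ₂)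
    (hg : ∀ y ∈ Set.Icc a₂ b₂, 1 / B' ≤ σ * (y - a₁) * S.g y ∧ σ * (y - a₁) * S.g y ≤ B')
    (hH' : H' ∈ Spec e (Thin m (scalePhase (tiltPhase S.Φ a₁ m) (σ * (ρ₂ ^ m)⁻¹) a₂ ρ₂) δ' B' 0
      ((b₂ - a₂) / ρ₂))) : Setup e m B' where
  δ := δ'
  a := 0
  b := (b₂ - a₂) / ρ₂
  Φ := scalePhase (tiltPhase S.Φ a₁ m) (σ * (ρ₂ ^ m)⁻¹) a₂ ρ₂
  g := fun x => σ * (a₂ + ρ₂ * x - a₁) * S.g (a₂ + ρ₂ * x)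
  H := H'
  δ_pos := hδ'
  δ_le := hδ'1
  hab := div_nonneg (by linarith) hρ₂.le
  hab' := by rw [zero_add, div_le_iff₀ hρ₂, one_mul]; exact hb
  hg := fun x hx => hg _ (affine_mem hρ₂ hx)
  hH := hH'

theorem abs_dv_scalePhase_tilt (Φ : G →+ ℝ[X]) {a₁ a₂ ρ₂ σ x A : ℝ} (hρ₂ : 0 < ρ₂) (hσ : |σ| = 1)
    {j : ℕ} (hj : j ≤ m) (ξ : G) (h : |dv j (tilt a₁ m (Φ ξ)) (a₂ + ρ₂ * x)| ≤ A) :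
    |dv j (scalePhase (tiltPhase Φ a₁ m) (σ * (ρ₂ ^ m)⁻¹) a₂ ρ₂ ξ) x| ≤ A / ρ₂ ^ (m - j) := by
  rw [dv_scalePhase]
  have e2 : ρ₂ ^ m = ρ₂ ^ j * ρ₂ ^ (m - j) := by rw [← pow_add]; congr 1; omega
  rw [abs_mul, abs_mul, abs_mul, hσ, one_mul, abs_of_pos (by positivity : 0 < (ρ₂ ^ m)⁻¹),
    abs_of_pos (by positivity : 0 < ρ₂ ^ j), e2]
  have : (ρ₂ ^ j * ρ₂ ^ (m - j))⁻¹ * (ρ₂ ^ j * |dv j (tiltPhase Φ a₁ m ξ) (a₂ + ρ₂ * x)|) =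
      |dv j (tilt a₁ m (Φ ξ)) (a₂ + ρ₂ * x)| / ρ₂ ^ (m - j) := by
    simp only [tiltPhase, AddMonoidHom.coe_mk, ZeroHom.coe_mk]
    field_simp
  rw [this]
  gcongr

theorem lower_thin (S : Setup e (m + 1) B) (hm : 1 ≤ m) (hB : 1 ≤ B) {T : Fam S}
    {a₁ b₁ y ρ₁ : ℝ} (hT : T.In a₁ b₁) (ha₁ : a₁ ∈ Set.Icc S.a S.b) (hρ : b₁ - a₁ ≤ ρ₁)
    (hδρ : S.δ ≤ ρ₁) (hρ1 : ρ₁ ≤ 1) (hy : y ∈ Set.Icc S.a S.b) {ξ ζ η : G} {i l : ℕ} (hi : i ∈ T.s)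
    (hl : l ∈ T.s) (hξ : ξ ∈ Adm (m + 1) S.Φ S.δ B S.a S.b S.g (T.u i))
    (hζ : ζ ∈ Adm (m + 1) S.Φ S.δ B S.a S.b S.g (T.u l))
    (hη : η ∈ Thin (m + 1) S.Φ S.δ B S.a S.b) :
    ∀ j ≤ m, |dv j (tilt a₁ m (S.Φ (ξ + η + -ζ))) y| ≤
      2 ^ m * ((m + 1) * (2 ^ (m + 4) * B * ρ₁ ^ 2)) := by
  have hδ := S.δ_pos
  have hρ0 : 0 < ρ₁ := hδ.trans_le hδρ
  have hδk : S.δ ^ (m + 1) ≤ ρ₁ ^ 2 := by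
    calc S.δ ^ (m + 1) ≤ S.δ ^ 2 := pow_le_pow_of_le_one hδ.le S.δ_le (by omega)
      _ ≤ ρ₁ ^ 2 := by gcongr
  have hBδ : B * S.δ ^ (m + 1) ≤ B * ρ₁ ^ 2 := by gcongr
  have hBρ : 0 ≤ B * ρ₁ ^ 2 := by positivity
  have hp16 : (16 : ℝ) ≤ 2 ^ (m + 4) := by
    have : (1 : ℝ) ≤ 2 ^ m := one_le_pow₀ (by norm_num)
    rw [pow_add]; linarith
  refine tilt_thin (by positivity) (fun j hj => ?_) (fun z hz => ?_) ?_
  · have hclose : ∀ i ∈ T.s, ∀ ξ ∈ Adm (m + 1) S.Φ S.δ B S.a S.b S.g (T.u i),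
        |dv j (S.Φ ξ) a₁| ≤ 2 ^ (m + 2) * B * ρ₁ ^ 2 := by
      intro i hi ξ hξ
      have h1 := abs_dv_le_of_adm hB (T.hu i hi) ha₁ hδρ (by
        rw [abs_sub_comm, abs_of_nonneg (by linarith [(hT i hi).1])]
        linarith [(hT i hi).2]) hξ (j := j) (by omega)
      have h2 : ρ₁ ^ (m + 1 - j) ≤ ρ₁ ^ 2 := pow_le_pow_of_le_one hρ0.le hρ1 (by omega)
      calc _ ≤ _ := h1
        _ ≤ 2 ^ (m + 1) * (2 * B) * ρ₁ ^ 2 := by gcongr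
        _ = _ := by ring
    have h1 := hclose i hi ξ hξ
    have h2 := hclose l hl ζ hζ
    have h3 := hη j (by omega) a₁ ha₁
    rw [map_add, map_add, map_neg, dv_add, dv_add, dv_neg]
    have h4 : B * ρ₁ ^ 2 ≤ 2 ^ (m + 2) * B * ρ₁ ^ 2 := by
      have : (1 : ℝ) ≤ 2 ^ (m + 2) := one_le_pow₀ (by norm_num)
      nlinarith
    have e1 : (2 : ℝ) ^ (m + 4) * B * ρ₁ ^ 2 = 4 * (2 ^ (m + 2) * B * ρ₁ ^ 2) := by ring
    rw [e1]
    rw [abs_le] at *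
    constructor <;> linarith
  · have hz' : z ∈ Set.Icc S.a S.b := Set.OrdConnected.uIcc_subset Set.ordConnected_Icc ha₁ hy hz
    have h1 := hξ.2 z hz'
    have h2 := hζ.2 z hz'
    have h3 := hη (m + 1) le_rfl z hz'
    rw [map_add, map_add, map_neg, dv_add, dv_add, dv_neg]
    have : 16 * (B * ρ₁ ^ 2) ≤ 2 ^ (m + 4) * B * ρ₁ ^ 2 := by nlinarith
    rw [abs_le] at *
    constructor <;> linarith
  · have := S.hab'
    rw [abs_le]
    constructor <;> linarith [hy.1, hy.2, ha₁.1, ha₁.2]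

end Descent

section Descent

open Polynomial

variable {X G : Type*} [TopologicalSpace X] [CompactSpace X] [MeasurableSpace X] [BorelSpace X]
  [AddCommGroup G] {μ : Measure X} [IsProbabilityMeasure μ] {e : G → C(X, ℂ)}
  {k m : ℕ} {B : ℝ}

theorem lower_adm (S : Setup e (m + 1) B) (hB : 1 ≤ B) {a₁ y u ρ' : ℝ}
    (ha₁ : a₁ ∈ Set.Icc S.a S.b) (hy : y ∈ Set.Icc S.a S.b) (hu : u ∈ Set.Icc S.a S.b)
    (hδρ : S.δ ≤ ρ') (hρ1 : ρ' ≤ 1) (hyu : |y - u| ≤ ρ') {ξ : G}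
    (hξ : ξ ∈ Adm (m + 1) S.Φ S.δ B S.a S.b S.g u) {j : ℕ} (hj : j < m) :
    |dv j (tilt a₁ m (S.Φ ξ)) y| ≤ 2 ^ m * ((m + 1) * (2 ^ (m + 4) * B)) * ρ' ^ (m - j) := by
  have hρ0 : 0 < ρ' := S.δ_pos.trans_le hδρ
  have h1 := abs_dv_le_of_adm hB hu hy hδρ hyu hξ (j := j) (by omega)
  have h2 := abs_dv_le_of_adm hB hu hy hδρ hyu hξ (j := j + 1) (by omega)
  rw [show m + 1 - j = m - j + 1 by omega] at h1
  rw [show m + 1 - (j + 1) = m - j by omega] at h2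
  set Q : ℝ := 2 ^ (m + 1) * (2 * B) * ρ' ^ (m - j) with hQ
  have hQ0 : 0 ≤ Q := by positivity
  have h1' : |dv j (S.Φ ξ) y| ≤ Q := by
    calc _ ≤ _ := h1
      _ = Q * ρ' := by rw [hQ]; ring
      _ ≤ Q := mul_le_of_le_one_right hQ0 hρ1
  have h3 : |y - a₁| ≤ 1 := by
    have := S.hab'
    rw [abs_le]
    constructor <;> linarith [hy.1, hy.2, ha₁.1, ha₁.2]
  have h4 : |(j : ℝ) - m| ≤ m := by
    have : (j : ℝ) ≤ m := by exact_mod_cast hj.le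
    have h0 : (0 : ℝ) ≤ j := by positivity
    rw [abs_le]; constructor <;> linarith
  rw [dv_tilt]
  calc _ ≤ |(y - a₁) * dv (j + 1) (S.Φ ξ) y| + |((j : ℝ) - m) * dv j (S.Φ ξ) y| := abs_add_le _ _
    _ ≤ 1 * Q + m * Q := by rw [abs_mul, abs_mul]; gcongr
    _ = (m + 1) * (2 ^ (m + 2) * B * ρ' ^ (m - j)) := by rw [hQ]; ring
    _ ≤ 2 ^ m * ((m + 1) * (2 ^ (m + 4) * B * ρ' ^ (m - j))) := by
      have e1 : (1 : ℝ) ≤ 2 ^ m := one_le_pow₀ (by norm_num)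
      have e2 : (2 : ℝ) ^ (m + 2) ≤ 2 ^ (m + 4) := pow_le_pow_right₀ (by norm_num) (by omega)
      refine le_trans ?_ (le_mul_of_one_le_left (by positivity) e1)
      gcongr
    _ = _ := by ring

/-- The family of cell sums of `T`, over the nonempty cells. -/
def cellFam {S : Setup e (m + 1) B} (T : Fam S) {B' : ℝ} (S' : Setup e m B') (a b ρ₂ ρ' : ℝ)
    (hT : T.In a b) (hρ' : 0 < ρ') (hρ₂ : 0 < ρ₂) (hδ' : S'.δ = ρ' / ρ₂) (ha : S'.a = 0)
    (hb : S'.b = (b - a) / ρ₂)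
    (hspec : ∀ l i, i ∈ (T.cell a ρ' l).s →
      |a + l * ρ' - T.u i| ≤ ρ' → a + l * ρ' ∈ Set.Icc a b →
      Adm (m + 1) S.Φ S.δ B S.a S.b S.g (T.u i) ⊆
        Adm m S'.Φ S'.δ B' S'.a S'.b S'.g (l * ρ' / ρ₂)) : Fam S' :=
  have key : ∀ l i, i ∈ (T.cell a ρ' l).s →
      |a + l * ρ' - T.u i| ≤ ρ' ∧ a + l * ρ' ∈ Set.Icc a b := by
    intro l i hi
    obtain ⟨hi, hm⟩ := Finset.mem_filter.1 hi
    have h0 : 0 ≤ (T.u i - a) / ρ' := div_nonneg (by linarith [(hT i hi).1]) hρ'.le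
    have h1 := Nat.floor_le h0
    have h2 := Nat.lt_floor_add_one ((T.u i - a) / ρ')
    rw [hm] at h1 h2
    rw [le_div_iff₀ hρ'] at h1
    rw [div_lt_iff₀ hρ'] at h2
    have h3 : 0 ≤ l * ρ' := by positivity
    refine ⟨by rw [abs_le]; constructor <;> nlinarith, by linarith, ?_⟩
    linarith [(hT i hi).2]
  { s := (Finset.range (⌊ρ₂ / ρ'⌋₊ + 1)).filter fun l => (T.cell a ρ' l).s.Nonempty
    u := fun l => l * ρ' / ρ₂
    f := fun l => (T.cell a ρ' l).sum
    hu := fun l hl => by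
      obtain ⟨i, hi⟩ := (Finset.mem_filter.1 hl).2
      have := (key l i hi).2
      rw [ha, hb]
      refine ⟨by positivity, ?_⟩
      have := this.2
      gcongr
      linarith
    sep := fun l _ l' _ hne => by
      rw [hδ', ← sub_div, ← sub_mul, abs_div, abs_mul, abs_of_pos hρ', abs_of_pos hρ₂]
      have h1 : (1 : ℝ) ≤ |(l : ℝ) - l'| := by
        have : (1 : ℤ) ≤ |(l : ℤ) - l'| := Int.one_le_abs (by omega)
        exact_mod_cast this
      gcongr
      nlinarith
    hf := fun l hl => spec_sum fun i hi => by
      obtain ⟨h1, h2⟩ := key l i hi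
      exact hspec l i hi h1 h2 }

theorem cellFam_sum {S : Setup e (m + 1) B} (T : Fam S) {B' : ℝ} (S' : Setup e m B') (a b ρ₂ ρ' : ℝ)
    (hT : T.In a b) (hρ' : 0 < ρ') (hρ₂ : 0 < ρ₂) (hδ' : S'.δ = ρ' / ρ₂) (ha : S'.a = 0)
    (hb : S'.b = (b - a) / ρ₂) (hspec) (hlen : b - a ≤ ρ₂) :
    (cellFam T S' a b ρ₂ ρ' hT hρ' hρ₂ hδ' ha hb hspec).sum = T.sum := by
  rw [Fam.sum_cell hT hlen hρ']
  refine Finset.sum_filter_of_ne fun l _ h => ?_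
  by_contra h0
  rw [Finset.not_nonempty_iff_eq_empty] at h0
  refine h ?_
  show ∑ i ∈ (T.cell a ρ' l).s, _ = 0
  rw [h0, Finset.sum_empty]

theorem cellFam_W_le {S : Setup e (m + 1) B} (T : Fam S) {B' : ℝ} (S' : Setup e m B')
    (a b ρ₂ ρ' : ℝ) (hT : T.In a b) (hρ' : 0 < ρ') (hρ₂ : 0 < ρ₂) (hδ' : S'.δ = ρ' / ρ₂)
    (ha : S'.a = 0) (hb : S'.b = (b - a) / ρ₂) (hspec) (P : ℕ) :
    (cellFam T S' a b ρ₂ ρ' hT hρ' hρ₂ hδ' ha hb hspec).W μ P ≤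
      ∑ l ∈ Finset.range (⌊ρ₂ / ρ'⌋₊ + 1),
        ∫ x, ‖(T.cell a ρ' l).sum x‖ ^ P * ‖S'.H x‖ ^ 2 ∂μ :=
  Finset.sum_le_sum_of_subset_of_nonneg (Finset.filter_subset _ _) fun _ _ _ =>
    integral_nonneg fun _ => by positivity

/-- Refining the second interval by decoupling in lower degree. -/
theorem Bil.refine₂ (he : Chars μ e) (hm : 1 ≤ m) {h : ℕ} {α β x η' : ℝ}
    (HD : Dec μ e m (2 * h) η') (H : Bil μ e (m + 1) h α (2 * α / m) x)
    (hα : 0 ≤ α) (hα1 : α ≤ 1) (hαm : 2 * α / m ≤ 1) (hβ0 : 0 ≤ β) (hβ : β ≤ 2 * α / m) :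
    Bil μ e (m + 1) h α β (x + (2 * α / m - β) * η') := by
  intro B hB
  set B' : ℝ := 32 * (2 ^ m * ((m + 1) * (2 ^ (m + 4) * B))) with hB'
  have hBB' : 32 * B ≤ B' := by
    have e1 : (1 : ℝ) ≤ 2 ^ m := one_le_pow₀ (by norm_num)
    have e2 : (1 : ℝ) ≤ 2 ^ (m + 4) := one_le_pow₀ (by norm_num)
    have e3 : (1 : ℝ) ≤ m + 1 := by have : (0 : ℝ) ≤ m := by positivity
                                    linarith
    have : B ≤ 2 ^ m * ((m + 1) * (2 ^ (m + 4) * B)) := by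
      refine le_trans ?_ (le_mul_of_one_le_left (by positivity) e1)
      refine le_trans ?_ (le_mul_of_one_le_left (by positivity) e3)
      exact le_mul_of_one_le_left (by positivity) e2
    linarith
  have hB'1 : 1 ≤ B' := by linarith
  obtain ⟨K, hK, H⟩ := H B hB
  obtain ⟨K', hK', HD⟩ := HD B' hB'1
  refine ⟨K' * (2 * K), by positivity, fun S T₁ T₂ a₁ b₁ a₂ b₂ hf h1 h2 => ?_⟩
  have hδ := S.δ_pos
  have hm0 : (0 : ℝ) < m := by exact_mod_cast hm
  set ρ' : ℝ := S.δ ^ (2 * α / m) with hρ'def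
  set ρ₁ : ℝ := S.δ ^ α with hρ₁def
  set ρ₂ : ℝ := S.δ ^ β with hρ₂def
  have hle : ∀ γ : ℝ, γ ≤ 1 → S.δ ≤ S.δ ^ γ := fun γ hγ => by
    have := rpow_le_rpow_of_exponent_ge S.δ_pos S.δ_le hγ
    rwa [rpow_one] at this
  have hle1 : ∀ γ : ℝ, 0 ≤ γ → S.δ ^ γ ≤ 1 := fun γ hγ => rpow_le_one hδ.le S.δ_le hγ
  have hρ' : 0 < ρ' := by positivity
  have hρ₁ : 0 < ρ₁ := by positivity
  have hρ₂ : 0 < ρ₂ := by positivity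
  have hρρ : ρ' ≤ ρ₂ := rpow_le_rpow_of_exponent_ge S.δ_pos S.δ_le hβ
  have hρ'm : ρ' ^ m = ρ₁ ^ 2 := by
    rw [hρ'def, hρ₁def, ← rpow_natCast, ← rpow_natCast, ← rpow_mul hδ.le, ← rpow_mul hδ.le]
    congr 1
    push_cast
    field_simp
  have hρ₂1 : ρ₂ ≤ 1 := hle1 β hβ0
  have hρ'1 : ρ' ≤ 1 := hρρ.trans hρ₂1
  have hρ₁1 : ρ₁ ≤ 1 := hle1 α hα
  have hδρ' : S.δ ≤ ρ' := hle _ hαm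
  have hδρ₁ : S.δ ≤ ρ₁ := hle _ hα1
  have hW1 := T₁.W_nonneg (μ := μ) (2 * h + 2)
  have hW2 := T₂.W_nonneg (μ := μ) (2 * h + 2)
  by_cases hex : ∃ l ∈ T₁.s, (Adm (m + 1) S.Φ S.δ B S.a S.b S.g (T₁.u l)).Nonempty
  swap
  · have h0 : T₁.sum = 0 := by
      refine Spec.eq_zero_of_empty (e := e) (Ω := ∅) (spec_sum fun i hi => ?_) rfl
      rw [Set.subset_empty_iff, ← Set.not_nonempty_iff_eq_empty]
      exact fun hne => hex ⟨i, hi, hne⟩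
    rw [h0]
    simp only [ContinuousMap.zero_apply, norm_zero, mul_zero, ne_eq, OfNat.ofNat_ne_zero,
      not_false_eq_true, zero_pow, zero_mul, integral_zero]
    positivity
  obtain ⟨l, hl, ζ, hζ⟩ := hex
  have ha₁ : a₁ ∈ Set.Icc S.a S.b := ⟨hf.ha₁, hf.le₁.trans hf.hb₁⟩
  have hsub : ∀ y ∈ Set.Icc a₂ b₂, y ∈ Set.Icc S.a S.b := fun y hy =>
    ⟨hf.ha₂.trans hy.1, hy.2.trans hf.hb₂⟩
  obtain ⟨σ, hσ, hσ1⟩ : ∃ σ : ℝ, |σ| = 1 ∧ ∀ y ∈ Set.Icc a₂ b₂, c₀ ≤ σ * (y - a₁) := by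
    rcases hf.sep with h3 | h3
    · exact ⟨1, by norm_num, fun y hy => by linarith [hy.1, hf.le₁]⟩
    · exact ⟨-1, by norm_num, fun y hy => by linarith [hy.2, hf.le₂]⟩
  have hσ2 : ∀ y ∈ Set.Icc a₂ b₂, σ * (y - a₁) ≤ 1 := fun y hy => by
    have h3 := hsub y hy
    have h4 := S.hab'
    have h5 : |y - a₁| ≤ 1 := by
      rw [abs_le]
      constructor <;> linarith [h3.1, h3.2, ha₁.1, ha₁.2]
    calc σ * (y - a₁) ≤ |σ * (y - a₁)| := le_abs_self _
      _ ≤ 1 := by rw [abs_mul, hσ, one_mul]; exact h5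
  set H' : C(X, ℂ) := T₁.sum * S.H * e (-ζ) with hH'
  have hH'n : ∀ y, ‖H' y‖ = ‖T₁.sum y‖ * ‖S.H y‖ := fun y => by
    simp only [hH', ContinuousMap.mul_apply, norm_mul, he.norm_one, mul_one]
  have hspec1 : T₁.sum ∈ Spec e
      {ξ | ∃ i ∈ T₁.s, ξ ∈ Adm (m + 1) S.Φ S.δ B S.a S.b S.g (T₁.u i)} :=
    spec_sum fun l hl ξ hξ => ⟨l, hl, hξ⟩
  have hHspec : H' ∈ Spec e (Thin m (scalePhase (tiltPhase S.Φ a₁ m) (σ * (ρ₂ ^ m)⁻¹) a₂ ρ₂)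
      (ρ' / ρ₂) B' 0 ((b₂ - a₂) / ρ₂)) := by
    refine Spec.mono ?_ (Spec.mul he (Spec.mul he hspec1 S.hH)
      (Spec.mem_of (Set.mem_singleton (-ζ))))
    rintro _ ⟨_, ⟨ξ, ⟨i, hi, hξ⟩, η, hη, rfl⟩, _, rfl, rfl⟩ j hj y hy
    have hy' := hsub _ (affine_mem hρ₂ hy)
    refine (abs_dv_scalePhase_tilt S.Φ hρ₂ hσ hj _
      (lower_thin S hm hB hf.in₁ ha₁ h1 hδρ₁ hρ₁1 hy' hi hl hξ hζ hη j hj)).trans ?_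
    rw [div_pow, hρ'm, mul_div_assoc']
    have e1 : ρ₂ ^ m ≤ ρ₂ ^ (m - j) := pow_le_pow_of_le_one hρ₂.le hρ₂1 (by omega)
    have e2 : 2 ^ m * ((m + 1) * (2 ^ (m + 4) * B * ρ₁ ^ 2)) ≤ B' * ρ₁ ^ 2 := by
      have : 0 ≤ 2 ^ m * ((m + 1) * (2 ^ (m + 4) * B * ρ₁ ^ 2)) := by positivity
      have e3 : B' * ρ₁ ^ 2 = 32 * (2 ^ m * ((m + 1) * (2 ^ (m + 4) * B * ρ₁ ^ 2))) := by
        rw [hB']; ring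
      linarith
    gcongr
  have hg : ∀ y ∈ Set.Icc a₂ b₂, 1 / B' ≤ σ * (y - a₁) * S.g y ∧ σ * (y - a₁) * S.g y ≤ B' := by
    intro y hy
    obtain ⟨g1, g2⟩ := S.hg y (hsub y hy)
    have s1 := hσ1 y hy
    have s2 := hσ2 y hy
    have g0 : 0 < 1 / B := by positivity
    constructor
    · calc 1 / B' ≤ 1 / (32 * B) := by gcongr
        _ = c₀ * (1 / B) := by rw [c₀]; field_simp
        _ ≤ _ := mul_le_mul s1 g1 g0.le (c₀_pos.le.trans s1)
    · calc _ ≤ 1 * B := mul_le_mul s2 g2 (g0.le.trans g1) zero_le_one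
        _ ≤ B' := by linarith
  set δ' : ℝ := ρ' / ρ₂ with hδ'
  have hδ'0 : 0 < δ' := by positivity
  have hδ'1 : δ' ≤ 1 := by rwa [hδ', div_le_iff₀ hρ₂, one_mul]
  set S' : Setup e m B' := lowerSetup S B' a₁ a₂ b₂ ρ₂ δ' σ H' hρ₂ hδ'0 hδ'1 hf.le₂ h2 hg hHspec
    with hS'
  have hspec : ∀ l i, i ∈ (T₂.cell a₂ ρ' l).s →
      |a₂ + l * ρ' - T₂.u i| ≤ ρ' → a₂ + l * ρ' ∈ Set.Icc a₂ b₂ →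
      Adm (m + 1) S.Φ S.δ B S.a S.b S.g (T₂.u i) ⊆
        Adm m S'.Φ S'.δ B' S'.a S'.b S'.g (l * ρ' / ρ₂) := by
    intro l i hi h3 h4 ξ hξ
    have hi' := (Finset.mem_filter.1 hi).1
    constructor
    · intro j hj
      have e1 : a₂ + ρ₂ * (l * ρ' / ρ₂) = a₂ + l * ρ' := by field_simp
      have hA := lower_adm S hB ha₁ (hsub _ h4) (T₂.hu i hi') hδρ' hρ'1 h3 hξ hj
      rw [← e1] at hA
      refine (abs_dv_scalePhase_tilt S.Φ hρ₂ hσ hj.le ξ hA).trans ?_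
      show _ ≤ B' * (ρ' / ρ₂) ^ (m - j)
      rw [div_pow, mul_div_assoc']
      have : 0 ≤ 2 ^ m * ((m + 1) * (2 ^ (m + 4) * B)) := by positivity
      gcongr
      linarith
    · intro z hz
      have hz' := affine_mem hρ₂ (show z ∈ Set.Icc 0 ((b₂ - a₂) / ρ₂) from hz)
      have h5 := hξ.2 _ (hsub _ hz')
      have s1 := hσ1 _ hz'
      have s2 := hσ2 _ hz'
      have hc := c₀_pos
      show |dv m (scalePhase (tiltPhase S.Φ a₁ m) (σ * (ρ₂ ^ m)⁻¹) a₂ ρ₂ ξ) z -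
        σ * (a₂ + ρ₂ * z - a₁) * S.g (a₂ + ρ₂ * z)| ≤ B' * (ρ' / ρ₂) ^ m
      rw [dv_scalePhase]
      simp only [tiltPhase, AddMonoidHom.coe_mk, ZeroHom.coe_mk]
      rw [dv_tilt, sub_self, zero_mul, add_zero]
      have e1 : σ * (ρ₂ ^ m)⁻¹ * (ρ₂ ^ m * ((a₂ + ρ₂ * z - a₁) *
          dv (m + 1) (S.Φ ξ) (a₂ + ρ₂ * z))) -
          σ * (a₂ + ρ₂ * z - a₁) * S.g (a₂ + ρ₂ * z) = σ * (a₂ + ρ₂ * z - a₁) *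
          (dv (m + 1) (S.Φ ξ) (a₂ + ρ₂ * z) - S.g (a₂ + ρ₂ * z)) := by
        field_simp
      rw [e1, abs_mul, abs_of_nonneg (by linarith)]
      have e2 : S.δ ^ (m + 1) ≤ (ρ' / ρ₂) ^ m := by
        calc S.δ ^ (m + 1) ≤ S.δ ^ m := pow_le_pow_of_le_one hδ.le S.δ_le (by omega)
          _ ≤ (ρ' / ρ₂) ^ m := by
            gcongr
            rw [le_div_iff₀ hρ₂]
            nlinarith
      calc _ ≤ 1 * (B * S.δ ^ (m + 1)) := by gcongr
        _ ≤ B' * (ρ' / ρ₂) ^ m := by rw [one_mul]; gcongr; linarith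
  have hD := HD S' (cellFam T₂ S' a₂ b₂ ρ₂ ρ' hf.in₂ hρ' hρ₂ rfl rfl rfl hspec)
  rw [cellFam_sum T₂ S' a₂ b₂ ρ₂ ρ' hf.in₂ hρ' hρ₂ rfl rfl rfl hspec h2] at hD
  have hD2 := hD.trans (mul_le_mul_of_nonneg_left (mul_le_mul_of_nonneg_left
    (cellFam_W_le T₂ S' a₂ b₂ ρ₂ ρ' hf.in₂ hρ' hρ₂ rfl rfl rfl hspec (2 * h)) hδ'0.le)
    (by positivity : 0 ≤ K' * δ' ^ η'))
  have hD3 : ∫ y, (δ' * ‖T₂.sum y‖) ^ (2 * h) * ‖H' y‖ ^ 2 ∂μ ≤ K' * δ' ^ η' * (δ' *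
      ∑ l ∈ Finset.range (⌊ρ₂ / ρ'⌋₊ + 1),
        ∫ y, ‖(T₂.cell a₂ ρ' l).sum y‖ ^ (2 * h) * ‖H' y‖ ^ 2 ∂μ) := hD2
  set I : ℕ → ℝ := fun l => ∫ y, (S.δ / ρ₁ * ‖T₁.sum y‖) ^ 2 *
    (S.δ / ρ' * ‖(T₂.cell a₂ ρ' l).sum y‖) ^ (2 * h) * ‖S.H y‖ ^ 2 ∂μ with hI
  have h4 := sum_avg_le (N := Finset.range (⌊ρ₂ / ρ'⌋₊ + 1)) (r := ρ' / ρ₂)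
    (K := K * S.δ ^ x) (W := S.δ / ρ₁ * T₁.W μ (2 * h + 2))
    (V := fun m => S.δ / ρ' * (T₂.cell a₂ ρ' m).W μ (2 * h + 2))
    (I := I)
    (by positivity) (cells_ratio hρ' hρρ) (by positivity)
    (mul_nonneg (by positivity) (T₁.W_nonneg _))
    (fun m => mul_nonneg (by positivity) (Fam.W_nonneg _ _))
    (fun l _ => by
      have := H S _ _ _ _ _ _ (hf.cell₂ hρ' l) h1 (Fam.cell_len hρ' l).2
      rw [add_comm (S.δ / S.δ ^ α * _)] at this
      exact this)
  rw [← Fam.W_avg T₂ hf.in₂ h2 hρ'] at h4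
  have hx : S.δ ^ (x + (2 * α / m - β) * η') = S.δ ^ x * δ' ^ η' := by
    rw [rpow_add hδ, rpow_mul hδ.le, rpow_sub hδ]
  have hIl : ∀ l, (S.δ / ρ₁) ^ 2 * (S.δ / ρ') ^ (2 * h) *
      ∫ y, ‖(T₂.cell a₂ ρ' l).sum y‖ ^ (2 * h) * ‖H' y‖ ^ 2 ∂μ = I l := by
    intro l
    rw [hI, ← integral_const_mul]
    congr 1; ext y
    rw [hH'n]
    ring
  calc ∫ y, (S.δ / ρ₁ * ‖T₁.sum y‖) ^ 2 * (S.δ / ρ₂ * ‖T₂.sum y‖) ^ (2 * h) * ‖S.H y‖ ^ 2 ∂μ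
      = (S.δ / ρ₁) ^ 2 * (S.δ / ρ') ^ (2 * h) *
        ∫ y, (δ' * ‖T₂.sum y‖) ^ (2 * h) * ‖H' y‖ ^ 2 ∂μ := by
        rw [← integral_const_mul]
        congr 1; ext y
        rw [hH'n]
        have e1 : S.δ / ρ₂ = S.δ / ρ' * δ' := by rw [hδ']; field_simp
        rw [e1]
        ring
    _ ≤ (S.δ / ρ₁) ^ 2 * (S.δ / ρ') ^ (2 * h) * (K' * δ' ^ η' * (δ' *
      ∑ l ∈ Finset.range (⌊ρ₂ / ρ'⌋₊ + 1),
        ∫ y, ‖(T₂.cell a₂ ρ' l).sum y‖ ^ (2 * h) * ‖H' y‖ ^ 2 ∂μ)) := by gcongr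
    _ = K' * δ' ^ η' * (δ' * ∑ l ∈ Finset.range (⌊ρ₂ / ρ'⌋₊ + 1), I l) := by
        simp only [← hIl]
        rw [← Finset.mul_sum]; ring
    _ ≤ K' * δ' ^ η' * (2 * (K * S.δ ^ x) * (S.δ / ρ₂ * T₂.W μ (2 * h + 2) +
          S.δ / ρ₁ * T₁.W μ (2 * h + 2))) := by
        gcongr
    _ = _ := by rw [hx]; ring

end Descent

section BroadNarrow

variable {X G : Type*} [TopologicalSpace X] [CompactSpace X] [MeasurableSpace X] [BorelSpace X]
  [AddCommGroup G] {μ : Measure X} [IsProbabilityMeasure μ] {e : G → C(X, ℂ)}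
  {k : ℕ} {B : ℝ}

/-- Pairs of indices of nonadjacent intervals. -/
def farPairs (N : ℕ) : Finset (ℕ × ℕ) :=
  ((Finset.range N) ×ˢ (Finset.range N)).filter fun p => p.1 + 2 ≤ p.2 ∨ p.2 + 2 ≤ p.1

theorem broad_narrow {N : ℕ} (hN : 1 ≤ N) (z : ℕ → ℝ) (hz : ∀ i, 0 ≤ z i) (h : ℕ) :
    (∑ i ∈ Finset.range N, z i) ^ (2 * h + 2) ≤
      4 ^ (2 * h + 2) * ∑ i ∈ Finset.range N, z i ^ (2 * h + 2) +
        (N : ℝ) ^ (2 * h + 4) * ∑ p ∈ farPairs N, z p.1 ^ 2 * z p.2 ^ (2 * h) := by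
  have hN' : (1 : ℝ) ≤ N := by exact_mod_cast hN
  obtain ⟨m, hm, hmax⟩ := Finset.exists_max_image (Finset.range N) z ⟨0, by simp; omega⟩
  set M := z m with hM
  have hM0 : 0 ≤ M := hz m
  have hS0 : 0 ≤ ∑ i ∈ Finset.range N, z i := Finset.sum_nonneg fun i _ => hz i
  have hA0 : 0 ≤ ∑ i ∈ Finset.range N, z i ^ (2 * h + 2) :=
    Finset.sum_nonneg fun i _ => pow_nonneg (hz i) _
  have hB0 : 0 ≤ ∑ p ∈ farPairs N, z p.1 ^ 2 * z p.2 ^ (2 * h) :=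
    Finset.sum_nonneg fun p _ => mul_nonneg (pow_nonneg (hz _) _) (pow_nonneg (hz _) _)
  have hMA : M ^ (2 * h + 2) ≤ ∑ i ∈ Finset.range N, z i ^ (2 * h + 2) :=
    Finset.single_le_sum (f := fun i => z i ^ (2 * h + 2)) (fun i _ => pow_nonneg (hz i) _) hm
  by_cases hfar : ∃ i ∈ Finset.range N, (i + 2 ≤ m ∨ m + 2 ≤ i) ∧ M ≤ N * z i
  · obtain ⟨i, hi, him, hiM⟩ := hfar
    have h1 : ∑ i ∈ Finset.range N, z i ≤ N * M := by
      have := Finset.sum_le_card_nsmul (Finset.range N) z M hmax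
      rwa [Finset.card_range, nsmul_eq_mul] at this
    have h2 : z i ^ 2 * z m ^ (2 * h) ≤ ∑ p ∈ farPairs N, z p.1 ^ 2 * z p.2 ^ (2 * h) := by
      refine Finset.single_le_sum (f := fun p : ℕ × ℕ => z p.1 ^ 2 * z p.2 ^ (2 * h))
        (fun p _ => mul_nonneg (pow_nonneg (hz _) _) (pow_nonneg (hz _) _)) (a := (i, m)) ?_
      simp only [farPairs, Finset.mem_filter, Finset.mem_product]
      exact ⟨⟨hi, hm⟩, him⟩
    calc _ ≤ (N * M) ^ (2 * h + 2) := by gcongr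
      _ = (N : ℝ) ^ (2 * h + 2) * (M ^ 2 * M ^ (2 * h)) := by ring
      _ ≤ (N : ℝ) ^ (2 * h + 2) * ((N * z i) ^ 2 * M ^ (2 * h)) := by gcongr
      _ = (N : ℝ) ^ (2 * h + 4) * (z i ^ 2 * z m ^ (2 * h)) := by rw [hM]; ring
      _ ≤ (N : ℝ) ^ (2 * h + 4) * ∑ p ∈ farPairs N, z p.1 ^ 2 * z p.2 ^ (2 * h) := by gcongr
      _ ≤ _ := by
        have : 0 ≤ 4 ^ (2 * h + 2) * ∑ i ∈ Finset.range N, z i ^ (2 * h + 2) := by positivity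
        linarith
  · have hlt : ∀ i ∈ Finset.range N, (i + 2 ≤ m ∨ m + 2 ≤ i) → z i ≤ M / N := by
      intro i hi him
      rw [le_div_iff₀ (by linarith), mul_comm]
      by_contra hcon
      exact hfar ⟨i, hi, him, (not_le.1 hcon).le⟩
    have h1 : ∑ i ∈ Finset.range N, z i ≤ 4 * M := by
      rw [← Finset.sum_filter_add_sum_filter_not (Finset.range N) (fun i => i + 2 ≤ m ∨ m + 2 ≤ i)]
      have e1 : ∑ i ∈ Finset.range N with (i + 2 ≤ m ∨ m + 2 ≤ i), z i ≤ M := by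
        calc _ ≤ ∑ i ∈ Finset.range N with (i + 2 ≤ m ∨ m + 2 ≤ i), M / N :=
              Finset.sum_le_sum fun i hi =>
                hlt i (Finset.mem_filter.1 hi).1 (Finset.mem_filter.1 hi).2
          _ ≤ ∑ i ∈ Finset.range N, M / N :=
              Finset.sum_le_sum_of_subset_of_nonneg (Finset.filter_subset _ _)
                fun _ _ _ => by positivity
          _ = M := by rw [Finset.sum_const, Finset.card_range, nsmul_eq_mul]; field_simp
      have e2 : ∑ i ∈ Finset.range N with ¬(i + 2 ≤ m ∨ m + 2 ≤ i), z i ≤ 3 * M := by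
        have hc : (Finset.filter (fun i => ¬(i + 2 ≤ m ∨ m + 2 ≤ i)) (Finset.range N)).card ≤ 3 := by
          refine (Finset.card_le_card (t := Finset.Icc (m - 1) (m + 1)) fun i hi => ?_).trans ?_
          · have := (Finset.mem_filter.1 hi).2
            rw [Finset.mem_Icc]; omega
          · rw [Nat.card_Icc]; omega
        have := Finset.sum_le_card_nsmul
          (Finset.filter (fun i => ¬(i + 2 ≤ m ∨ m + 2 ≤ i)) (Finset.range N)) z M
          (fun i hi => hmax i (Finset.mem_filter.1 hi).1)
        rw [nsmul_eq_mul] at this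
        refine this.trans ?_
        have : ((Finset.filter (fun i => ¬(i + 2 ≤ m ∨ m + 2 ≤ i)) (Finset.range N)).card : ℝ) ≤ 3 := by
          exact_mod_cast hc
        gcongr
      linarith
    calc _ ≤ (4 * M) ^ (2 * h + 2) := by gcongr
      _ = 4 ^ (2 * h + 2) * M ^ (2 * h + 2) := by ring
      _ ≤ 4 ^ (2 * h + 2) * ∑ i ∈ Finset.range N, z i ^ (2 * h + 2) := by gcongr
      _ ≤ _ := by
        have : 0 ≤ (N : ℝ) ^ (2 * h + 4) * ∑ p ∈ farPairs N, z p.1 ^ 2 * z p.2 ^ (2 * h) := by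
          positivity
        linarith

theorem Fam.W_cell_le {S : Setup e k B} (T : Fam S) (a ρ : ℝ) (m P : ℕ) :
    (T.cell a ρ m).W μ P ≤ T.W μ P :=
  Finset.sum_le_sum_of_subset_of_nonneg (Finset.filter_subset _ _) fun _ _ _ =>
    integral_nonneg fun _ => by positivity

theorem Fam.far_cells {h : ℕ} {x K : ℝ} {S : Setup e k B} (hK : 0 ≤ K) (T : Fam S)
    (H : ∀ (T₁ T₂ : Fam S) (a₁ b₁ a₂ b₂ : ℝ),
      BilFam T₁ T₂ a₁ b₁ a₂ b₂ → b₁ - a₁ ≤ 1 → b₂ - a₂ ≤ 1 →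
      ∫ y, (S.δ * ‖T₁.sum y‖) ^ 2 * (S.δ * ‖T₂.sum y‖) ^ (2 * h) * ‖S.H y‖ ^ 2 ∂μ ≤
      K * S.δ ^ x * (S.δ * T₁.W μ (2 * h + 2) + S.δ * T₂.W μ (2 * h + 2)))
    (hh : 1 ≤ h) (i j : ℕ) (hij : i + 2 ≤ j ∨ j + 2 ≤ i) :
    ∫ y, (S.δ * ‖(T.cell S.a (1 / 32) i).sum y‖) ^ 2 *
      (S.δ * ‖(T.cell S.a (1 / 32) j).sum y‖) ^ (2 * h) * ‖S.H y‖ ^ 2 ∂μ ≤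
      2 * K * S.δ ^ x * (S.δ * T.W μ (2 * h + 2)) := by
  have hδ := S.δ_pos
  have hW := T.W_nonneg (μ := μ) (2 * h + 2)
  have hT : T.In S.a S.b := T.hu
  have hab := S.hab
  have hab' := S.hab'
  have hr : (0 : ℝ) < 1 / 32 := by norm_num
  by_cases hi : (T.cell S.a (1 / 32) i).s.Nonempty
  swap
  · rw [Finset.not_nonempty_iff_eq_empty] at hi
    have : (T.cell S.a (1 / 32) i).sum = 0 := by rw [Fam.sum, hi, Finset.sum_empty]
    rw [this]
    simp only [ContinuousMap.zero_apply, norm_zero, mul_zero, ne_eq, OfNat.ofNat_ne_zero,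
      not_false_eq_true, zero_pow, zero_mul, integral_zero]
    positivity
  by_cases hj : (T.cell S.a (1 / 32) j).s.Nonempty
  swap
  · rw [Finset.not_nonempty_iff_eq_empty] at hj
    have : (T.cell S.a (1 / 32) j).sum = 0 := by rw [Fam.sum, hj, Finset.sum_empty]
    rw [this]
    have h0 : 2 * h ≠ 0 := by omega
    simp only [ContinuousMap.zero_apply, norm_zero, mul_zero, ne_eq, h0,
      not_false_eq_true, zero_pow, zero_mul, integral_zero]
    positivity
  have hleft : ∀ i, (T.cell S.a (1 / 32) i).s.Nonempty → S.a + i * (1 / 32) ≤ S.b := by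
    rintro i ⟨l, hl⟩
    obtain ⟨hl, hm⟩ := Finset.mem_filter.1 hl
    have h0 : 0 ≤ (T.u l - S.a) / (1 / 32) := div_nonneg (by linarith [(hT l hl).1]) hr.le
    have h1 := Nat.floor_le h0
    rw [hm, le_div_iff₀ hr] at h1
    linarith [(hT l hl).2]
  have li := hleft i hi
  have lj := hleft j hj
  have hb : BilFam (T.cell S.a (1 / 32) i) (T.cell S.a (1 / 32) j) (min S.b (S.a + i * (1 / 32)))
      (min S.b (S.a + (i + 1) * (1 / 32))) (min S.b (S.a + j * (1 / 32)))
      (min S.b (S.a + (j + 1) * (1 / 32))) :=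
    { in₁ := Fam.cell_In hT hr i
      in₂ := Fam.cell_In hT hr j
      le₁ := (Fam.cell_len hr i).1
      le₂ := (Fam.cell_len hr j).1
      ha₁ := Fam.cell_left hr hab i
      ha₂ := Fam.cell_left hr hab j
      hb₁ := min_le_left _ _
      hb₂ := min_le_left _ _
      sep := by
        have m1 := min_le_right S.b (S.a + (i + 1) * (1 / 32))
        have m2 := min_le_right S.b (S.a + (j + 1) * (1 / 32))
        rw [min_eq_right li, min_eq_right lj, c₀]
        rcases hij with hij | hij
        · have : (i : ℝ) + 2 ≤ j := by exact_mod_cast hij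
          left; linarith
        · have : (j : ℝ) + 2 ≤ i := by exact_mod_cast hij
          right; linarith }
  have h3 := H _ _ _ _ _ _ hb ((Fam.cell_len hr i).2.trans (by norm_num))
    ((Fam.cell_len hr j).2.trans (by norm_num))
  have w1 := T.W_cell_le (μ := μ) S.a (1 / 32) i (2 * h + 2)
  have w2 := T.W_cell_le (μ := μ) S.a (1 / 32) j (2 * h + 2)
  calc _ ≤ _ := h3
    _ ≤ K * S.δ ^ x * (S.δ * T.W μ (2 * h + 2) + S.δ * T.W μ (2 * h + 2)) := by gcongr
    _ = _ := by ring

/-- Broad-narrow analysis: the bilinear inequality implies the linear one. -/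
theorem Bil.toDec {h : ℕ} {x : ℝ} (hh : 1 ≤ h) (hx0 : 0 ≤ x) (hx : x ≤ h)
    (H : Bil μ e k h 0 0 x) : Dec μ e k (2 * h + 2) x := by
  intro B hB
  obtain ⟨K, hK, H⟩ := H B hB
  obtain ⟨K₀, hK₀, H₀⟩ := Dec.zero (μ := μ) (e := e) k (P := 2 * h + 2) (by omega) B hB
  obtain ⟨q, hq⟩ : ∃ q : ℕ, q = 33 := ⟨33, rfl⟩
  set C₁ : ℝ := q ^ (2 * h + 4) * ((farPairs q).card * (2 * K)) with hC₁
  have hC₁0 : 0 ≤ C₁ := by positivity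
  set A : ℝ := 2 * C₁ + K₀ * 32 ^ x with hA
  have hA0 : 0 ≤ A := by positivity
  refine ⟨A, hA0, ?_⟩
  suffices hscale : ∀ (N : ℕ) (S : Setup e k B) (T : Fam S), (1 / 32 : ℝ) ^ N ≤ S.δ →
      ∫ y, (S.δ * ‖T.sum y‖) ^ (2 * h + 2) * ‖S.H y‖ ^ 2 ∂μ ≤
        A * S.δ ^ x * (S.δ * T.W μ (2 * h + 2)) by
    intro S T
    obtain ⟨N, hN⟩ := exists_pow_lt_of_lt_one S.δ_pos (show (1 / 32 : ℝ) < 1 by norm_num)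
    exact hscale N S T hN.le
  intro N
  induction N with
  | zero =>
    intro S T hS
    have hW := T.W_nonneg (μ := μ) (2 * h + 2)
    have h1 : S.δ = 1 := le_antisymm S.δ_le (by simpa using hS)
    have h2 := H₀ S T
    rw [h1] at h2 ⊢
    rw [one_rpow] at h2 ⊢
    refine h2.trans ?_
    have : K₀ * 1 ≤ A := by
      have h3 : (1 : ℝ) ≤ 32 ^ x := one_le_rpow (by norm_num) hx0
      have : K₀ * 1 ≤ K₀ * 32 ^ x := by gcongr
      linarith
    rw [mul_one A]
    gcongr
  | succ N ih =>
    intro S T hS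
    have hW := T.W_nonneg (μ := μ) (2 * h + 2)
    have hδ := S.δ_pos
    by_cases hbig : 1 / 32 < S.δ
    · have h2 := H₀ S T
      rw [rpow_zero, mul_one] at h2
      refine h2.trans ?_
      have h3 : 1 ≤ 32 ^ x * S.δ ^ x := by
        rw [← mul_rpow (by norm_num) hδ.le]
        exact one_le_rpow (by linarith) hx0
      have : K₀ ≤ A * S.δ ^ x := by
        have h4 : 0 ≤ C₁ * S.δ ^ x := by positivity
        have h5 : A * S.δ ^ x = 2 * (C₁ * S.δ ^ x) + K₀ * (32 ^ x * S.δ ^ x) := by rw [hA]; ring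
        have h6 : K₀ * 1 ≤ K₀ * (32 ^ x * S.δ ^ x) := by gcongr
        linarith
      gcongr
    · have hsm : S.δ ≤ 1 / 32 := not_lt.1 hbig
      have hr : (0 : ℝ) < 1 / 32 := by norm_num
      have hT : T.In S.a S.b := T.hu
      have hcard : ⌊(1 : ℝ) / (1 / 32)⌋₊ + 1 = q := by rw [hq]; norm_num
      have hsum := Fam.sum_cell hT (by linarith [S.hab'] : S.b - S.a ≤ 1) hr
      have hWsum := Fam.W_cell (μ := μ) hT (by linarith [S.hab'] : S.b - S.a ≤ 1) hr (2 * h + 2)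
      rw [hcard] at hsum hWsum
      have hnarrow : ∀ m, ∫ y, (S.δ * ‖(T.cell S.a (1 / 32) m).sum y‖) ^ (2 * h + 2) *
          ‖S.H y‖ ^ 2 ∂μ ≤ (1 / 32) ^ (2 * h + 2) * (A * (S.δ / (1 / 32)) ^ x * (S.δ / (1 / 32) *
            (T.cell S.a (1 / 32) m).W μ (2 * h + 2))) := by
        intro m
        have h1 := ih (S.rescale (by linarith) (Fam.cell_left hr S.hab m) (Fam.cell_len hr m).1
          (min_le_left _ _) (Fam.cell_len hr m).2 hsm (by norm_num))
          ((T.cell S.a (1 / 32) m).rescale (by linarith) (Fam.cell_left hr S.hab m)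
            (Fam.cell_len hr m).1
            (min_le_left _ _) (Fam.cell_len hr m).2 hsm (by norm_num) (Fam.cell_In hT hr m))
          (by
            show _ ≤ S.δ / (1 / 32)
            rw [le_div_iff₀ hr, ← pow_succ]; exact hS)
        have h2 : ∫ y, (S.δ / (1 / 32) * ‖(T.cell S.a (1 / 32) m).sum y‖) ^ (2 * h + 2) *
          ‖S.H y‖ ^ 2 ∂μ ≤ A * (S.δ / (1 / 32)) ^ x * (S.δ / (1 / 32) *
            (T.cell S.a (1 / 32) m).W μ (2 * h + 2)) := h1
        refine le_trans (le_of_eq ?_) (mul_le_mul_of_nonneg_left h2 (by positivity))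
        rw [← integral_const_mul]
        congr 1; ext y
        rw [← mul_assoc, ← mul_pow]
        congr 2
        ring
      have hgain : (4 : ℝ) ^ (2 * h + 2) * ((1 / 32) ^ (2 * h + 2) * (1 / (1 / 32)) ^ x * 32) ≤
          1 / 2 := by
        have e1 : (1 / (1 / 32) : ℝ) ^ x ≤ 32 ^ h := by
          rw [← rpow_natCast, show (1 / (1 / 32) : ℝ) = 32 by norm_num]
          exact rpow_le_rpow_of_exponent_le (by norm_num : (1 : ℝ) ≤ 32) hx
        calc _ ≤ (4 : ℝ) ^ (2 * h + 2) * ((1 / 32) ^ (2 * h + 2) * 32 ^ h * 32) := by gcongr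
          _ = (1 / 2) ^ h * (1 / 2) := by
            rw [pow_add, pow_add, pow_mul, pow_mul]
            have : (1 / 2 : ℝ) ^ h = ((4 : ℝ) ^ 2) ^ h * ((1 / 32) ^ 2) ^ h * 32 ^ h := by
              rw [← mul_pow, ← mul_pow]; norm_num
            rw [this]; ring
          _ ≤ 1 * (1 / 2) := by
            gcongr
            exact pow_le_one₀ (by norm_num) (by norm_num)
          _ = _ := by ring
      have hfar := fun i j hij => T.far_cells (μ := μ) (x := x) hK (fun T₁ T₂ a₁ b₁ a₂ b₂ hb h1 h2 => by
        have := H S T₁ T₂ a₁ b₁ a₂ b₂ hb (by rwa [rpow_zero]) (by rwa [rpow_zero])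
        simpa only [rpow_zero, div_one] using this) hh i j hij
      calc ∫ y, (S.δ * ‖T.sum y‖) ^ (2 * h + 2) * ‖S.H y‖ ^ 2 ∂μ
          ≤ ∫ y, (4 ^ (2 * h + 2) * ∑ m ∈ Finset.range q,
              (S.δ * ‖(T.cell S.a (1 / 32) m).sum y‖) ^ (2 * h + 2) * ‖S.H y‖ ^ 2 +
              (q : ℝ) ^ (2 * h + 4) * ∑ p ∈ farPairs q,
              (S.δ * ‖(T.cell S.a (1 / 32) p.1).sum y‖) ^ 2 *
              (S.δ * ‖(T.cell S.a (1 / 32) p.2).sum y‖) ^ (2 * h) * ‖S.H y‖ ^ 2) ∂μ := by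
            refine integral_mono (cint (by fun_prop)) (cint (by fun_prop)) fun y => ?_
            have h1 := broad_narrow (N := q) (by omega)
              (fun m => S.δ * ‖(T.cell S.a (1 / 32) m).sum y‖) (fun m => by positivity) h
            have h2 : S.δ * ‖T.sum y‖ ≤ ∑ m ∈ Finset.range q,
                S.δ * ‖(T.cell S.a (1 / 32) m).sum y‖ := by
              rw [hsum, ← Finset.mul_sum, ContinuousMap.sum_apply]
              gcongr
              exact norm_sum_le _ _
            have h3 : (S.δ * ‖T.sum y‖) ^ (2 * h + 2) ≤ _ :=
              (pow_le_pow_left₀ (by positivity) h2 _).trans h1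
            calc _ ≤ _ := mul_le_mul_of_nonneg_right h3 (by positivity : 0 ≤ ‖S.H y‖ ^ 2)
              _ = _ := by
                rw [add_mul, mul_assoc, mul_assoc, Finset.sum_mul, Finset.sum_mul]
        _ = 4 ^ (2 * h + 2) * ∑ m ∈ Finset.range q,
              ∫ y, (S.δ * ‖(T.cell S.a (1 / 32) m).sum y‖) ^ (2 * h + 2) * ‖S.H y‖ ^ 2 ∂μ +
              (q : ℝ) ^ (2 * h + 4) * ∑ p ∈ farPairs q,
              ∫ y, (S.δ * ‖(T.cell S.a (1 / 32) p.1).sum y‖) ^ 2 *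
              (S.δ * ‖(T.cell S.a (1 / 32) p.2).sum y‖) ^ (2 * h) * ‖S.H y‖ ^ 2 ∂μ := by
            rw [integral_add (cint (by fun_prop)) (cint (by fun_prop)), integral_const_mul,
              integral_const_mul, integral_finsetSum _ fun i _ => cint (by fun_prop),
              integral_finsetSum _ fun i _ => cint (by fun_prop)]
        _ ≤ 4 ^ (2 * h + 2) * ∑ m ∈ Finset.range q, (1 / 32) ^ (2 * h + 2) *
              (A * (S.δ / (1 / 32)) ^ x * (S.δ / (1 / 32) *
                (T.cell S.a (1 / 32) m).W μ (2 * h + 2))) +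
              (q : ℝ) ^ (2 * h + 4) * ∑ p ∈ farPairs q, 2 * K * S.δ ^ x * (S.δ * T.W μ (2 * h + 2)) := by
            gcongr with m hm p hp
            · exact hnarrow m
            · exact hfar p.1 p.2 (Finset.mem_filter.1 hp).2
        _ = 4 ^ (2 * h + 2) * ((1 / 32) ^ (2 * h + 2) * (1 / (1 / 32)) ^ x * 32) *
              (A * S.δ ^ x * (S.δ * T.W μ (2 * h + 2))) +
              C₁ * (S.δ ^ x * (S.δ * T.W μ (2 * h + 2))) := by
            rw [← Finset.mul_sum, ← Finset.mul_sum, ← Finset.mul_sum, ← hWsum, Finset.sum_const,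
              nsmul_eq_mul, hC₁, div_eq_mul_one_div S.δ, mul_rpow hδ.le (by norm_num)]
            ring
        _ ≤ 1 / 2 * (A * S.δ ^ x * (S.δ * T.W μ (2 * h + 2))) +
              A / 2 * (S.δ ^ x * (S.δ * T.W μ (2 * h + 2))) := by
            have : 0 ≤ K₀ * (32 : ℝ) ^ x := by positivity
            gcongr
            linarith
        _ = _ := by ring

end BroadNarrow

section MeanValue

variable {X G : Type*} [TopologicalSpace X] [CompactSpace X] [MeasurableSpace X] [BorelSpace X]
  [AddCommGroup G] {μ : Measure X} [IsProbabilityMeasure μ] {e : G → C(X, ℂ)}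
  {k : ℕ} {B : ℝ}

theorem Dec.mono {P : ℕ} {η η' : ℝ} (H : Dec μ e k P η) (h : η' ≤ η) : Dec μ e k P η' := by
  intro B hB
  obtain ⟨K, hK, H⟩ := H B hB
  refine ⟨K, hK, fun S T => (H S T).trans ?_⟩
  have h3 : S.δ ^ η ≤ S.δ ^ η' := rpow_le_rpow_of_exponent_ge S.δ_pos S.δ_le h
  have hW := T.W_nonneg (μ := μ) P
  have hδ := S.δ_pos
  gcongr

theorem Bil.iterate (he : Chars μ e) {m h : ℕ} (hm : 1 ≤ m) {κ β Z : ℝ}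
    (HD : Dec μ e m (2 * h) (κ - (m + 1))) (hβ0 : 0 ≤ β) (hβ1 : (m + 1) * β ≤ 1)
    (H : Bil μ e (m + 1) h ((m + 1) * β) β (Z - κ * β)) (i : ℕ) :
    Bil μ e (m + 1) h ((m + 1) * (β * (m / (2 * (m + 1))) ^ i)) (β * (m / (2 * (m + 1))) ^ i)
      (Z - κ * (β * (m / (2 * (m + 1))) ^ i)) := by
  have hm' : (1 : ℝ) ≤ m := by exact_mod_cast hm
  induction i with
  | zero => simpa using H
  | succ i ih =>
    set q : ℝ := m / (2 * (m + 1)) with hq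
    have hq0 : 0 ≤ q := by positivity
    have hq1 : q ≤ 1 := by rw [hq, div_le_one (by positivity)]; linarith
    have hqm : (m + 1) * q = m / 2 := by rw [hq]; field_simp
    set b := β * q ^ i with hb
    have hb0 : 0 ≤ b := by positivity
    have hbβ : b ≤ β := mul_le_of_le_one_right hβ0 (pow_le_one₀ hq0 hq1)
    have hb1 : (m + 1) * b ≤ 1 := le_trans (by gcongr) hβ1
    have hbm : m * b ≤ 1 := le_trans (by gcongr; linarith) hb1
    rw [show β * q ^ (i + 1) = b * q by rw [hb]; ring]
    have e1 : (m + 1) * (b * q) = m / 2 * b := by rw [← hqm]; ring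
    have h1 := Bil.refine₁ he (by omega : 1 ≤ m + 1) (α := m / 2 * b) (by push_cast; exact ih) hb0
      (by positivity) (by push_cast; gcongr; linarith) (by push_cast; exact hb1)
    have e2 : 2 * (m / 2 * b) / m = b := by field_simp
    have h2 := Bil.refine₂ he hm (β := b * q) HD (by rw [e2]; exact h1) (by positivity) (by linarith)
      (by rw [e2]; nlinarith) (by positivity) (by rw [e2]; exact mul_le_of_le_one_right hb0 hq1)
    rw [e2] at h2
    rw [e1]
    convert h2 using 1
    push_cast
    linear_combination -b * hqm

theorem Dec.improve (he : Chars μ e) {m h : ℕ} (hm : 1 ≤ m) (hh : 1 ≤ h) {κ ε η : ℝ}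
    (HD : Dec μ e m (2 * h) (κ - (m + 1))) (H : Dec μ e (m + 1) (2 * h + 2) η) (hε : 0 < ε)
    (hη0 : 0 ≤ η) (hη : η ≤ κ - 3 * ε) (hP : 2 * η / (2 * h + 2) ≤ ε / (m + 1))
    (hηh : η + ε / (m + 1) ≤ h) : Dec μ e (m + 1) (2 * h + 2) (η + ε / (m + 1)) := by
  have hm' : (1 : ℝ) ≤ m := by exact_mod_cast hm
  have hM : (0 : ℝ) < m + 1 := by linarith
  have hb1 : (1 : ℝ) / (m + 1) ≤ 1 := by rw [div_le_one hM]; linarith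
  have h0 := H.toBil zero_le_one le_rfl (by positivity : (0 : ℝ) ≤ 1 / (m + 1)) hb1
  have hκ : 0 < κ := by linarith
  set x := η * (1 - 1 / (m + 1)) - 2 * η * (1 - 1 / (m + 1)) / (2 * h + 2) with hx
  have h1 := Bil.iterate he hm (β := 1 / (m + 1)) (Z := x + κ * (1 / (m + 1))) HD (by positivity)
    (by rw [mul_one_div_cancel hM.ne'])
    (by rw [mul_one_div_cancel hM.ne', add_sub_cancel_right]; exact h0)
  obtain ⟨i, hi⟩ := exists_pow_lt_of_lt_one (div_pos hε hκ)
    (show (m / (2 * (m + 1)) : ℝ) < 1 by rw [div_lt_one (by positivity)]; linarith)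
  refine Bil.toDec hh (by positivity) hηh ?_
  refine Bil.mono ((h1 i).shrink₁ (α' := 0) (by positivity) |>.shrink₂ hh (by positivity)) ?_
  have h2 : κ * (1 / (m + 1) * (m / (2 * (m + 1))) ^ i) ≤ ε / (m + 1) := by
    calc κ * (1 / (m + 1) * (m / (2 * (m + 1))) ^ i) ≤ κ * (1 / (m + 1) * (ε / κ)) := by gcongr
      _ = ε / (m + 1) := by field_simp
  have h3 : 2 * η * (1 - 1 / (m + 1)) / (2 * h + 2) ≤ ε / (m + 1) := by
    have : (0 : ℝ) ≤ 1 / (m + 1) := by positivity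
    have h5 : 2 * η * (1 - 1 / (m + 1)) ≤ 2 * η :=
      mul_le_of_le_one_right (by positivity) (by linarith)
    exact le_trans (by gcongr) hP
  have h4 : 3 * (ε / (m + 1)) ≤ (κ - η) * (1 / (m + 1)) := by
    rw [← mul_div_assoc, mul_one_div]
    gcongr
    linarith
  rw [hx]
  linarith

/-- Discrete decoupling for the moment curve, in the mean value form. -/
theorem decoupling (he : Chars μ e) (k : ℕ) (hk : 1 ≤ k) {ε : ℝ} (hε : 0 < ε) :
    ∃ h₀ : ℕ, ∀ h ≥ h₀, Dec μ e k (2 * h + 2) (k * (k + 1) / 2 - ε) := by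
  induction k, hk using Nat.le_induction generalizing ε with
  | base =>
    refine ⟨1, fun h hh => ?_⟩
    have h1 : Bil μ e 1 h 1 1 0 := by
      simpa using (Dec.zero (μ := μ) (e := e) 1 (P := 2 * h + 2) (by omega)).toBil
        zero_le_one le_rfl zero_le_one le_rfl
    have h2 := Bil.refine₁ he le_rfl (α := 0) (β := 1) (by simpa using h1) (by norm_num) le_rfl
      (by norm_num) (by norm_num)
    have h3 : Bil μ e 1 h 0 0 1 := by simpa using h2.shrink₂ hh (β' := 0) zero_le_one
    refine (h3.toDec hh zero_le_one (by exact_mod_cast hh)).mono ?_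
    norm_num
    linarith
  | succ m hm ih =>
    obtain ⟨h₀, ih⟩ := ih (show 0 < ε / 4 by linarith)
    have hm' : (1 : ℝ) ≤ m := by exact_mod_cast hm
    have hM : (0 : ℝ) < m + 1 := by linarith
    set κ : ℝ := (m + 1) * (m + 1 + 1) / 2 - ε / 4 with hκ
    set g : ℝ := ε / 4 / (m + 1) with hg
    have hg0 : 0 < g := by positivity
    obtain ⟨h₁, hh₁⟩ := exists_nat_ge (κ / g)
    obtain ⟨h₂, hh₂⟩ := exists_nat_ge (κ + g)
    refine ⟨max (h₀ + 1) (max h₁ h₂), fun h hh => ?_⟩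
    have hha : h₀ + 1 ≤ h := (le_max_left _ _).trans hh
    have hhb : (h₁ : ℝ) ≤ h := by
      exact_mod_cast (le_max_left _ _).trans ((le_max_right _ _).trans hh)
    have hhc : (h₂ : ℝ) ≤ h := by
      exact_mod_cast (le_max_right _ _).trans ((le_max_right _ _).trans hh)
    have HD : Dec μ e m (2 * h) (κ - (m + 1)) := by
      have := ih (h - 1) (by omega)
      rw [show 2 * (h - 1) + 2 = 2 * h by omega] at this
      refine this.mono (le_of_eq ?_)
      rw [hκ]; ring
    by_cases hpos : κ - 3 * (ε / 4) < 0
    · refine (Dec.zero (m + 1) (by omega)).mono ?_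
      push_cast
      linarith
    have key : ∀ j : ℕ, j * g ≤ κ - 3 * (ε / 4) + g → Dec μ e (m + 1) (2 * h + 2) (j * g) := by
      intro j
      induction j with
      | zero => intro _; simpa using Dec.zero (m + 1) (by omega)
      | succ j ihj =>
        intro hj
        push_cast at hj ⊢
        have h1 := ihj (by linarith)
        have h2 := Dec.improve he hm (by omega) HD h1 (show 0 < ε / 4 by linarith) (by positivity)
          (by linarith) (by
            rw [← hg, div_le_iff₀ (by positivity)]
            rw [div_le_iff₀ hg0] at hh₁
            nlinarith) (by rw [← hg]; linarith)
        rw [add_mul, one_mul]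
        exact h2
    have hk0 : 0 ≤ (κ - 3 * (ε / 4)) / g := div_nonneg (by linarith) hg0.le
    refine (key (⌊(κ - 3 * (ε / 4)) / g⌋₊ + 1) ?_).mono ?_
    · have := Nat.floor_le hk0
      rw [le_div_iff₀ hg0] at this
      push_cast
      linarith
    · have := (Nat.lt_floor_add_one ((κ - 3 * (ε / 4)) / g)).le
      rw [div_le_iff₀ hg0] at this
      push_cast
      linarith

end MeanValue

section Torus

/-- The additive character `r ↦ exp (2 π i r)`. -/
def ee (r : ℝ) : ℂ := Complex.exp (2 * π * Complex.I * r)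

theorem ee_add (r s : ℝ) : ee (r + s) = ee r * ee s := by
  rw [ee, ee, ee, ← Complex.exp_add]; push_cast; ring_nf

theorem ee_zero : ee 0 = 1 := by simp [ee]

theorem norm_ee (r : ℝ) : ‖ee r‖ = 1 := by
  rw [ee, show (2 * π * Complex.I * r : ℂ) = ((2 * π * r : ℝ) : ℂ) * Complex.I by push_cast; ring]
  exact Complex.norm_exp_ofReal_mul_I _

theorem ee_sum {ι : Type*} (s : Finset ι) (f : ι → ℝ) : ee (∑ i ∈ s, f i) = ∏ i ∈ s, ee (f i) := by
  classical
  induction s using Finset.induction_on with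
  | empty => simp [ee_zero]
  | insert a s ha ih => rw [Finset.sum_insert ha, Finset.prod_insert ha, ee_add, ih]

theorem conj_ee (r : ℝ) : (starRingEnd ℂ) (ee r) = ee (-r) := by
  rw [ee, ee, ← Complex.exp_conj]
  congr 1
  simp [Complex.conj_ofNat]

@[fun_prop]
theorem continuous_ee : Continuous ee := by
  unfold ee; fun_prop

/-- The characters of the torus. -/
def tch {d : Type*} [Fintype d] (ξ : d → ℤ) : C(d → UnitAddCircle, ℂ) where
  toFun x := ∏ i, fourier (ξ i) (x i)
  continuous_toFun := by fun_prop

def torM (d : Type*) [Fintype d] : Measure (d → UnitAddCircle) :=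
  Measure.pi fun _ => AddCircle.haarAddCircle

instance (d : Type*) [Fintype d] : IsProbabilityMeasure (torM d) := by
  unfold torM; infer_instance

theorem integral_fourier_eq_zero {a : ℤ} (ha : a ≠ 0) :
    ∫ x : UnitAddCircle, fourier a x ∂AddCircle.haarAddCircle = 0 := by
  have h := fourierCoeff_fourier (T := 1) a
  have h2 := congrFun h 0
  rw [fourierCoeff, Pi.single_eq_of_ne (Ne.symm ha)] at h2
  simpa using h2

theorem tchars (d : Type*) [Fintype d] : Chars (torM d) (tch : (d → ℤ) → _) where
  add a b := by
    ext x
    simp [tch, Finset.prod_mul_distrib]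
  norm_one a x := by simp [tch, norm_prod, Circle.norm_coe]
  integral_zero a ha := by
    obtain ⟨i, hi⟩ := Function.ne_iff.1 ha
    show ∫ x : d → UnitAddCircle, ∏ i, fourier (a i) (x i) ∂_ = 0
    rw [torM, integral_fintype_prod_eq_prod (fun i (x : UnitAddCircle) => (fourier (a i) x : ℂ))]
    exact Finset.prod_eq_zero (Finset.mem_univ i) (integral_fourier_eq_zero hi)

/-- The point of the torus with given real coordinates. -/
def tpt {d : Type*} (y : d → ℝ) : d → UnitAddCircle := fun i => (y i : UnitAddCircle)

theorem tch_tpt {d : Type*} [Fintype d] (ξ : d → ℤ) (y : d → ℝ) :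
    tch ξ (tpt y) = ee (∑ i, ξ i * y i) := by
  rw [ee_sum]
  show ∏ i, fourier (ξ i) ((y i : ℝ) : UnitAddCircle) = _
  refine Finset.prod_congr rfl fun i _ => ?_
  rw [fourier_coe_apply, ee]
  push_cast
  ring_nf

theorem tpt_surjective {d : Type*} : Function.Surjective (tpt : (d → ℝ) → _) := by
  intro x
  choose y hy using fun i => QuotientAddGroup.mk_surjective (x i)
  exact ⟨y, funext hy⟩

end Torus

section Kernel

/-- Sums of characters over intervals of frequencies. -/
theorem norm_sum_ee_le {S : Finset ℤ} (hS : (S : Set ℤ).OrdConnected) (y : ℝ) :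
    ‖∑ a ∈ S, ee (a * y)‖ * ‖1 - ee y‖ ≤ 2 := by
  rcases S.eq_empty_or_nonempty with rfl | hne
  · simp
  have h1 : S = Finset.Icc (S.min' hne) (S.max' hne) := by
    ext a
    rw [Finset.mem_Icc]
    exact ⟨fun h => ⟨S.min'_le a h, S.le_max' a h⟩, fun h =>
      hS.out (S.min'_mem hne) (S.max'_mem hne) h⟩
  have key : ∀ (p : ℤ) (N : ℕ), (∑ a ∈ Finset.Ico p (p + N), ee (a * y)) * (1 - ee y) =
      ee (p * y) - ee ((p + N : ℝ) * y) := by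
    intro p N
    induction N with
    | zero => simp
    | succ N ih =>
      have e1 : Finset.Ico p (p + (N + 1 : ℕ)) = insert (p + N : ℤ) (Finset.Ico p (p + N)) := by
        ext a; simp only [Finset.mem_Ico, Finset.mem_insert]; push_cast; omega
      rw [e1, Finset.sum_insert (by simp), add_mul, ih, mul_sub, ← ee_add]
      push_cast
      ring_nf
  have hle := S.min'_le _ (S.max'_mem hne)
  obtain ⟨N, hN⟩ := Int.le.dest (by linarith : S.min' hne ≤ S.max' hne + 1)
  have h2 : S = Finset.Ico (S.min' hne) (S.min' hne + N) := by
    rw [hN]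
    conv_lhs => rw [h1]
    ext a; simp only [Finset.mem_Icc, Finset.mem_Ico]; omega
  rw [← norm_mul, h2, key]
  refine (norm_sub_le _ _).trans ?_
  rw [norm_ee, norm_ee]; norm_num

end Kernel

section Fejer

theorem four_mul_le_norm_one_sub_ee {y : ℝ} (hy : |y| ≤ 1 / 2) : 4 * |y| ≤ ‖1 - ee y‖ := by
  have h1 : ‖1 - ee y‖ = 2 * |sin (π * y)| := by
    have : 1 - ee y = -(Complex.exp (Complex.I * ((2 * π * y : ℝ) : ℂ)) - 1) := by
      rw [ee]; push_cast; ring_nf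
    rw [this, norm_neg, Complex.norm_exp_I_mul_ofReal_sub_one, norm_mul, norm_eq_abs, norm_eq_abs,
      abs_of_pos (by norm_num : (0 : ℝ) < 2)]
    congr 3; ring
  rw [h1]
  have key : ∀ z : ℝ, 0 ≤ z → z ≤ 1 / 2 → 2 * z ≤ sin (π * z) := by
    intro z h0 h2
    have := mul_le_sin (x := π * z) (by positivity) (by nlinarith [pi_pos])
    calc 2 * z = 2 / π * (π * z) := by field_simp
      _ ≤ _ := this
  have h3 : |sin (π * y)| = |sin (π * |y|)| := by
    rcases abs_choice y with h | h <;> rw [h]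
    rw [mul_neg, sin_neg, abs_neg]
  have := (key |y| (abs_nonneg _) hy).trans (le_abs_self _)
  rw [h3]
  linarith

/-- Fourier coefficients of the normalized Fejér kernel. -/
def wt (N : ℕ) (a : ℤ) : ℝ :=
  ((Finset.range N).filter fun p : ℕ => 0 ≤ (p : ℤ) - a ∧ (p : ℤ) - a < N).card / (N : ℝ) ^ 2

/-- The part of the Fejér kernel with frequencies in `I`. -/
def kf (N : ℕ) (I : Finset ℤ) (y : ℝ) : ℂ := ∑ a ∈ I, wt N a * ee (a * y)

theorem kf_eq (N : ℕ) (I : Finset ℤ) (y : ℝ) : kf N I y =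
    (1 / (N : ℝ) ^ 2 : ℝ) * ∑ p ∈ Finset.range N,
      ∑ a ∈ I.filter fun a => 0 ≤ (p : ℤ) - a ∧ (p : ℤ) - a < N, ee (a * y) := by
  simp_rw [Finset.sum_filter]
  rw [Finset.sum_comm, kf, Finset.mul_sum]
  refine Finset.sum_congr rfl fun a _ => ?_
  rw [← Finset.sum_filter, Finset.sum_const, wt, nsmul_eq_mul]
  push_cast
  ring

theorem norm_kf_le_one {N : ℕ} (hN : 0 < N) (I : Finset ℤ) (y : ℝ) : ‖kf N I y‖ ≤ 1 := by
  have hN' : (0 : ℝ) < N := by exact_mod_cast hN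
  rw [kf_eq, norm_mul, Complex.norm_real, norm_eq_abs, abs_of_nonneg (by positivity)]
  calc 1 / (N : ℝ) ^ 2 * ‖∑ p ∈ Finset.range N,
      ∑ a ∈ I.filter fun a => 0 ≤ (p : ℤ) - a ∧ (p : ℤ) - a < N, ee (a * y)‖
      ≤ 1 / (N : ℝ) ^ 2 * ∑ p ∈ Finset.range N, (N : ℝ) := by
        gcongr
        refine norm_sum_le_of_le _ fun p _ => ?_
        refine (norm_sum_le_of_le (f := fun a : ℤ => ee (a * y)) (n := fun _ => 1) _
          fun a _ => (norm_ee _).le).trans ?_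
        rw [Finset.sum_const, nsmul_eq_mul, mul_one]
        have : (I.filter fun a => 0 ≤ (p : ℤ) - a ∧ (p : ℤ) - a < N) ⊆
            Finset.Ioc ((p : ℤ) - N) p := by
          intro a ha
          have := (Finset.mem_filter.1 ha).2
          rw [Finset.mem_Ioc]; omega
        have h2 := Finset.card_le_card this
        rw [Int.card_Ioc] at h2
        have h3 : ((p : ℤ) - (p - N)).toNat = N := by simp
        rw [h3] at h2
        exact_mod_cast h2
    _ = 1 := by rw [Finset.sum_const, nsmul_eq_mul, Finset.card_range]; field_simp

theorem norm_kf_mul_le {N : ℕ} (hN : 0 < N) {I : Finset ℤ} (hI : (I : Set ℤ).OrdConnected) (y : ℝ) :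
    ‖kf N I y‖ * ‖1 - ee y‖ ≤ 2 / N := by
  have hN' : (0 : ℝ) < N := by exact_mod_cast hN
  rw [kf_eq, norm_mul, Complex.norm_real, norm_eq_abs, abs_of_nonneg (by positivity)]
  calc 1 / (N : ℝ) ^ 2 * ‖∑ p ∈ Finset.range N,
      ∑ a ∈ I.filter fun a => 0 ≤ (p : ℤ) - a ∧ (p : ℤ) - a < N, ee (a * y)‖ * ‖1 - ee y‖
      ≤ 1 / (N : ℝ) ^ 2 * (∑ p ∈ Finset.range N,
      ‖∑ a ∈ I.filter fun a => 0 ≤ (p : ℤ) - a ∧ (p : ℤ) - a < N, ee (a * y)‖) * ‖1 - ee y‖ := by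
        gcongr
        exact norm_sum_le _ _
    _ = 1 / (N : ℝ) ^ 2 * ∑ p ∈ Finset.range N,
      ‖∑ a ∈ I.filter fun a => 0 ≤ (p : ℤ) - a ∧ (p : ℤ) - a < N, ee (a * y)‖ * ‖1 - ee y‖ := by
        rw [mul_assoc, Finset.sum_mul]
    _ ≤ 1 / (N : ℝ) ^ 2 * ∑ p ∈ Finset.range N, 2 := by
        gcongr with p
        refine norm_sum_ee_le ⟨fun a ha b hb c hc => ?_⟩ y
        simp only [Finset.coe_filter, Set.mem_ofPred_eq] at ha hb ⊢
        exact ⟨hI.out ha.1 hb.1 hc, by have := hc.1; have := hc.2; omega⟩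
    _ = 2 / N := by rw [Finset.sum_const, nsmul_eq_mul, Finset.card_range]; field_simp

/-- The frequency range of the Fejér kernel. -/
def fr (N : ℕ) : Finset ℤ := Finset.Ioo (-N) N

theorem kf_fr {N : ℕ} (y : ℝ) :
    kf N (fr N) y = ((‖∑ p ∈ Finset.range N, ee (p * y)‖ / N) ^ 2 : ℝ) := by
  have h1 : ∀ p ∈ Finset.range N, ∑ a ∈ (fr N).filter (fun a => 0 ≤ (p : ℤ) - a ∧ (p : ℤ) - a < N),
      ee (a * y) = ee (p * y) * (starRingEnd ℂ) (∑ q ∈ Finset.range N, ee (q * y)) := by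
    intro p hp
    rw [Finset.mem_range] at hp
    rw [map_sum, Finset.mul_sum]
    refine Finset.sum_bij' (fun a _ => ((p : ℤ) - a).toNat) (fun q _ => (p : ℤ) - q) ?_ ?_ ?_ ?_ ?_
    · intro a ha
      have := (Finset.mem_filter.1 ha).2
      rw [Finset.mem_range]; omega
    · intro q hq
      rw [Finset.mem_range] at hq
      simp only [Finset.mem_filter, fr, Finset.mem_Ioo]
      omega
    · intro a ha
      have := (Finset.mem_filter.1 ha).2
      omega
    · intro q hq
      omega
    · intro a ha
      have := (Finset.mem_filter.1 ha).2
      have e1 : ((((p : ℤ) - a).toNat : ℕ) : ℝ) = p - a := by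
        have : ((((p : ℤ) - a).toNat : ℕ) : ℤ) = p - a := by omega
        exact_mod_cast this
      rw [conj_ee, ← ee_add, e1]
      congr 1; ring
  rw [kf_eq, Finset.sum_congr rfl h1, ← Finset.sum_mul, Complex.mul_conj, Complex.normSq_eq_norm_sq]
  push_cast
  ring

theorem kf_fr_lower {N : ℕ} (hN : 0 < N) {y : ℝ} (hy : |y| ≤ 1 / (16 * N)) :
    1 / 4 ≤ (‖∑ p ∈ Finset.range N, ee (p * y)‖ / N) ^ 2 := by
  have hN' : (0 : ℝ) < N := by exact_mod_cast hN
  have h1 : ‖∑ p ∈ Finset.range N, (ee (p * y) - 1)‖ ≤ N * (1 / 2) := by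
    refine (norm_sum_le_of_le (n := fun _ => 1 / 2) _ fun p hp => ?_).trans (by simp)
    have hp : (p : ℝ) ≤ N := by exact_mod_cast (Finset.mem_range.1 hp).le
    have e1 : ee (p * y) = Complex.exp (Complex.I * ((2 * π * (p * y) : ℝ) : ℂ)) := by
      rw [ee]; push_cast; ring_nf
    rw [e1]
    refine (norm_exp_I_mul_ofReal_sub_one_le).trans ?_
    rw [norm_eq_abs, abs_mul, abs_mul (p : ℝ), abs_of_pos (by positivity : 0 < 2 * π),
      abs_of_nonneg (by positivity : (0 : ℝ) ≤ p)]
    have h2 : (p : ℝ) * |y| ≤ 1 / 16 := by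
      calc (p : ℝ) * |y| ≤ N * (1 / (16 * N)) := by gcongr
        _ = 1 / 16 := by field_simp
    nlinarith [pi_lt_four, pi_pos]
  rw [Finset.sum_sub_distrib, Finset.sum_const, Finset.card_range, nsmul_eq_mul, mul_one] at h1
  have h3 : (N : ℝ) - ‖∑ p ∈ Finset.range N, ee (p * y)‖ ≤ N * (1 / 2) := by
    have := norm_sub_norm_le (N : ℂ) (∑ p ∈ Finset.range N, ee (p * y))
    rw [norm_sub_rev, Complex.norm_natCast] at this
    linarith
  have h4 : 1 / 2 ≤ ‖∑ p ∈ Finset.range N, ee (p * y)‖ / N := by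
    rw [le_div_iff₀ hN']; linarith
  nlinarith

end Fejer

section Grid

/-- The two-sided harmonic sum. -/
def lg (N : ℕ) : ℝ := ∑ m ∈ Finset.Icc (-N : ℤ) N, 1 / (1 + |(m : ℝ)|)

theorem lg_le (N : ℕ) : lg N ≤ 1 + 2 * log (N + 1) := by
  induction N with
  | zero => simp [lg]
  | succ N ih =>
    have e1 : Finset.Icc (-(N + 1 : ℕ) : ℤ) (N + 1 : ℕ) =
        insert (-(N + 1 : ℕ) : ℤ) (insert ((N + 1 : ℕ) : ℤ) (Finset.Icc (-N : ℤ) N)) := by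
      ext a; simp only [Finset.mem_Icc, Finset.mem_insert]; push_cast; omega
    have hN : (0 : ℝ) ≤ N := Nat.cast_nonneg N
    have h2 : lg (N + 1) = 2 * (1 / (N + 2)) + lg N := by
      rw [lg, e1, Finset.sum_insert, Finset.sum_insert, lg]
      · push_cast
        rw [abs_neg, abs_of_nonneg (by linarith : (0 : ℝ) ≤ N + 1)]
        ring
      · simp
      · simp only [Finset.mem_insert, Finset.mem_Icc]; omega
    have h3 : 1 / (N + 2 : ℝ) ≤ log (N + 2) - log (N + 1) := by
      rw [← log_div (by positivity) (by positivity)]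
      have := one_sub_inv_le_log_of_pos (x := (N + 2 : ℝ) / (N + 1)) (by positivity)
      refine le_trans (le_of_eq ?_) this
      rw [inv_div]; field_simp; ring
    rw [h2]
    push_cast
    rw [show (N : ℝ) + 1 + 1 = N + 2 by ring]
    linarith

theorem lg_nonneg (N : ℕ) : 0 ≤ lg N := Finset.sum_nonneg fun _ _ => by positivity

theorem lg_mono {N N' : ℕ} (h : N ≤ N') : lg N ≤ lg N' :=
  Finset.sum_le_sum_of_subset_of_nonneg (Finset.Icc_subset_Icc (by omega) (by omega))
    fun _ _ _ => by positivity

theorem ee_int (m : ℤ) : ee m = 1 := by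
  rw [ee, show (2 * π * Complex.I * ((m : ℝ) : ℂ) : ℂ) = m * (2 * π * Complex.I) by push_cast; ring]
  exact Complex.exp_int_mul_two_pi_mul_I m

theorem kf_add_int (N : ℕ) (I : Finset ℤ) (y : ℝ) (m : ℤ) : kf N I (y + m) = kf N I y := by
  refine Finset.sum_congr rfl fun a _ => ?_
  rw [mul_add, ee_add, show (a : ℝ) * m = ((a * m : ℤ) : ℝ) by push_cast; ring, ee_int, mul_one]

theorem le_div_one_add_abs {z m A u R : ℝ} (hA : 0 ≤ A) (hR : 0 < R) (hz : z ≤ A)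
    (hzu : z * |u| ≤ A / R) (hm : |m| - 1 ≤ R * |u|) (hm1 : |m| ≤ 1 ∨ 2 ≤ |m|) :
    z ≤ 3 * A / (1 + |m|) := by
  have h0 : 0 < 1 + |m| := by positivity
  rw [le_div_iff₀ h0]
  rcases hm1 with h | h
  · rcases le_total 0 z with hz0 | hz0 <;> nlinarith
  · rw [le_div_iff₀ hR] at hzu
    rcases le_total 0 z with hz0 | hz0 <;> nlinarith

theorem int_abs_cases (m : ℤ) : |(m : ℝ)| ≤ 1 ∨ 2 ≤ |(m : ℝ)| := by
  rcases le_or_gt |m| 1 with h | h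
  · left; exact_mod_cast h
  · right; exact_mod_cast h

theorem norm_kf_le_grid {N : ℕ} (hN : 0 < N) {I : Finset ℤ} (hI : (I : Set ℤ).OrdConnected)
    {u : ℝ} (hu : |u| ≤ 1 / 2) {m : ℤ} (hm : |(m : ℝ)| - 1 ≤ 16 * N * |u|) :
    ‖kf N I u‖ ≤ 24 / (1 + |(m : ℝ)|) := by
  have hN' : (0 : ℝ) < N := by exact_mod_cast hN
  have h1 := norm_kf_le_one hN I u
  have h2 := norm_kf_mul_le hN hI u
  have h3 := four_mul_le_norm_one_sub_ee hu
  have h4 : ‖kf N I u‖ * (4 * |u|) ≤ 2 / N := (by gcongr : _ ≤ _).trans h2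
  refine (le_div_one_add_abs (A := 8) (by norm_num) (by positivity : (0 : ℝ) < 16 * N)
    (by linarith) ?_ hm (int_abs_cases m)).trans (by norm_num)
  have : 2 / (N : ℝ) = 4 * (8 / (16 * N)) := by field_simp; norm_num
  rw [this] at h4
  linarith

theorem sum_norm_kf_le {N : ℕ} (hN : 0 < N) {I : Finset ℤ} (hI : (I : Set ℤ).OrdConnected)
    (y : ℝ) (p : ℤ) :
    ∑ c ∈ Finset.Ico p (p + 16 * N), ‖kf N I (y - c / (16 * N))‖ ≤ 24 * lg (16 * N) := by
  have hN' : (0 : ℝ) < N := by exact_mod_cast hN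
  set L : ℝ := 16 * N with hL
  have hL0 : 0 < L := by positivity
  set sh : ℤ → ℤ := fun c => round (y - c / L) with hsh
  set q : ℤ → ℤ := fun c => c + 16 * N * sh c with hq
  set m₀ : ℤ := ⌊L * y⌋ with hm₀
  have hqL : ∀ c, y - q c / L = y - c / L - sh c := by
    intro c
    rw [hq]
    push_cast
    rw [← hL]
    field_simp
    ring
  have hu : ∀ c, |y - q c / L| ≤ 1 / 2 := fun c => by rw [hqL]; exact abs_sub_round _
  have hLu : ∀ c, |L * y - q c| ≤ L / 2 := by
    intro c
    have : L * y - q c = L * (y - q c / L) := by field_simp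
    rw [this, abs_mul, abs_of_pos hL0]
    nlinarith [hu c]
  have hfl := Int.floor_le (L * y)
  have hfl' := Int.lt_floor_add_one (L * y)
  have hinj : Set.InjOn (fun c => q c - m₀) (Finset.Ico p (p + 16 * N) : Finset ℤ) := by
    intro c hc c' hc' h
    simp only [Finset.coe_Ico, Set.mem_Ico] at hc hc'
    have h1 : c - c' = 16 * N * (sh c' - sh c) := by
      simp only [hq] at h; linarith
    have h2 : |c - c'| < 16 * N := by rw [abs_lt]; omega
    have h3 := Int.eq_zero_of_abs_lt_dvd ⟨_, h1⟩ h2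
    omega
  calc ∑ c ∈ Finset.Ico p (p + 16 * N), ‖kf N I (y - c / L)‖
      ≤ ∑ c ∈ Finset.Ico p (p + 16 * N), 24 * (1 / (1 + |((q c - m₀ : ℤ) : ℝ)|)) := by
        refine Finset.sum_le_sum fun c _ => ?_
        have e1 : kf N I (y - c / L) = kf N I (y - q c / L) := by
          rw [hqL, sub_eq_add_neg _ (sh c : ℝ), ← Int.cast_neg, kf_add_int]
        rw [e1, mul_one_div]
        refine norm_kf_le_grid hN hI (hu c) ?_
        have e2 : 16 * N * |y - q c / L| = |L * y - q c| := by
          rw [← hL, ← abs_of_pos hL0, ← abs_mul, abs_of_pos hL0]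
          congr 1; field_simp
        rw [e2]
        push_cast
        have : |(q c : ℝ) - m₀| ≤ |L * y - q c| + |L * y - m₀| := by
          rw [abs_sub_comm (L * y)]
          have := abs_sub_le (q c : ℝ) (L * y) m₀
          linarith
        have h5 : |L * y - m₀| ≤ 1 := by rw [abs_le]; constructor <;> linarith
        linarith
    _ = 24 * ∑ m ∈ (Finset.Ico p (p + 16 * N)).image (fun c => q c - m₀),
          1 / (1 + |(m : ℝ)|) := by
        rw [Finset.sum_image hinj, Finset.mul_sum]
    _ ≤ _ := by
        refine mul_le_mul_of_nonneg_left ?_ (by norm_num)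
        refine Finset.sum_le_sum_of_subset_of_nonneg (fun m hm => ?_) fun _ _ _ => by positivity
        obtain ⟨c, -, rfl⟩ := Finset.mem_image.1 hm
        have h6 := abs_le.1 (hLu c)
        have hL1 : 16 ≤ L := by
          have : (1 : ℝ) ≤ N := by exact_mod_cast hN
          rw [hL]; linarith
        rw [Finset.mem_Icc]
        constructor
        · have : (-(16 * N : ℕ) : ℝ) ≤ q c - m₀ := by push_cast; rw [← hL]; linarith
          exact_mod_cast this
        · have : (q c - m₀ : ℝ) ≤ (16 * N : ℕ) := by push_cast; rw [← hL]; linarith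
          exact_mod_cast this

/-- The Dirichlet kernel. -/
def dk (H : ℕ) (u : ℝ) : ℂ := ∑ a ∈ Finset.Icc (-H : ℤ) H, ee (a * u)

theorem norm_dk_le_grid {H : ℕ} (hH : 0 < H) {u : ℝ} (hu : |u| ≤ 1 / 2) {m : ℤ}
    (hm : |(m : ℝ)| - 1 ≤ H * |u|) : ‖dk H u‖ ≤ 9 * H / (1 + |(m : ℝ)|) := by
  have hH' : (1 : ℝ) ≤ H := by exact_mod_cast hH
  have h1 : ‖dk H u‖ ≤ 3 * H := by
    refine (norm_sum_le_of_le (n := fun _ => 1) _ fun a _ => (norm_ee _).le).trans ?_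
    rw [Finset.sum_const, Int.card_Icc, nsmul_eq_mul, mul_one,
      show ((H : ℤ) + 1 - -H).toNat = 2 * H + 1 by omega]
    push_cast
    linarith
  have h2 : ‖dk H u‖ * ‖1 - ee u‖ ≤ 2 :=
    norm_sum_ee_le (by rw [Finset.coe_Icc]; exact Set.ordConnected_Icc) u
  have h3 := four_mul_le_norm_one_sub_ee hu
  have h4 : ‖dk H u‖ * (4 * |u|) ≤ 2 := (by gcongr : _ ≤ _).trans h2
  refine (le_div_one_add_abs (A := 3 * H) (by positivity) (by linarith : (0 : ℝ) < H) h1 ?_ hm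
    (int_abs_cases m)).trans (le_of_eq (by ring))
  have : 3 * (H : ℝ) / H = 3 := by field_simp
  rw [this]
  linarith

end Grid

section LargeSieve

variable {X G : Type*} [TopologicalSpace X] [CompactSpace X] [MeasurableSpace X] [BorelSpace X]
  [AddCommGroup G] {μ : Measure X} [IsProbabilityMeasure μ] {e : G → C(X, ℂ)}

/-- The reproducing kernel of `Spec e Ω`. -/
def rk (e : G → C(X, ℂ)) (Ω : Finset G) (y x : X) : ℂ :=
  ∑ ξ ∈ Ω, e ξ y * (starRingEnd ℂ) (e ξ x)

theorem conj_rk (Ω : Finset G) (y x : X) : (starRingEnd ℂ) (rk e Ω y x) = rk e Ω x y := by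
  simp only [rk, map_sum, map_mul, Complex.conj_conj]
  exact Finset.sum_congr rfl fun _ _ => mul_comm _ _

theorem integral_char_mul_conj (he : Chars μ e) [DecidableEq G] (ξ η : G) :
    ∫ x, e ξ x * (starRingEnd ℂ) (e η x) ∂μ = if ξ = η then 1 else 0 := by
  have h1 : ∀ x, e ξ x * (starRingEnd ℂ) (e η x) = e (ξ - η) x := by
    intro x
    have h2 := congrArg (fun f : C(X, ℂ) => f x) (he.add (ξ - η) η)
    simp only [sub_add_cancel, ContinuousMap.mul_apply] at h2
    rw [h2, mul_assoc, Complex.mul_conj, Complex.normSq_eq_norm_sq, he.norm_one]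
    simp
  simp_rw [h1]
  split_ifs with h
  · rw [h, sub_self, he.zero]; simp
  · exact he.integral_zero _ (sub_ne_zero.2 h)

theorem reproducing (he : Chars μ e) {Ω : Finset G} {f : C(X, ℂ)} (hf : f ∈ Spec e (Ω : Set G))
    (x : X) : ∫ y, f y * rk e Ω x y ∂μ = f x := by
  classical
  induction hf using Submodule.span_induction with
  | mem f hf =>
    obtain ⟨η, hη, rfl⟩ := hf
    have h1 : ∀ y, e η y * rk e Ω x y = ∑ ξ ∈ Ω, e ξ x * (e η y * (starRingEnd ℂ) (e ξ y)) := by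
      intro y
      rw [rk, Finset.mul_sum]
      exact Finset.sum_congr rfl fun _ _ => by ring
    simp_rw [h1]
    rw [integral_finsetSum _ fun i _ => cint (by fun_prop)]
    simp_rw [integral_const_mul, integral_char_mul_conj he]
    simp [Finset.mem_coe.1 hη]
  | zero => simp
  | add f g _ _ hf hg =>
    simp only [ContinuousMap.add_apply, add_mul]
    rw [integral_add (cint (by unfold rk; fun_prop)) (cint (by unfold rk; fun_prop)), hf, hg]
  | smul c f _ hf =>
    simp only [ContinuousMap.smul_apply, smul_eq_mul, mul_assoc]
    rw [integral_const_mul, hf]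

/-- The large sieve inequality. -/
theorem large_sieve (he : Chars μ e) {Ω : Finset G} {f : C(X, ℂ)} (hf : f ∈ Spec e (Ω : Set G))
    {ι : Type*} (s : Finset ι) (p : ι → X) {Δ : ℝ} (hΔ : 0 < Δ)
    (h : ∀ w ∈ s, ∑ w' ∈ s, ‖rk e Ω (p w) (p w')‖ ≤ Δ) :
    ∑ w ∈ s, ‖f (p w)‖ ^ 2 ≤ Δ * ∫ y, ‖f y‖ ^ 2 ∂μ := by
  set A := ∑ w ∈ s, ‖f (p w)‖ ^ 2 with hA
  set g : C(X, ℂ) := ∑ w ∈ s, ∑ ξ ∈ Ω, (f (p w) * (starRingEnd ℂ) (e ξ (p w))) • e ξ with hg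
  have hgs : g ∈ Spec e (Ω : Set G) := Submodule.sum_mem _ fun w _ => Submodule.sum_mem _
    fun ξ hξ => Submodule.smul_mem _ _ (Spec.mem_of (by exact_mod_cast hξ))
  have hgy : ∀ y, g y = ∑ w ∈ s, f (p w) * rk e Ω y (p w) := by
    intro y
    rw [hg]
    simp only [ContinuousMap.sum_apply, ContinuousMap.smul_apply, smul_eq_mul, rk, Finset.mul_sum]
    exact Finset.sum_congr rfl fun _ _ => Finset.sum_congr rfl fun _ _ => by ring
  have hpair : ∀ F : C(X, ℂ), F ∈ Spec e (Ω : Set G) →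
      ∫ y, F y * (starRingEnd ℂ) (g y) ∂μ = ∑ w ∈ s, (starRingEnd ℂ) (f (p w)) * F (p w) := by
    intro F hF
    have h1 : ∀ y, F y * (starRingEnd ℂ) (g y) =
        ∑ w ∈ s, (starRingEnd ℂ) (f (p w)) * (F y * rk e Ω (p w) y) := by
      intro y
      rw [hgy, map_sum, Finset.mul_sum]
      refine Finset.sum_congr rfl fun w _ => ?_
      rw [map_mul, conj_rk]; ring
    simp_rw [h1]
    rw [integral_finsetSum _ fun i _ => cint (by unfold rk; fun_prop)]
    refine Finset.sum_congr rfl fun w _ => ?_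
    rw [integral_const_mul, reproducing he hF]
  have hsq : ∀ z : ℂ, (starRingEnd ℂ) z * z = ((‖z‖ ^ 2 : ℝ) : ℂ) := by
    intro z
    rw [mul_comm, Complex.mul_conj, Complex.normSq_eq_norm_sq]
  have h1 : (A : ℂ) = ∫ y, f y * (starRingEnd ℂ) (g y) ∂μ := by
    rw [hpair f hf, hA]
    push_cast
    exact Finset.sum_congr rfl fun w _ => by rw [hsq]; push_cast; rfl
  have h2 : A ≤ ∫ y, (Δ / 2 * ‖f y‖ ^ 2 + 1 / (2 * Δ) * ‖g y‖ ^ 2) ∂μ := by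
    calc A ≤ ‖(A : ℂ)‖ := by rw [Complex.norm_real]; exact le_abs_self _
      _ ≤ ∫ y, ‖f y * (starRingEnd ℂ) (g y)‖ ∂μ := by
          rw [h1]; exact norm_integral_le_integral_norm _
      _ ≤ _ := by
          refine integral_mono (cint (by fun_prop)) (cint (by fun_prop)) fun y => ?_
          simp only
          rw [norm_mul, RCLike.norm_conj]
          have : Δ / 2 * ‖f y‖ ^ 2 + 1 / (2 * Δ) * ‖g y‖ ^ 2 - ‖f y‖ * ‖g y‖ =
              1 / (2 * Δ) * (Δ * ‖f y‖ - ‖g y‖) ^ 2 := by field_simp; ring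
          have h3 : 0 ≤ 1 / (2 * Δ) * (Δ * ‖f y‖ - ‖g y‖) ^ 2 := by positivity
          linarith
  have h3 : ∫ y, ‖g y‖ ^ 2 ∂μ ≤ Δ * A := by
    have e1 : ((∫ y, ‖g y‖ ^ 2 ∂μ : ℝ) : ℂ) =
        ∑ w ∈ s, (starRingEnd ℂ) (f (p w)) * g (p w) := by
      rw [← hpair g hgs, ← integral_complex_ofReal]
      congr 1; ext y
      rw [mul_comm, hsq]
    calc ∫ y, ‖g y‖ ^ 2 ∂μ ≤ ‖((∫ y, ‖g y‖ ^ 2 ∂μ : ℝ) : ℂ)‖ := by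
          rw [Complex.norm_real]; exact le_abs_self _
      _ ≤ ∑ w ∈ s, ∑ w' ∈ s, (‖f (p w)‖ ^ 2 / 2 * ‖rk e Ω (p w) (p w')‖ +
            ‖f (p w')‖ ^ 2 / 2 * ‖rk e Ω (p w') (p w)‖) := by
          rw [e1]
          refine norm_sum_le_of_le _ fun w _ => ?_
          rw [hgy, Finset.mul_sum]
          refine norm_sum_le_of_le _ fun w' _ => ?_
          rw [norm_mul, norm_mul, RCLike.norm_conj, ← conj_rk, RCLike.norm_conj]
          rw [← add_mul, ← mul_assoc]
          gcongr
          · nlinarith [sq_nonneg (‖f (p w)‖ - ‖f (p w')‖)]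
      _ = ∑ w ∈ s, ‖f (p w)‖ ^ 2 * ∑ w' ∈ s, ‖rk e Ω (p w) (p w')‖ := by
          simp_rw [Finset.sum_add_distrib]
          rw [Finset.sum_comm (f := fun w w' => ‖f (p w')‖ ^ 2 / 2 * ‖rk e Ω (p w') (p w)‖)]
          rw [← Finset.sum_add_distrib]
          refine Finset.sum_congr rfl fun w _ => ?_
          rw [← Finset.mul_sum]
          ring
      _ ≤ ∑ w ∈ s, ‖f (p w)‖ ^ 2 * Δ := by
          gcongr with w hw
          exact h w hw
      _ = Δ * A := by rw [← Finset.sum_mul, mul_comm]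
  rw [integral_add (cint (by fun_prop)) (cint (by fun_prop)), integral_const_mul,
    integral_const_mul] at h2
  have h4 : 1 / (2 * Δ) * ∫ y, ‖g y‖ ^ 2 ∂μ ≤ 1 / (2 * Δ) * (Δ * A) := by gcongr
  have h5 : 1 / (2 * Δ) * (Δ * A) = A / 2 := by field_simp
  linarith

/-- A box of frequencies. -/
def fbox {d : Type*} [Fintype d] [DecidableEq d] (H : d → ℕ) : Finset (d → ℤ) :=
  Fintype.piFinset fun i => Finset.Icc (-H i : ℤ) (H i)

theorem rk_fbox {d : Type*} [Fintype d] [DecidableEq d] (H : d → ℕ) (y y' : d → ℝ) :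
    rk tch (fbox H) (tpt y) (tpt y') = ∏ i, dk (H i) (y i - y' i) := by
  rw [rk, fbox]
  simp_rw [dk]
  rw [Finset.prod_univ_sum]
  refine Finset.sum_congr rfl fun ξ _ => ?_
  rw [tch_tpt, tch_tpt, conj_ee, ← ee_add, ← ee_sum, ← Finset.sum_neg_distrib,
    ← Finset.sum_add_distrib]
  congr 1
  exact Finset.sum_congr rfl fun _ _ => by ring

theorem sum_rk_le {d ι : Type*} [Fintype d] [DecidableEq d] {H : d → ℕ} (hH : ∀ i, 0 < H i)
    (F : Finset ι) (y : ι → d → ℝ) (hy : ∀ w ∈ F, ∀ i, |y w i| ≤ 1 / 4) {Mx : ℝ}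
    (hMx : ∀ w ∈ F, ((F.filter fun w' => ∀ i, |y w i - y w' i| * H i ≤ 1).card : ℝ) ≤ Mx)
    (hMx0 : 0 ≤ Mx)
    {w : ι} (hw : w ∈ F) :
    ∑ w' ∈ F, ‖rk tch (fbox H) (tpt (y w)) (tpt (y w'))‖ ≤ Mx * ∏ i, (9 * H i * lg (H i)) := by
  set c : ι → d → ℤ := fun w' i => ⌊H i * (y w i - y w' i)⌋ with hc
  have hu : ∀ w' ∈ F, ∀ i, |y w i - y w' i| ≤ 1 / 2 := fun w' hw' i => by
    have := abs_sub (y w i) (y w' i)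
    linarith [hy w hw i, hy w' hw' i]
  have hfl : ∀ w' i, (c w' i : ℝ) ≤ H i * (y w i - y w' i) := fun w' i => Int.floor_le _
  have hfl' : ∀ w' i, H i * (y w i - y w' i) < c w' i + 1 := fun w' i => Int.lt_floor_add_one _
  have hcm : ∀ w' ∈ F, c w' ∈ fbox H := by
    intro w' hw'
    rw [fbox, Fintype.mem_piFinset]
    intro i
    have h1 := abs_le.1 (hu w' hw' i)
    have hHi : (1 : ℝ) ≤ H i := by exact_mod_cast hH i
    have h2 := hfl w' i
    have h3 := hfl' w' i
    rw [Finset.mem_Icc]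
    constructor
    · have : (-(H i : ℤ) - 1 : ℤ) < c w' i := by
        have : (-(H i : ℝ) - 1) < c w' i := by nlinarith
        exact_mod_cast this
      omega
    · have : (c w' i : ℝ) ≤ H i := by nlinarith
      exact_mod_cast this
  calc ∑ w' ∈ F, ‖rk tch (fbox H) (tpt (y w)) (tpt (y w'))‖
      ≤ ∑ w' ∈ F, ∏ i, (9 * H i / (1 + |(c w' i : ℝ)|)) := by
        refine Finset.sum_le_sum fun w' hw' => ?_
        rw [rk_fbox, norm_prod]
        refine Finset.prod_le_prod (fun _ _ => norm_nonneg _) fun i _ => ?_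
        refine norm_dk_le_grid (hH i) (hu w' hw' i) ?_
        have hHi : (1 : ℝ) ≤ H i := by exact_mod_cast hH i
        rw [show (H i : ℝ) * |y w i - y w' i| = |H i * (y w i - y w' i)| by
          rw [abs_mul, Nat.abs_cast]]
        have h2 := hfl w' i
        have h3 := hfl' w' i
        have := abs_sub_abs_le_abs_sub (c w' i : ℝ) (H i * (y w i - y w' i))
        have : |(c w' i : ℝ) - H i * (y w i - y w' i)| ≤ 1 := by
          rw [abs_le]; constructor <;> linarith
        linarith
    _ = ∑ b ∈ fbox H, ∑ w' ∈ F.filter (fun w' => c w' = b), ∏ i, (9 * H i / (1 + |(b i : ℝ)|)) := by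
        rw [← Finset.sum_fiberwise_of_maps_to hcm]
        refine Finset.sum_congr rfl fun b _ => Finset.sum_congr rfl fun w' hw' => ?_
        rw [(Finset.mem_filter.1 hw').2]
    _ ≤ ∑ b ∈ fbox H, Mx * ∏ i, (9 * H i / (1 + |(b i : ℝ)|)) := by
        refine Finset.sum_le_sum fun b _ => ?_
        rw [Finset.sum_const, nsmul_eq_mul]
        refine mul_le_mul_of_nonneg_right ?_ (Finset.prod_nonneg fun _ _ => by positivity)
        rcases (F.filter (fun w' => c w' = b)).eq_empty_or_nonempty with h0 | ⟨w₁, hw₁⟩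
        · rw [h0]; simpa using hMx0
        obtain ⟨hw₁F, hw₁b⟩ := Finset.mem_filter.1 hw₁
        refine le_trans ?_ (hMx w₁ hw₁F)
        norm_cast
        refine Finset.card_le_card fun w' hw' => ?_
        obtain ⟨hw'F, hw'b⟩ := Finset.mem_filter.1 hw'
        refine Finset.mem_filter.2 ⟨hw'F, fun i => ?_⟩
        have h2 := hfl w' i
        have h3 := hfl' w' i
        have h4 := hfl w₁ i
        have h5 := hfl' w₁ i
        rw [hw'b] at h2 h3
        rw [hw₁b] at h4 h5
        rw [show |y w₁ i - y w' i| * (H i : ℝ) = |(y w₁ i - y w' i) * H i| by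
          rw [abs_mul, Nat.abs_cast], abs_le]
        constructor <;> nlinarith
    _ = Mx * ∏ i, (9 * H i * lg (H i)) := by
        rw [← Finset.mul_sum]
        congr 1
        simp_rw [lg, Finset.mul_sum]
        rw [Finset.prod_univ_sum, fbox]
        simp_rw [mul_one_div]

end LargeSieve

section MultiScale

open Polynomial

variable {X G : Type*} [TopologicalSpace X] [CompactSpace X] [MeasurableSpace X] [BorelSpace X]
  [AddCommGroup G] {μ : Measure X} [IsProbabilityMeasure μ] {e : G → C(X, ℂ)}

theorem dv_eq_zero {p : ℝ[X]} {n l : ℕ} (hp : p.natDegree ≤ n) (hl : n < l) (y : ℝ) :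
    dv l p y = 0 := by
  rw [dv, iterate_derivative_eq_zero (by omega), eval_zero]

theorem dv_taylor {n : ℕ} {p : ℝ[X]} {u y r V : ℝ} (hp : p.natDegree ≤ n) (hr : 0 < r)
    (hV : 0 ≤ V) (hy : |y - u| ≤ r) (h : ∀ i ≤ n, |dv i p u| * r ^ i ≤ V) (l : ℕ) :
    |dv l p y| * r ^ l ≤ 2 ^ (n + 1) * V := by
  rcases lt_or_ge n l with hl | hl
  · rw [dv_eq_zero hp hl, abs_zero, zero_mul]; positivity
  have h1 := abs_dv_le (m := n + 1) (p := p) (u := u) (y := y) (r := r) (A := V / r ^ (n + 1))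
    hr.le (by positivity) hy (fun j hj => by
      have := h j (by omega)
      rw [div_mul_eq_mul_div, le_div_iff₀ (by positivity)]
      calc |dv j p u| * r ^ (n + 1) = (|dv j p u| * r ^ j) * r ^ (n + 1 - j) := by
            rw [mul_assoc, ← pow_add]; congr 2; omega
        _ ≤ _ := by gcongr) (fun z _ => by
      rw [dv_eq_zero hp (by omega), abs_zero]; positivity) l (by omega)
  calc |dv l p y| * r ^ l ≤ 2 ^ (n + 1) * (V / r ^ (n + 1)) * r ^ (n + 1 - l) * r ^ l := by gcongr
    _ = 2 ^ (n + 1) * V := by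
      rw [mul_assoc _ (r ^ (n + 1 - l)), ← pow_add, show n + 1 - l + l = n + 1 by omega]
      field_simp

theorem sum_range_mul_eq {M : Type*} [AddCommMonoid M] (f : ℕ → M) (q N : ℕ) :
    ∑ j ∈ Finset.range (q * N), f j = ∑ i ∈ Finset.range q, ∑ j ∈ Finset.range N, f (i * N + j) := by
  induction q with
  | zero => simp
  | succ q ih => rw [Nat.succ_mul, Finset.sum_range_add, ih, Finset.sum_range_succ]

/-- Frequencies whose derivatives at `j` have the prescribed sizes and, where large, signs. -/
def Boxed (n : ℕ) (Φ : G →+ ℝ[X]) (A : ℝ) (K T : ℕ) (x σ : ℕ → ℝ) (j : ℝ) : Set G :=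
  {ξ | (Φ ξ).natDegree ≤ n ∧ ∀ m ≤ n, |dv m (Φ ξ) j| ≤ A * x m ∧
    (1 ≤ m → 1 ≤ x m * (K : ℝ) ^ (T * m) →
      |dv m (Φ ξ) j - σ m * (m.factorial * x m)| ≤ A * x m / K ^ n)}

/-- Largest of the sizes `x m * K ^ (t * m)`. -/
def domSize (n : ℕ) (x : ℕ → ℝ) (K t : ℕ) : ℝ :=
  (Finset.range (n + 1)).sup' ⟨0, by simp⟩ fun m => x m * (K : ℝ) ^ (t * m)

/-- Largest index at which `domSize` is attained. -/
def domIdx (n : ℕ) (x : ℕ → ℝ) (K t : ℕ) : ℕ :=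
  open Classical in Nat.findGreatest (fun m => x m * (K : ℝ) ^ (t * m) = domSize n x K t) n

theorem le_domSize {n : ℕ} (x : ℕ → ℝ) (K t : ℕ) {m : ℕ} (hm : m ≤ n) :
    x m * (K : ℝ) ^ (t * m) ≤ domSize n x K t :=
  Finset.le_sup' (fun m => x m * (K : ℝ) ^ (t * m)) (by simpa [Nat.lt_succ_iff] using hm)

theorem domIdx_le (n : ℕ) (x : ℕ → ℝ) (K t : ℕ) : domIdx n x K t ≤ n := Nat.findGreatest_le _

theorem domIdx_spec (n : ℕ) (x : ℕ → ℝ) (K t : ℕ) :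
    x (domIdx n x K t) * (K : ℝ) ^ (t * domIdx n x K t) = domSize n x K t := by
  classical
  obtain ⟨m, hm, h⟩ := Finset.exists_mem_eq_sup' (s := Finset.range (n + 1)) ⟨0, by simp⟩
    fun m => x m * (K : ℝ) ^ (t * m)
  exact Nat.findGreatest_spec (P := fun m => x m * (K : ℝ) ^ (t * m) = domSize n x K t)
    (by simpa [Nat.lt_succ_iff] using hm) h.symm

theorem le_domIdx {n : ℕ} {x : ℕ → ℝ} {K t m : ℕ} (hm : m ≤ n)
    (h : domSize n x K t ≤ x m * (K : ℝ) ^ (t * m)) : m ≤ domIdx n x K t := by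
  classical
  exact Nat.le_findGreatest hm (le_antisymm (le_domSize x K t hm) h)

theorem domSize_succ_le (n : ℕ) (x : ℕ → ℝ) (K t : ℕ) :
    domSize n x K (t + 1) ≤ domSize n x K t * K ^ domIdx n x K (t + 1) := by
  rw [← domIdx_spec n x K (t + 1), Nat.succ_mul, pow_add, ← mul_assoc]
  have := le_domSize x K t (domIdx_le n x K (t + 1))
  gcongr

theorem domIdx_mono {n : ℕ} {x : ℕ → ℝ} {K : ℕ} (hK : 1 ≤ K) (hx : ∀ m, 0 ≤ x m) :
    Monotone (domIdx n x K) := by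
  refine monotone_nat_of_le_succ fun t => ?_
  by_contra hlt
  push Not at hlt
  refine absurd (le_domIdx (t := t + 1) (domIdx_le n x K t) ?_) (not_le.2 hlt)
  refine (domSize_succ_le n x K t).trans ?_
  rw [← domIdx_spec n x K t, mul_assoc, ← pow_add, Nat.succ_mul]
  have hK' : (1 : ℝ) ≤ K := by exact_mod_cast hK
  exact mul_le_mul_of_nonneg_left (pow_le_pow_right₀ hK' (by omega)) (hx _)

theorem domSize_nonneg {n : ℕ} {x : ℕ → ℝ} (hx : ∀ m, 0 ≤ x m) (K t : ℕ) : 0 ≤ domSize n x K t := by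
  rw [← domIdx_spec]; exact mul_nonneg (hx _) (by positivity)

/-- Sum of `n + 1` consecutive dominant indices. -/
def domSum (n : ℕ) (x : ℕ → ℝ) (K t : ℕ) : ℕ := ∑ i ∈ Finset.range (n + 1), domIdx n x K (t + i)

theorem domSum_succ (n : ℕ) (x : ℕ → ℝ) (K t : ℕ) :
    domSum n x K (t + 1) + domIdx n x K t = domSum n x K t + domIdx n x K (t + (n + 1)) := by
  have h1 := Finset.sum_range_succ (fun i => domIdx n x K (t + i)) (n + 1)
  have h2 := Finset.sum_range_succ' (fun i => domIdx n x K (t + i)) (n + 1)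
  rw [h1] at h2
  simp only [domSum, add_zero] at h2 ⊢
  rw [h2]
  congr 1
  exact Finset.sum_congr rfl fun i _ => by congr 1; ring

theorem domSum_le (n : ℕ) (x : ℕ → ℝ) (K t : ℕ) : domSum n x K t ≤ (n + 1) * n := by
  refine (Finset.sum_le_sum fun i _ => domIdx_le n x K (t + i)).trans ?_
  simp

end MultiScale

section MultiScaleStep

open Polynomial

variable {X G : Type*} [TopologicalSpace X] [CompactSpace X] [MeasurableSpace X] [BorelSpace X]
  [AddCommGroup G] {μ : Measure X} [IsProbabilityMeasure μ] {e : G → C(X, ℂ)}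

/-- Sum over a block of `N` consecutive indices. -/
def blk (F : ℕ → C(X, ℂ)) (N a : ℕ) : C(X, ℂ) := ∑ j ∈ Finset.range N, F (a + j)

theorem blk_mul (F : ℕ → C(X, ℂ)) (q N a : ℕ) :
    blk F (q * N) a = ∑ i ∈ Finset.range q, blk F N (a + i * N) := by
  simp only [blk, sum_range_mul_eq, add_assoc]

/-- Moment of a block average. -/
def blkMom (μ : Measure X) (F : ℕ → C(X, ℂ)) (P N a : ℕ) : ℝ :=
  ∫ x, (1 / (N : ℝ) * ‖blk F N a x‖) ^ P ∂μ

theorem blkMom_nonneg (F : ℕ → C(X, ℂ)) (P N a : ℕ) : 0 ≤ blkMom μ F P N a :=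
  integral_nonneg fun _ => by positivity

theorem blkMom_one (F : ℕ → C(X, ℂ)) (P a : ℕ) : blkMom μ F P 1 a = ∫ x, ‖F a x‖ ^ P ∂μ := by
  simp [blkMom, blk]

theorem blkMom_eq (F : ℕ → C(X, ℂ)) (P N a : ℕ) :
    blkMom μ F P N a = ∫ x, ‖((((1 / (N : ℝ)) : ℝ) : ℂ) • blk F N a) x‖ ^ P ∂μ := by
  simp only [blkMom, ContinuousMap.smul_apply, norm_smul, Complex.norm_real, Real.norm_eq_abs]
  congr 1; ext x
  rw [abs_of_nonneg (by positivity)]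

theorem blkMom_mul_le (F : ℕ → C(X, ℂ)) {P : ℕ} (hP : 1 ≤ P) (q N a : ℕ) :
    blkMom μ F P (q * N) a ≤ 1 / (q : ℝ) * ∑ i ∈ Finset.range q, blkMom μ F P N (a + i * N) := by
  have h := integral_avg_pow_le (μ := μ) (Finset.range q)
    (fun i => (((1 / (N : ℝ)) : ℝ) : ℂ) • blk F N (a + i * N)) (w := fun _ => 1) (by fun_prop)
    (by simp) (c := 1 / (q : ℝ)) (K := 1) (by positivity) (by
      rw [Finset.card_range]
      rcases Nat.eq_zero_or_pos q with rfl | hq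
      · simp
      · rw [one_div, inv_mul_cancel₀ (by positivity)]) hP
  simp only [mul_one, one_pow, one_mul] at h
  simp_rw [← blkMom_eq] at h
  refine le_trans (le_of_eq ?_) h
  rw [blkMom]
  congr 1; ext x
  rw [← Finset.smul_sum, ← blk_mul, ContinuousMap.smul_apply, norm_smul, Complex.norm_real,
    Real.norm_eq_abs, abs_of_nonneg (by positivity)]
  push_cast
  rw [← mul_assoc]
  congr 2
  rw [one_div_mul_one_div]

theorem block_point {a i N K j : ℕ} (hj : j < N) (hi : i < K) :
    (a : ℝ) ≤ ((a + i * N + j : ℕ) : ℝ) ∧ ((a + i * N + j : ℕ) : ℝ) ≤ a + K * N := by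
  constructor
  · push_cast; nlinarith [Nat.cast_nonneg (α := ℝ) i, Nat.cast_nonneg (α := ℝ) j,
      Nat.cast_nonneg (α := ℝ) N, mul_nonneg (Nat.cast_nonneg (α := ℝ) i) (Nat.cast_nonneg (α := ℝ) N)]
  · have : i * N + j ≤ K * N := by nlinarith
    have : ((i * N + j : ℕ) : ℝ) ≤ ((K * N : ℕ) : ℝ) := by exact_mod_cast this
    push_cast at this ⊢; linarith

theorem boxed_subset_adm {n K T t m i a j : ℕ} {Φ : G →+ ℝ[X]} {A : ℝ} (hA : 1 ≤ A)
    {x σ : ℕ → ℝ} (hx : ∀ m, 0 ≤ x m) (hx0 : x 0 = 1) (hσ : ∀ m, |σ m| = 1) (hK : 1 ≤ K)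
    (htT : t ≤ T) (hm : domIdx n x K t = m) (hm1 : 1 ≤ m)
    (hm' : domIdx n x K (t + (n + 1)) = m) (hi : i < K) (hj : j < K ^ t) :
    Boxed n Φ A K T x σ ((a + i * K ^ t + j : ℕ) : ℝ) ⊆
      Adm m (scalePhase Φ (σ m / (m.factorial * x m * ((K : ℝ) ^ (t + 1)) ^ m)) a ((K : ℝ) ^ (t + 1)))
        (1 / (K : ℝ)) (2 ^ (n + 2) * A) 0 1 (fun _ => 1) ((i : ℝ) / K) := by
  intro ξ hξ
  obtain ⟨hdeg, hξ⟩ := hξ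
  have hmn : m ≤ n := hm ▸ domIdx_le n x K t
  have hK' : (1 : ℝ) ≤ K := by exact_mod_cast hK
  have hK0 : (0 : ℝ) < K := by linarith
  set q : ℝ := ((a + i * K ^ t + j : ℕ) : ℝ) with hq
  set r : ℝ := (K : ℝ) ^ t with hr
  have hr0 : 0 < r := by positivity
  have hr1 : (K : ℝ) ^ (t + 1) = r * K := pow_succ _ _
  have hdom : ∀ l ≤ n, x l * r ^ l ≤ x m * r ^ m := by
    intro l hl
    have := le_domSize x K t hl
    rwa [← domIdx_spec, hm, pow_mul, pow_mul] at this
  have h1 : 1 ≤ x m * r ^ m := by simpa [hx0] using hdom 0 (Nat.zero_le _)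
  have hxm : 0 < x m := by
    rcases (hx m).lt_or_eq with h | h
    · exact h
    · rw [← h, zero_mul] at h1; linarith
  have hdom' : ∀ l ≤ n, m < l → x l * (r * K) ^ (l - m) ≤ x m / K ^ n := by
    intro l hl hml
    have h := le_domSize x K (t + (n + 1)) hl
    rw [← domIdx_spec, hm', pow_mul, pow_mul, show t + (n + 1) = (t + 1) + n by ring, pow_add, hr1,
      show l = (l - m) + m by omega, pow_add _ (l - m) m, ← mul_assoc] at h
    have h2 := le_of_mul_le_mul_right h (by positivity)
    rw [Nat.sub_add_cancel hml.le] at h2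
    rw [le_div_iff₀ (by positivity)]
    refine le_trans ?_ h2
    rw [mul_pow (r * K) _ (l - m), ← mul_assoc (x l)]
    have : 0 ≤ x l * (r * K) ^ (l - m) := mul_nonneg (hx l) (by positivity)
    exact mul_le_mul_of_nonneg_left (le_self_pow₀ (one_le_pow₀ hK') (by omega)) this
  have hfac : (1 : ℝ) ≤ m.factorial := by exact_mod_cast Nat.one_le_iff_ne_zero.2 m.factorial_ne_zero
  have hc : |σ m / (m.factorial * x m * (r * K) ^ m)| ≤ 1 / (x m * (r * K) ^ m) := by
    rw [abs_div, hσ, abs_of_pos (by positivity)]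
    have : 0 < x m * (r * K) ^ m := by positivity
    apply one_div_le_one_div_of_le this
    rw [mul_assoc]
    nlinarith
  rw [hr1]
  constructor
  · intro l hl
    rw [dv_scalePhase]
    have hpt : |(a : ℝ) + r * K * (i / K) - q| ≤ r := by
      rw [hq]; push_cast
      rw [← hr, show (a : ℝ) + r * K * (i / K) - (a + i * r + j) = -j by field_simp; ring, abs_neg,
        abs_of_nonneg (by positivity)]
      have : ((j : ℕ) : ℝ) ≤ ((K ^ t : ℕ) : ℝ) := by exact_mod_cast hj.le
      simpa [hr] using this
    have h3 := dv_taylor hdeg hr0 (V := A * (x m * r ^ m)) (by positivity) hpt (fun l hl => by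
      calc |dv l (Φ ξ) q| * r ^ l ≤ A * x l * r ^ l := by gcongr; exact (hξ l hl).1
        _ = A * (x l * r ^ l) := by ring
        _ ≤ _ := mul_le_mul_of_nonneg_left (hdom l hl) (by linarith)) l
    have h4 : |dv l (Φ ξ) (↑a + r * ↑K * (↑i / ↑K))| ≤ 2 ^ (n + 1) * (A * (x m * r ^ m)) / r ^ l := by
      rwa [le_div_iff₀ (by positivity)]
    rw [abs_mul, abs_mul, abs_of_nonneg (by positivity : 0 ≤ (r * K) ^ l)]
    calc _ ≤ 1 / (x m * (r * K) ^ m) * ((r * K) ^ l * (2 ^ (n + 1) * (A * (x m * r ^ m)) / r ^ l)) := by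
          gcongr
      _ = 2 ^ (n + 1) * A * (1 / K) ^ (m - l) := by
          have : (K : ℝ) ^ m = K ^ (m - l) * K ^ l := by rw [← pow_add]; congr 1; omega
          rw [mul_pow, mul_pow, this, one_div_pow]
          field_simp
      _ ≤ _ := by
          gcongr
          · norm_num
          · omega
  · intro y hy
    rw [dv_scalePhase]
    set z : ℝ := a + r * K * y with hz
    have hzq : |z - q| ≤ r * K := by
      obtain ⟨b1, b2⟩ := block_point (a := a) hj hi
      rw [← hq] at b1 b2
      push_cast at b2
      rw [← hr] at b2
      have : r * K * y ≤ r * K * 1 := by gcongr; exact hy.2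
      have : 0 ≤ r * K * y := mul_nonneg (by positivity) hy.1
      rw [abs_le, hz]
      constructor <;> linarith
    have hsup : ∀ w ∈ Set.uIcc q z, |dv (m + 1) (Φ ξ) w| ≤
        2 ^ (n + 1) * (A * x m / K ^ n) / (r * K) := by
      intro w hw
      have hwq : |w - q| ≤ r * K := (Set.abs_sub_left_of_mem_uIcc hw).trans hzq
      have h5 := dv_taylor (p := derivative^[m + 1] (Φ ξ)) (u := q) (y := w) (r := r * K) (n := n)
        (V := A * x m / K ^ n / (r * K))
        ((natDegree_iterate_derivative _ _).trans (by omega)) (by positivity) (by positivity)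
        hwq (fun l hl => by
          rw [dv_iterate]
          rcases lt_or_ge n (l + (m + 1)) with hlt | hle
          · rw [dv_eq_zero hdeg hlt, abs_zero, zero_mul]; positivity
          · rw [le_div_iff₀ (by positivity)]
            calc |dv (l + (m + 1)) (Φ ξ) q| * (r * K) ^ l * (r * K)
                ≤ A * x (l + (m + 1)) * (r * K) ^ l * (r * K) := by gcongr; exact (hξ _ hle).1
              _ = A * (x (l + (m + 1)) * (r * K) ^ (l + (m + 1) - m)) := by
                  rw [show l + (m + 1) - m = l + 1 by omega]; ring
              _ ≤ A * (x m / K ^ n) := by gcongr; exact hdom' _ hle (by omega)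
              _ = _ := by ring) 0
      rw [dv_iterate, pow_zero, mul_one, zero_add] at h5
      refine h5.trans (le_of_eq (by ring))
    have h6 := abs_dv_sub_le hsup
    have h7 : |dv m (Φ ξ) z - dv m (Φ ξ) q| ≤ 2 ^ (n + 1) * (A * x m / K ^ n) := by
      refine h6.trans ((mul_le_mul_of_nonneg_left hzq (by positivity)).trans (le_of_eq ?_))
      field_simp
    have hbig : 1 ≤ x m * (K : ℝ) ^ (T * m) := by
      refine h1.trans ?_
      rw [pow_mul]
      have : r ≤ (K : ℝ) ^ T := pow_le_pow_right₀ hK' htT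
      gcongr
    have h8 := (hξ m hmn).2 hm1 hbig
    have hσσ : σ m * σ m = 1 := by rw [← abs_mul_abs_self, hσ, one_mul]
    have e1 : σ m / (m.factorial * x m * (r * K) ^ m) * ((r * K) ^ m * dv m (Φ ξ) z) - 1 =
        σ m / (m.factorial * x m) * (dv m (Φ ξ) z - σ m * (m.factorial * x m)) := by
      field_simp
      linear_combination (m.factorial * x m) * hσσ
    rw [e1, abs_mul, abs_div, hσ, abs_of_pos (by positivity)]
    calc 1 / (m.factorial * x m) * |dv m (Φ ξ) z - σ m * (m.factorial * x m)|
        ≤ 1 / (1 * x m) * (2 ^ (n + 1) * (A * x m / K ^ n) + A * x m / K ^ n) := by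
          gcongr
          calc _ = |(dv m (Φ ξ) z - dv m (Φ ξ) q) + (dv m (Φ ξ) q - σ m * (m.factorial * x m))| := by
                congr 1; ring
            _ ≤ _ := (abs_add_le _ _).trans (add_le_add h7 h8)
      _ = (2 ^ (n + 1) + 1) * A * (1 / K) ^ n := by rw [one_div_pow]; field_simp
      _ ≤ 2 ^ (n + 2) * A * (1 / K) ^ m := by
          have h2 : (1 : ℝ) ≤ 2 ^ (n + 1) := one_le_pow₀ (by norm_num)
          have h3 : (2 : ℝ) ^ (n + 2) = 2 * 2 ^ (n + 1) := by ring
          gcongr ?_ * A * ?_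
          · linarith
          · exact pow_le_pow_of_le_one (by positivity) (by rw [div_le_one hK0]; exact hK') hmn

end MultiScaleStep

section MultiScaleInduction

open Polynomial

variable {X G : Type*} [TopologicalSpace X] [CompactSpace X] [MeasurableSpace X] [BorelSpace X]
  [AddCommGroup G] {μ : Measure X} [IsProbabilityMeasure μ] {e : G → C(X, ℂ)}

theorem blkMom_good_step (he : Chars μ e) {n K T t m a P : ℕ} {Φ : G →+ ℝ[X]} {A : ℝ} (hA : 1 ≤ A)
    {x σ : ℕ → ℝ} (hx : ∀ m, 0 ≤ x m) (hx0 : x 0 = 1) (hσ : ∀ m, |σ m| = 1) (hK : 1 ≤ K)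
    (htT : t ≤ T) (hm : domIdx n x K t = m) (hm1 : 1 ≤ m)
    (hm' : domIdx n x K (t + (n + 1)) = m) {F : ℕ → C(X, ℂ)}
    (hF : ∀ j : ℕ, F j ∈ Spec e (Boxed n Φ A K T x σ j)) {Q : ℝ}
    (hQ : ∀ (S : Setup e m (2 ^ (n + 2) * A)) (T : Fam S), S.δ = 1 / (K : ℝ) →
      ∫ x, (S.δ * ‖T.sum x‖) ^ P * ‖S.H x‖ ^ 2 ∂μ ≤ Q * (S.δ * T.W μ P)) :
    blkMom μ F P (K * K ^ t) a ≤
      Q * (1 / (K : ℝ) * ∑ i ∈ Finset.range K, blkMom μ F P (K ^ t) (a + i * K ^ t)) := by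
  have hK' : (1 : ℝ) ≤ K := by exact_mod_cast hK
  have hK0 : (0 : ℝ) < K := by linarith
  have hB : (1 : ℝ) ≤ 2 ^ (n + 2) * A := by
    have : (1 : ℝ) ≤ 2 ^ (n + 2) := one_le_pow₀ (by norm_num)
    nlinarith
  let S : Setup e m (2 ^ (n + 2) * A) :=
    { δ := 1 / K
      a := 0
      b := 1
      Φ := scalePhase Φ (σ m / (m.factorial * x m * ((K : ℝ) ^ (t + 1)) ^ m)) a ((K : ℝ) ^ (t + 1))
      g := fun _ => 1
      H := 1
      δ_pos := by positivity
      δ_le := by rw [div_le_one hK0]; exact hK'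
      hab := by norm_num
      hab' := by norm_num
      hg := fun _ _ => ⟨by rw [div_le_one (by linarith)]; exact hB, hB⟩
      hH := by
        rw [← he.zero]
        refine Spec.mem_of fun j _ x _ => ?_
        rw [map_zero, dv_zero_poly, abs_zero]
        positivity }
  let Fa : Fam S :=
    { s := Finset.range K
      u := fun i => (i : ℝ) / K
      f := fun i => (((1 / ((K ^ t : ℕ) : ℝ)) : ℝ) : ℂ) • blk F (K ^ t) (a + i * K ^ t)
      hu := fun i hi => by
        have : (i : ℝ) ≤ K := by exact_mod_cast (Finset.mem_range.1 hi).le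
        exact ⟨by positivity, by rw [div_le_one hK0]; exact this⟩
      sep := fun i _ j _ hij => by
        rw [← sub_div, abs_div, abs_of_pos hK0]
        have : (1 : ℤ) ≤ |(i : ℤ) - j| := Int.one_le_abs (by omega)
        have : (1 : ℝ) ≤ |(i : ℝ) - j| := by exact_mod_cast this
        exact div_le_div_of_nonneg_right this hK0.le
      hf := fun i hi => by
        refine Submodule.smul_mem _ _ (Submodule.sum_mem _ fun j hj => ?_)
        exact Spec.mono (boxed_subset_adm hA hx hx0 hσ hK htT hm hm1 hm' (Finset.mem_range.1 hi)
          (Finset.mem_range.1 hj)) (hF _) }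
  have h := hQ S Fa rfl
  have e1 : ∀ y, S.δ * ‖Fa.sum y‖ = 1 / ((K * K ^ t : ℕ) : ℝ) * ‖blk F (K * K ^ t) a y‖ := by
    intro y
    show 1 / (K : ℝ) * ‖(∑ i ∈ Finset.range K,
      (((1 / ((K ^ t : ℕ) : ℝ)) : ℝ) : ℂ) • blk F (K ^ t) (a + i * K ^ t)) y‖ = _
    rw [← Finset.smul_sum, ← blk_mul, ContinuousMap.smul_apply, norm_smul, Complex.norm_real,
      Real.norm_eq_abs, abs_of_nonneg (by positivity), ← mul_assoc, Nat.cast_mul, one_div_mul_one_div]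
  have e2 : Fa.W μ P = ∑ i ∈ Finset.range K, blkMom μ F P (K ^ t) (a + i * K ^ t) := by
    refine Finset.sum_congr rfl fun i _ => ?_
    rw [blkMom_eq]
    have : ∀ y, ‖S.H y‖ = 1 := fun y => by show ‖(1 : C(X, ℂ)) y‖ = 1; simp
    simp only [this, one_pow, mul_one]
    rfl
  have e3 : ∀ y, ‖S.H y‖ = 1 := fun y => by show ‖(1 : C(X, ℂ)) y‖ = 1; simp
  rw [e2] at h
  simpa only [e1, e3, one_pow, mul_one, blkMom] using h

theorem multiscale (he : Chars μ e) {n d K T P : ℕ} (hd : d ≤ n) (hP : 1 ≤ P) {Φ : G →+ ℝ[X]} {A : ℝ}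
    (hA : 1 ≤ A) {x σ : ℕ → ℝ} (hx : ∀ m, 0 ≤ x m) (hx0 : x 0 = 1) (hσ : ∀ m, |σ m| = 1) (hK : 1 ≤ K)
    {F : ℕ → C(X, ℂ)} (hF : ∀ j : ℕ, F j ∈ Spec e (Boxed n Φ A K T x σ j)) {Q : ℝ} (hQ1 : 1 ≤ Q)
    (hQ : ∀ m, 1 ≤ m → m ≤ n → ∃ q : ℝ, q * K ^ (m * (d + 1)) ≤ Q ∧
      ∀ (S : Setup e m (2 ^ (n + 2) * A)) (T : Fam S), S.δ = 1 / (K : ℝ) →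
        ∫ x, (S.δ * ‖T.sum x‖) ^ P * ‖S.H x‖ ^ 2 ∂μ ≤ q * (S.δ * T.W μ P))
    (t : ℕ) (ht : t ≤ T) (a : ℕ) :
    domSize n x K t ^ (d + 1) * blkMom μ F P (K ^ t) a ≤
      Q ^ t * K ^ (n * (n + 1) * domSum n x K t) * domSize n x K 0 ^ (d + 1) *
        (1 / ((K ^ t : ℕ) : ℝ) * ∑ j ∈ Finset.range (K ^ t), blkMom μ F P 1 (a + j)) := by
  have hK' : (1 : ℝ) ≤ K := by exact_mod_cast hK
  induction t generalizing a with
  | zero =>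
    have h0 : 0 ≤ domSize n x K 0 ^ (d + 1) * blkMom μ F P 1 a :=
      mul_nonneg (pow_nonneg (domSize_nonneg hx _ _) _) (blkMom_nonneg _ _ _ _)
    have h1 : (1 : ℝ) ≤ K ^ (n * (n + 1) * domSum n x K 0) := one_le_pow₀ hK'
    simp only [pow_zero, one_mul, Nat.cast_one, div_one, Finset.range_one, Finset.sum_singleton,
      add_zero]
    rw [mul_assoc]
    exact le_mul_of_one_le_left h0 h1
  | succ t ih =>
    have ih := fun a => ih (by omega) a
    have hR0 := domSize_nonneg hx K (n := n) t
    have hR0' := domSize_nonneg hx K (n := n) 0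
    set V : ℝ := 1 / (K : ℝ) * ∑ i ∈ Finset.range K, blkMom μ F P (K ^ t) (a + i * K ^ t) with hV
    have hV0 : 0 ≤ V := mul_nonneg (by positivity) (Finset.sum_nonneg fun _ _ => blkMom_nonneg _ _ _ _)
    -- one step, with the loss measured by the change of `domSum`
    have step : (K : ℝ) ^ (domIdx n x K (t + 1) * (d + 1)) * blkMom μ F P (K * K ^ t) a *
        K ^ (n * (n + 1) * domSum n x K t) ≤
        Q * K ^ (n * (n + 1) * domSum n x K (t + 1)) * V := by
      have hmono := domIdx_mono (n := n) hK hx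
      have hsum := domSum_succ n x K t
      have hle := hmono (show t ≤ t + (n + 1) by omega)
      have hjen : blkMom μ F P (K * K ^ t) a ≤ V := blkMom_mul_le F hP K (K ^ t) a
      rcases hle.lt_or_eq with hlt | heq
      · have hd1 := domIdx_le n x K (t + 1)
        have hexp : domIdx n x K (t + 1) * (d + 1) + n * (n + 1) * domSum n x K t ≤
            n * (n + 1) * domSum n x K (t + 1) := by
          have h1 : domSum n x K t + 1 ≤ domSum n x K (t + 1) := by omega
          have h2 : domIdx n x K (t + 1) * (d + 1) ≤ n * (n + 1) := by gcongr
          calc _ ≤ n * (n + 1) + n * (n + 1) * domSum n x K t := by omega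
            _ = n * (n + 1) * (domSum n x K t + 1) := by ring
            _ ≤ _ := by gcongr
        calc _ = (K : ℝ) ^ (domIdx n x K (t + 1) * (d + 1) + n * (n + 1) * domSum n x K t) *
              blkMom μ F P (K * K ^ t) a := by rw [pow_add]; ring
          _ ≤ 1 * K ^ (n * (n + 1) * domSum n x K (t + 1)) * V := by
              rw [one_mul]
              refine mul_le_mul (pow_le_pow_right₀ hK' hexp) hjen (blkMom_nonneg _ _ _ _)
                (by positivity)
          _ ≤ _ := by gcongr
      · have hs : domSum n x K (t + 1) = domSum n x K t := by omega
        have h1 : domIdx n x K (t + 1) = domIdx n x K t :=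
          le_antisymm ((hmono (show t + 1 ≤ t + (n + 1) by omega)).trans heq.ge)
            (hmono (Nat.le_succ t))
        rw [hs, h1, mul_right_comm Q, mul_right_comm]
        rw [mul_right_comm]
        refine mul_le_mul_of_nonneg_right ?_ (by positivity)
        rcases Nat.eq_zero_or_pos (domIdx n x K t) with h0 | hpos
        · rw [h0, zero_mul, pow_zero, one_mul]
          nlinarith
        · obtain ⟨q, hq, hq'⟩ := hQ _ hpos (domIdx_le n x K t)
          have := blkMom_good_step he hA hx hx0 hσ hK (by omega : t ≤ T) rfl hpos heq.symm hF hq'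
            (a := a)
          calc _ ≤ (K : ℝ) ^ (domIdx n x K t * (d + 1)) * (q * V) := by gcongr
            _ = q * K ^ (domIdx n x K t * (d + 1)) * V := by ring
            _ ≤ Q * V := by gcongr
    have hKpos : (0 : ℝ) < K ^ (n * (n + 1) * domSum n x K t) := by positivity
    rw [← mul_le_mul_iff_left₀ hKpos]
    have hR : domSize n x K (t + 1) ^ (d + 1) ≤
        domSize n x K t ^ (d + 1) * K ^ (domIdx n x K (t + 1) * (d + 1)) := by
      rw [pow_mul, ← mul_pow]
      exact pow_le_pow_left₀ (domSize_nonneg hx _ _) (domSize_succ_le n x K t) _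
    have hb0 := blkMom_nonneg (μ := μ) F P (K * K ^ t) a
    rw [pow_succ' K t]
    calc domSize n x K (t + 1) ^ (d + 1) * blkMom μ F P (K * K ^ t) a *
          K ^ (n * (n + 1) * domSum n x K t)
        ≤ domSize n x K t ^ (d + 1) * K ^ (domIdx n x K (t + 1) * (d + 1)) *
            blkMom μ F P (K * K ^ t) a * K ^ (n * (n + 1) * domSum n x K t) := by gcongr
      _ = domSize n x K t ^ (d + 1) * (K ^ (domIdx n x K (t + 1) * (d + 1)) *
            blkMom μ F P (K * K ^ t) a * K ^ (n * (n + 1) * domSum n x K t)) := by ring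
      _ ≤ domSize n x K t ^ (d + 1) * (Q * K ^ (n * (n + 1) * domSum n x K (t + 1)) * V) := by gcongr
      _ = Q * K ^ (n * (n + 1) * domSum n x K (t + 1)) * (1 / (K : ℝ) *
            ∑ i ∈ Finset.range K, domSize n x K t ^ (d + 1) * blkMom μ F P (K ^ t) (a + i * K ^ t)) := by
          rw [hV, ← Finset.mul_sum]; ring
      _ ≤ Q * K ^ (n * (n + 1) * domSum n x K (t + 1)) * (1 / (K : ℝ) *
            ∑ i ∈ Finset.range K, (Q ^ t * K ^ (n * (n + 1) * domSum n x K t) *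
              domSize n x K 0 ^ (d + 1) * (1 / ((K ^ t : ℕ) : ℝ) *
              ∑ j ∈ Finset.range (K ^ t), blkMom μ F P 1 (a + i * K ^ t + j)))) := by
          exact mul_le_mul_of_nonneg_left (mul_le_mul_of_nonneg_left
            (Finset.sum_le_sum fun i _ => ih _) (by positivity)) (by positivity)
      _ = _ := by
          rw [sum_range_mul_eq, ← Finset.mul_sum, ← Finset.mul_sum]
          simp only [← add_assoc]
          push_cast
          rw [← one_div_mul_one_div]
          ring

end MultiScaleInduction

section Phases

open Polynomial

variable {n : ℕ}

/-- Frequencies re-centred at `j`. -/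
def shiftF (n j : ℕ) (b : Fin (n + 1) → ℤ) : Fin (n + 1) → ℤ :=
  fun s => ∑ m : Fin (n + 1), (m.val.choose s.val : ℤ) * (-(j : ℤ)) ^ (m.val - s.val) * b m

/-- Points re-centred at `j`. -/
def locc (n j : ℕ) (y : Fin (n + 1) → ℝ) (m : Fin (n + 1)) : ℝ :=
  ∑ s : Fin (n + 1), (m.val.choose s.val : ℝ) * (-(j : ℝ)) ^ (m.val - s.val) * y s

/-- The polynomial attached to a frequency. -/
def phase (n : ℕ) : (Fin (n + 1) → ℤ) →+ ℝ[X] where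
  toFun ξ := ∑ s : Fin (n + 1), C (ξ s : ℝ) * Polynomial.X ^ (s : ℕ)
  map_zero' := by simp
  map_add' := by intro x y; simp [add_mul, Finset.sum_add_distrib]

theorem phase_apply (ξ : Fin (n + 1) → ℤ) :
    phase n ξ = ∑ s : Fin (n + 1), C (ξ s : ℝ) * Polynomial.X ^ (s : ℕ) := rfl

theorem sum_shiftF (j : ℕ) (b : Fin (n + 1) → ℤ) (y : Fin (n + 1) → ℝ) :
    ∑ s, (shiftF n j b s : ℝ) * y s = ∑ m, (b m : ℝ) * locc n j y m := by
  simp only [shiftF, locc, Finset.mul_sum]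
  push_cast
  simp only [Finset.sum_mul]
  rw [Finset.sum_comm]
  exact Finset.sum_congr rfl fun _ _ => Finset.sum_congr rfl fun _ _ => by ring

theorem add_pow_fin {R : Type*} [CommSemiring R] (x y : R) {m : ℕ} (hm : m ≤ n) :
    (x + y) ^ m = ∑ s : Fin (n + 1), x ^ (s : ℕ) * y ^ (m - s) * (m.choose s : R) := by
  rw [add_pow, Fin.sum_univ_eq_sum_range (fun s => x ^ s * y ^ (m - s) * (m.choose s : R)) (n + 1)]
  refine Finset.sum_subset (Finset.range_subset_range.2 (by omega)) fun s _ hs => ?_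
  rw [Nat.choose_eq_zero_of_lt (by simpa using hs)]
  simp

theorem phase_shiftF (j : ℕ) (b : Fin (n + 1) → ℤ) :
    phase n (shiftF n j b) = (phase n b).comp (C (-(j : ℝ)) + C 1 * Polynomial.X) := by
  simp only [phase_apply, shiftF, Polynomial.sum_comp, mul_comp, C_comp, pow_comp, X_comp]
  push_cast
  simp only [map_sum, Finset.sum_mul]
  rw [Finset.sum_comm]
  refine Finset.sum_congr rfl fun m _ => ?_
  rw [add_comm (C (-(j : ℝ))), C_1, one_mul, add_pow_fin (n := n) _ _ (Nat.le_of_lt_succ m.2),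
    Finset.mul_sum]
  refine Finset.sum_congr rfl fun s _ => ?_
  simp only [map_mul, map_pow, map_neg, map_natCast]
  ring

theorem natDegree_phase_le (ξ : Fin (n + 1) → ℤ) : (phase n ξ).natDegree ≤ n := by
  rw [phase_apply]
  refine natDegree_sum_le_of_forall_le _ _ fun s _ => ?_
  exact (natDegree_C_mul_X_pow_le _ _).trans (Nat.le_of_lt_succ s.2)

theorem dv_phase_zero (b : Fin (n + 1) → ℤ) (m : Fin (n + 1)) :
    dv m (phase n b) 0 = m.val.factorial * b m := by
  rw [dv, ← coeff_zero_eq_eval_zero, coeff_iterate_derivative, zero_add, Nat.descFactorial_self,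
    nsmul_eq_mul, phase_apply, finsetSum_coeff]
  simp only [coeff_C_mul, coeff_X_pow]
  rw [Finset.sum_eq_single m]
  · simp
  · intro s _ hs
    rw [if_neg (fun h => hs (Fin.ext h.symm)), mul_zero]
  · simp

theorem dv_phase_shiftF (j : ℕ) (b : Fin (n + 1) → ℤ) (m : Fin (n + 1)) :
    dv m (phase n (shiftF n j b)) j = m.val.factorial * b m := by
  rw [phase_shiftF, dv_comp, one_pow, one_mul, one_mul, neg_add_cancel, dv_phase_zero]

theorem shiftF_injective (n j : ℕ) : Function.Injective (shiftF n j) := by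
  intro b b' h
  ext m
  have h1 := dv_phase_shiftF j b m
  rw [h, dv_phase_shiftF] at h1
  have : (m.val.factorial : ℝ) ≠ 0 := by exact_mod_cast m.val.factorial_ne_zero
  exact_mod_cast (mul_left_cancel₀ this h1).symm

end Phases

section Parseval

variable {X G : Type*} [TopologicalSpace X] [CompactSpace X] [MeasurableSpace X] [BorelSpace X]
  [AddCommGroup G] {μ : Measure X} [IsProbabilityMeasure μ] {e : G → C(X, ℂ)}

theorem parseval (he : Chars μ e) {ι : Type*} (s : Finset ι) (φ : ι → G) (hφ : Function.Injective φ)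
    (c : ι → ℂ) : ∫ x, ‖(∑ b ∈ s, c b • e (φ b)) x‖ ^ 2 ∂μ = ∑ b ∈ s, ‖c b‖ ^ 2 := by
  classical
  have h1 : ∀ x, ((‖(∑ b ∈ s, c b • e (φ b)) x‖ ^ 2 : ℝ) : ℂ) =
      ∑ b ∈ s, ∑ b' ∈ s, c b * (starRingEnd ℂ) (c b') *
        (e (φ b) x * (starRingEnd ℂ) (e (φ b') x)) := by
    intro x
    rw [Complex.ofReal_pow, ← Complex.mul_conj']
    simp only [ContinuousMap.sum_apply, ContinuousMap.smul_apply, smul_eq_mul, map_sum, map_mul]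
    rw [Finset.sum_mul_sum]
    exact Finset.sum_congr rfl fun _ _ => Finset.sum_congr rfl fun _ _ => by ring
  have h2 : ((∫ x, ‖(∑ b ∈ s, c b • e (φ b)) x‖ ^ 2 ∂μ : ℝ) : ℂ) =
      ((∑ b ∈ s, ‖c b‖ ^ 2 : ℝ) : ℂ) := by
    rw [← integral_complex_ofReal]
    simp_rw [h1]
    rw [integral_finsetSum _ fun i _ => cint (by fun_prop), Complex.ofReal_sum]
    refine Finset.sum_congr rfl fun b hb => ?_
    rw [integral_finsetSum _ fun i _ => cint (by fun_prop)]
    simp_rw [integral_const_mul, integral_char_mul_conj he, hφ.eq_iff]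
    simp [hb, Complex.mul_conj']
  exact_mod_cast h2

end Parseval

section Detector

open Polynomial

variable {n : ℕ}

/-- Coefficient of the smoothed indicator of the cells `c ∈ Hv`. -/
def cf (n N : ℕ) (Hv : Finset (Fin (n + 1) → ℤ)) (b : Fin (n + 1) → ℤ) : ℂ :=
  ∑ c ∈ Hv, ∏ m, ((wt N (b m) : ℂ) * ee (-(b m * (c m / (16 * N)))))

/-- The part of the smoothed indicator of the cells in `Hv` at time `j` with frequencies in `I`. -/
def det (n N : ℕ) (Hv : Finset (Fin (n + 1) → ℤ)) (I : Fin (n + 1) → Finset ℤ) (j : ℕ) :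
    C(Fin (n + 1) → UnitAddCircle, ℂ) :=
  ∑ b ∈ Fintype.piFinset I, cf n N Hv b • tch (shiftF n j b)

theorem det_tpt (N : ℕ) (Hv : Finset (Fin (n + 1) → ℤ)) (I : Fin (n + 1) → Finset ℤ) (j : ℕ)
    (y : Fin (n + 1) → ℝ) :
    det n N Hv I j (tpt y) = ∑ c ∈ Hv, ∏ m, kf N (I m) (locc n j y m - c m / (16 * N)) := by
  simp only [det, cf, ContinuousMap.sum_apply, ContinuousMap.smul_apply, smul_eq_mul, Finset.sum_mul]
  rw [Finset.sum_comm]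
  refine Finset.sum_congr rfl fun c _ => ?_
  simp only [kf]
  rw [Finset.prod_univ_sum]
  refine Finset.sum_congr rfl fun b _ => ?_
  rw [tch_tpt, sum_shiftF, ee_sum, ← Finset.prod_mul_distrib]
  refine Finset.prod_congr rfl fun m _ => ?_
  rw [mul_assoc, ← ee_add]
  congr 2; ring

theorem det_fr_tpt (N : ℕ) (Hv : Finset (Fin (n + 1) → ℤ)) (j : ℕ) (y : Fin (n + 1) → ℝ) :
    det n N Hv (fun _ => fr N) j (tpt y) = ((∑ c ∈ Hv, ∏ m, (‖∑ p ∈ Finset.range N,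
      ee (p * (locc n j y m - c m / (16 * N)))‖ / N) ^ 2 : ℝ) : ℂ) := by
  rw [det_tpt]
  push_cast
  refine Finset.sum_congr rfl fun c _ => Finset.prod_congr rfl fun m _ => ?_
  rw [kf_fr]; push_cast; rfl

theorem det_fr_lower {N : ℕ} (hN : 0 < N) {Hv : Finset (Fin (n + 1) → ℤ)} {j : ℕ}
    {y : Fin (n + 1) → ℝ} {c : Fin (n + 1) → ℤ} (hc : c ∈ Hv)
    (h : ∀ m, |locc n j y m - c m / (16 * N)| ≤ 1 / (16 * N)) :
    (1 / 4) ^ (n + 1) ≤ ‖det n N Hv (fun _ => fr N) j (tpt y)‖ := by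
  rw [det_fr_tpt, Complex.norm_real, Real.norm_eq_abs]
  refine le_trans ?_ (le_abs_self _)
  refine le_trans ?_ (Finset.single_le_sum (fun c _ => by positivity) hc)
  calc (1 / 4 : ℝ) ^ (n + 1) = ∏ _m : Fin (n + 1), (1 / 4 : ℝ) := by simp
    _ ≤ _ := Finset.prod_le_prod (fun _ _ => by norm_num) fun m _ => kf_fr_lower hN (h m)

theorem norm_det_le {N : ℕ} (hN : 0 < N) {Hv : Finset (Fin (n + 1) → ℤ)}
    (hHv : Hv ⊆ Fintype.piFinset fun _ => Finset.Ico (-8 * N : ℤ) (8 * N))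
    {I : Fin (n + 1) → Finset ℤ} (hI : ∀ m, (I m : Set ℤ).OrdConnected) (j : ℕ)
    (x : Fin (n + 1) → UnitAddCircle) : ‖det n N Hv I j x‖ ≤ (24 * lg (16 * N)) ^ (n + 1) := by
  obtain ⟨y, rfl⟩ := tpt_surjective x
  rw [det_tpt]
  calc _ ≤ ∑ c ∈ Hv, ∏ m, ‖kf N (I m) (locc n j y m - c m / (16 * N))‖ :=
        norm_sum_le_of_le _ fun c _ => (norm_prod _ _).le
    _ ≤ ∑ c ∈ Fintype.piFinset fun _ => Finset.Ico (-8 * N : ℤ) (8 * N),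
          ∏ m, ‖kf N (I m) (locc n j y m - c m / (16 * N))‖ :=
        Finset.sum_le_sum_of_subset_of_nonneg hHv fun _ _ _ =>
          Finset.prod_nonneg fun _ _ => norm_nonneg _
    _ = ∏ m, ∑ c ∈ Finset.Ico (-8 * N : ℤ) (8 * N), ‖kf N (I m) (locc n j y m - c / (16 * N))‖ := by
        rw [Finset.prod_univ_sum]
    _ ≤ ∏ _m : Fin (n + 1), (24 * lg (16 * N)) := by
        refine Finset.prod_le_prod (fun _ _ => Finset.sum_nonneg fun _ _ => norm_nonneg _)
          fun m _ => ?_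
        have := sum_norm_kf_le hN (hI m) (locc n j y m) (-8 * N)
        rwa [show (-8 * N + 16 * N : ℤ) = 8 * N by ring] at this
    _ = _ := by simp

theorem wt_zero {N : ℕ} (hN : 0 < N) : wt N 0 = 1 / N := by
  have : ((Finset.range N).filter fun p : ℕ => 0 ≤ (p : ℤ) - 0 ∧ (p : ℤ) - 0 < N) =
      Finset.range N := Finset.filter_true_of_mem fun p hp => by
    rw [Finset.mem_range] at hp; omega
  rw [wt, this, Finset.card_range]
  field_simp

theorem integral_norm_det_fr {N : ℕ} (hN : 0 < N) (Hv : Finset (Fin (n + 1) → ℤ)) (j : ℕ) :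
    ∫ x, ‖det n N Hv (fun _ => fr N) j x‖ ∂torM (Fin (n + 1)) = Hv.card * (1 / (N : ℝ)) ^ (n + 1) := by
  have h1 : ∀ x, ((‖det n N Hv (fun _ => fr N) j x‖ : ℝ) : ℂ) = det n N Hv (fun _ => fr N) j x := by
    intro x
    obtain ⟨y, rfl⟩ := tpt_surjective x
    rw [det_fr_tpt, Complex.norm_real, Real.norm_eq_abs, abs_of_nonneg]
    exact Finset.sum_nonneg fun _ _ => Finset.prod_nonneg fun _ _ => by positivity
  have h2 : ((∫ x, ‖det n N Hv (fun _ => fr N) j x‖ ∂torM (Fin (n + 1)) : ℝ) : ℂ) =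
      ((Hv.card * (1 / (N : ℝ)) ^ (n + 1) : ℝ) : ℂ) := by
    rw [← integral_complex_ofReal]
    simp_rw [h1]
    have he := tchars (Fin (n + 1))
    have h0 : shiftF n j 0 = 0 := by ext s; simp [shiftF]
    have h3 : ∀ x, det n N Hv (fun _ => fr N) j x =
        ∑ b ∈ Fintype.piFinset (fun _ : Fin (n + 1) => fr N), cf n N Hv b * tch (shiftF n j b) x := by
      intro x; simp [det]
    simp_rw [h3]
    rw [integral_finsetSum _ fun i _ => cint (by fun_prop)]
    simp_rw [integral_const_mul]
    rw [Finset.sum_eq_single (0 : Fin (n + 1) → ℤ)]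
    · rw [h0, he.zero]
      simp [cf, wt_zero hN, ee_zero]
    · intro b _ hb
      rw [he.integral_zero _ (fun h => hb (shiftF_injective n j (h.trans h0.symm))), mul_zero]
    · intro h
      exact absurd (Fintype.mem_piFinset.2 fun _ => by simp [fr, hN]) h
  exact_mod_cast h2

theorem integral_norm_det_pow_le {N : ℕ} (hN : 0 < N) {Hv : Finset (Fin (n + 1) → ℤ)}
    (hHv : Hv ⊆ Fintype.piFinset fun _ => Finset.Ico (-8 * N : ℤ) (8 * N))
    {I : Fin (n + 1) → Finset ℤ} (hI : ∀ m, (I m : Set ℤ).OrdConnected) (hIf : ∀ m, I m ⊆ fr N) (j : ℕ)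
    {P : ℕ} (hP : 2 ≤ P) :
    ∫ x, ‖det n N Hv I j x‖ ^ P ∂torM (Fin (n + 1)) ≤
      ((24 * lg (16 * N)) ^ (n + 1)) ^ (P - 1) * (Hv.card * (1 / (N : ℝ)) ^ (n + 1)) := by
  set S : ℝ := (24 * lg (16 * N)) ^ (n + 1) with hS
  have hS0 : 0 ≤ S := pow_nonneg (mul_nonneg (by norm_num) (lg_nonneg _)) _
  have hfr : ∀ m : Fin (n + 1), ((fun _ : Fin (n + 1) => fr N) m : Set ℤ).OrdConnected := fun _ => by
    simp only [fr, Finset.coe_Ioo]; exact Set.ordConnected_Ioo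
  have he := tchars (Fin (n + 1))
  calc ∫ x, ‖det n N Hv I j x‖ ^ P ∂torM (Fin (n + 1))
      ≤ ∫ x, S ^ (P - 2) * ‖det n N Hv I j x‖ ^ 2 ∂torM (Fin (n + 1)) := by
        refine integral_mono (cint (by fun_prop)) (cint (by fun_prop)) fun x => ?_
        show ‖det n N Hv I j x‖ ^ P ≤ S ^ (P - 2) * ‖det n N Hv I j x‖ ^ 2
        rw [show P = (P - 2) + 2 by omega, pow_add, Nat.add_sub_cancel]
        gcongr
        exact norm_det_le hN hHv hI j x
    _ = S ^ (P - 2) * ∑ b ∈ Fintype.piFinset I, ‖cf n N Hv b‖ ^ 2 := by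
        rw [integral_const_mul]
        unfold det
        rw [parseval he _ _ (shiftF_injective n j)]
    _ ≤ S ^ (P - 2) * ∑ b ∈ Fintype.piFinset (fun _ : Fin (n + 1) => fr N), ‖cf n N Hv b‖ ^ 2 := by
        gcongr
        exact Fintype.piFinset_subset _ _ hIf
    _ = S ^ (P - 2) * ∫ x, ‖det n N Hv (fun _ => fr N) j x‖ ^ 2 ∂torM (Fin (n + 1)) := by
        unfold det
        rw [parseval he _ _ (shiftF_injective n j)]
    _ ≤ S ^ (P - 2) * ∫ x, S * ‖det n N Hv (fun _ => fr N) j x‖ ∂torM (Fin (n + 1)) := by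
        refine mul_le_mul_of_nonneg_left ?_ (by positivity)
        refine integral_mono (cint (by fun_prop)) (cint (by fun_prop)) fun x => ?_
        show ‖det n N Hv (fun _ => fr N) j x‖ ^ 2 ≤ S * ‖det n N Hv (fun _ => fr N) j x‖
        rw [pow_two]
        gcongr
        exact norm_det_le hN hHv hfr j x
    _ = S ^ (P - 1) * (Hv.card * (1 / (N : ℝ)) ^ (n + 1)) := by
        rw [integral_const_mul, integral_norm_det_fr hN, ← mul_assoc, ← pow_succ]
        congr 2; omega

theorem det_fr_eq_sum {N : ℕ} (Hv : Finset (Fin (n + 1) → ℤ)) (j : ℕ) (f : ℤ → ℤ) (Λ : Finset ℤ)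
    (hf : ∀ a ∈ fr N, f a ∈ Λ) :
    det n N Hv (fun _ => fr N) j = ∑ l ∈ Fintype.piFinset (fun _ : Fin (n + 1) => Λ),
      det n N Hv (fun m => (fr N).filter fun a => f a = l m) j := by
  ext x
  obtain ⟨y, rfl⟩ := tpt_surjective x
  rw [ContinuousMap.sum_apply]
  simp only [det_tpt]
  rw [Finset.sum_comm]
  refine Finset.sum_congr rfl fun c _ => ?_
  rw [← Finset.prod_univ_sum (fun _ : Fin (n + 1) => Λ) (fun m l => kf N ((fr N).filter fun a => f a = l)
    (locc n j y m - c m / (16 * N)))]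
  refine Finset.prod_congr rfl fun m _ => ?_
  simp only [kf]
  rw [Finset.sum_fiberwise_of_maps_to hf]

end Detector

section Labels

/-- The least geometric scale `c q^i` dominating `a`. -/
def scaleIdx (c q : ℝ) (a : ℤ) : ℕ := sInf {i : ℕ | |(a : ℝ)| ≤ c * q ^ i}

/-- The signed geometric scale of `a`. -/
def label (c q : ℝ) (a : ℤ) : ℤ := if 0 ≤ a then scaleIdx c q a else -scaleIdx c q a

variable {c q : ℝ}

theorem scaleIdx_spec (hc : 0 < c) (hq : 1 < q) (a : ℤ) : |(a : ℝ)| ≤ c * q ^ scaleIdx c q a := by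
  refine Nat.sInf_mem (s := {i : ℕ | |(a : ℝ)| ≤ c * q ^ i}) ?_
  obtain ⟨i, hi⟩ := pow_unbounded_of_one_lt (|(a : ℝ)| / c) hq
  exact ⟨i, by rw [div_lt_iff₀ hc] at hi; simp only [Set.mem_ofPred_eq]; linarith⟩

theorem scaleIdx_le {a : ℤ} {i : ℕ} (h : |(a : ℝ)| ≤ c * q ^ i) : scaleIdx c q a ≤ i :=
  Nat.sInf_le h

theorem lt_of_lt_scaleIdx {a : ℤ} {i : ℕ} (h : i < scaleIdx c q a) : c * q ^ i < |(a : ℝ)| := by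
  by_contra h'
  exact absurd (scaleIdx_le (not_lt.1 h')) (not_le.2 h)

theorem scaleIdx_mono (hc : 0 < c) (hq : 1 < q) {a b : ℤ} (h : |a| ≤ |b|) :
    scaleIdx c q a ≤ scaleIdx c q b := by
  refine scaleIdx_le (le_trans ?_ (scaleIdx_spec hc hq b))
  exact_mod_cast h

theorem label_mono (hc : 0 < c) (hq : 1 < q) : Monotone (label c q) := by
  intro a b hab
  unfold label
  have h1 : 0 ≤ a → scaleIdx c q a ≤ scaleIdx c q b := fun h =>
    scaleIdx_mono hc hq (abs_le_abs_of_nonneg h hab)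
  have h2 : b < 0 → scaleIdx c q b ≤ scaleIdx c q a := fun h =>
    scaleIdx_mono hc hq (abs_le_abs_of_nonpos h.le hab)
  split_ifs <;> omega

theorem ordConnected_label (hc : 0 < c) (hq : 1 < q) (N : ℕ) (l : ℤ) :
    (((fr N).filter fun a => label c q a = l : Finset ℤ) : Set ℤ).OrdConnected := by
  refine ⟨fun a ha b hb x hx => ?_⟩
  simp only [Finset.coe_filter, fr, Finset.mem_Ioo, Set.mem_ofPred_eq] at ha hb ⊢
  have h1 := label_mono hc hq hx.1
  have h2 := label_mono hc hq hx.2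
  have := hx.1
  have := hx.2
  omega

theorem label_mem (hc : 0 < c) (hq : 1 < q) {N : ℕ} {a : ℤ} (ha : a ∈ fr N) :
    label c q a ∈ Finset.Icc (-(scaleIdx c q N : ℤ)) (scaleIdx c q N) := by
  simp only [fr, Finset.mem_Ioo] at ha
  have : scaleIdx c q a ≤ scaleIdx c q N := scaleIdx_mono hc hq (by
    rw [Nat.abs_cast, abs_le]; omega)
  rw [Finset.mem_Icc, label]
  split_ifs <;> omega

theorem scaleIdx_card_le {n N K T : ℕ} (hK : 1 ≤ K) (hcN : (N : ℝ) ≤ c * (K : ℝ) ^ (n * T)) (hc : 0 < c)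
    (hq : 1 + 1 / (K : ℝ) ^ n ≤ q) : scaleIdx c q N ≤ n * T * K ^ (n + 1) := by
  refine scaleIdx_le ?_
  have hK0 : (0 : ℝ) < K := by exact_mod_cast hK
  have h1 : (2 : ℝ) ≤ (1 + 1 / (K : ℝ) ^ n) ^ (K ^ n) := by
    refine le_trans ?_ (one_add_mul_le_pow (by
      have : (0 : ℝ) ≤ 1 / (K : ℝ) ^ n := by positivity
      linarith) _)
    push_cast
    field_simp
    norm_num
  have h2 : (K : ℝ) ≤ 2 ^ K := by exact_mod_cast Nat.lt_two_pow_self.le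
  have hq0 : 0 ≤ 1 + 1 / (K : ℝ) ^ n := by positivity
  calc |((N : ℤ) : ℝ)| = N := by simp
    _ ≤ c * (K : ℝ) ^ (n * T) := hcN
    _ ≤ c * (2 ^ K) ^ (n * T) := by gcongr
    _ ≤ c * ((q ^ (K ^ n)) ^ K) ^ (n * T) := by
        gcongr
        exact h1.trans (by gcongr)
    _ = c * q ^ (n * T * K ^ (n + 1)) := by
        rw [← pow_mul, ← pow_mul]; congr 2; ring

theorem mul_pow_scaleIdx_le {N : ℕ} (hc : 0 < c) (hq : 1 < q) (hq2 : q ≤ 2) (hcN : c ≤ 8 * N) {i : ℕ}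
    (hi : i ≤ scaleIdx c q N) : c * q ^ i ≤ 8 * N := by
  rcases Nat.eq_zero_or_pos i with rfl | h
  · simpa using hcN
  · have := lt_of_lt_scaleIdx (show i - 1 < scaleIdx c q N by omega)
    simp only [Int.cast_natCast, Nat.abs_cast] at this
    rw [show i = i - 1 + 1 by omega, pow_succ]
    nlinarith [mul_pos hc (pow_pos (zero_lt_one.trans hq) (i - 1))]

theorem label_bounds (hc : 0 < c) (hq : 1 < q) {a l : ℤ} (h : label c q a = l) :
    |(a : ℝ)| ≤ c * q ^ l.natAbs ∧
      (l ≠ 0 → |(a : ℝ) - (if 0 ≤ l then 1 else -1) * (c * q ^ l.natAbs)| ≤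
        c * q ^ l.natAbs * (q - 1)) := by
  have hl : l.natAbs = scaleIdx c q a := by
    rw [← h, label]; split_ifs <;> omega
  have h1 := scaleIdx_spec hc hq a
  rw [hl]
  refine ⟨h1, fun h0 => ?_⟩
  have hpos : 0 < scaleIdx c q a := by omega
  have h2 := lt_of_lt_scaleIdx (show scaleIdx c q a - 1 < scaleIdx c q a by omega)
  have h3 : q ^ scaleIdx c q a = q ^ (scaleIdx c q a - 1) * q := by
    rw [← pow_succ]; congr 1; omega
  have h4 : c * q ^ (scaleIdx c q a - 1) * q - c * q ^ (scaleIdx c q a - 1) ≤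
      c * q ^ scaleIdx c q a * (q - 1) := by
    rw [h3]
    nlinarith [mul_pos hc (pow_pos (zero_lt_one.trans hq) (scaleIdx c q a - 1)), mul_pos
      (mul_pos hc (pow_pos (zero_lt_one.trans hq) (scaleIdx c q a - 1))) (sub_pos.2 hq), mul_nonneg
      (mul_pos hc (pow_pos (zero_lt_one.trans hq) (scaleIdx c q a - 1))).le (sq_nonneg (q - 1))]
  rw [h3] at h1 h4 ⊢
  by_cases ha : 0 ≤ a
  · have hl0 : 0 ≤ l := by rw [← h, label, if_pos ha]; omega
    have ha' : (0 : ℝ) ≤ a := by exact_mod_cast ha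
    rw [if_pos hl0, one_mul, abs_le]
    rw [abs_of_nonneg ha'] at h1 h2
    constructor <;> nlinarith
  · have hl0 : ¬ 0 ≤ l := by rw [← h, label, if_neg ha]; omega
    have ha' : (a : ℝ) < 0 := by exact_mod_cast not_le.1 ha
    rw [if_neg hl0, abs_le]
    rw [abs_of_neg ha'] at h1 h2
    constructor <;> nlinarith

end Labels

section Sieve

variable {n : ℕ}

theorem sieve_pow {ι : Type*} {B : Fin (n + 1) → ℝ} (hB : ∀ s, 0 < B s)
    {f : C(Fin (n + 1) → UnitAddCircle, ℂ)} (hf : f ∈ Spec tch {ξ : Fin (n + 1) → ℤ | ∀ s, |(ξ s : ℝ)| ≤ B s})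
    (h : ℕ) (F : Finset ι) (y : ι → Fin (n + 1) → ℝ) (hy : ∀ w ∈ F, ∀ i, |y w i| ≤ 1 / 4) {Mx : ℝ}
    (hMx0 : 0 < Mx)
    (hMx : ∀ w ∈ F, ((F.filter fun w' => ∀ i, |y w i - y w' i| * B i ≤ 1).card : ℝ) ≤ Mx) :
    ∑ w ∈ F, ‖f (tpt (y w))‖ ^ (2 * h + 2) ≤
      (Mx * ∏ i, (9 * ⌈(h + 1) * B i⌉₊ * lg ⌈(h + 1) * B i⌉₊)) *
        ∫ x, ‖f x‖ ^ (2 * h + 2) ∂torM (Fin (n + 1)) := by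
  classical
  have he := tchars (Fin (n + 1))
  set H : Fin (n + 1) → ℕ := fun i => ⌈(h + 1) * B i⌉₊ with hH
  have hH0 : ∀ i, 0 < H i := fun i => Nat.ceil_pos.2 (mul_pos (by positivity) (hB i))
  have hHB : ∀ i, (h + 1) * B i ≤ H i := fun i => Nat.le_ceil _
  have h1 : f ^ (h + 1) ∈ Spec tch ((fbox H : Finset (Fin (n + 1) → ℤ)) : Set (Fin (n + 1) → ℤ)) := by
    refine Spec.mono ?_ (Spec.pow he (fun m => {ξ : Fin (n + 1) → ℤ | ∀ s, |(ξ s : ℝ)| ≤ m * B s}) hf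
      (fun s => by simp) (fun m ξ hξ η hη s => ?_) (h + 1))
    · intro ξ hξ
      simp only [fbox, Finset.mem_coe, Fintype.mem_piFinset, Finset.mem_Icc]
      intro i
      have h2 := (hξ i).trans (by push_cast; exact hHB i)
      rw [← abs_le]
      exact_mod_cast h2
    · have h2 := hξ s
      have h3 := hη s
      push_cast
      rw [Pi.add_apply]
      push_cast
      calc |(ξ s : ℝ) + η s| ≤ |(ξ s : ℝ)| + |(η s : ℝ)| := abs_add_le _ _
        _ ≤ _ := by linarith
  have hlg : ∀ i, 0 < lg (H i) := fun i => by
    refine lt_of_lt_of_le ?_ (lg_mono (Nat.zero_le _))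
    simp [lg]
  have h4 := large_sieve he h1 F (fun w => tpt (y w)) (Δ := Mx * ∏ i, (9 * (H i : ℝ) * lg (H i)))
    (mul_pos hMx0 (Finset.prod_pos fun i _ => by
      have := hlg i
      have : (0 : ℝ) < H i := by exact_mod_cast hH0 i
      positivity)) (fun w hw => sum_rk_le hH0 F y hy (fun w hw => le_trans ?_ (hMx w hw)) hMx0.le hw)
  · simp only [ContinuousMap.pow_apply, norm_pow, ← pow_mul] at h4
    rwa [show (h + 1) * 2 = 2 * h + 2 by ring] at h4
  · norm_cast
    refine Finset.card_le_card fun w' hw' => ?_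
    rw [Finset.mem_filter] at hw' ⊢
    refine ⟨hw'.1, fun i => le_trans ?_ (hw'.2 i)⟩
    gcongr
    refine le_trans ?_ (hHB i)
    have := hB i
    nlinarith [(Nat.cast_nonneg h : (0 : ℝ) ≤ h)]

end Sieve

section Piece

open Polynomial

variable {n : ℕ}

/-- Sizes of the frequencies labelled `l`. -/
def labSize (n N : ℕ) (c q : ℝ) (l : Fin (n + 1) → ℤ) (m : ℕ) : ℝ :=
  if m = 0 then 1 else c * q ^ (l (Fin.ofNat (n + 1) m)).natAbs / (16 * N)

/-- Signs of the frequencies labelled `l`. -/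
def labSign (n : ℕ) (l : Fin (n + 1) → ℤ) (m : ℕ) : ℝ :=
  if 0 ≤ l (Fin.ofNat (n + 1) m) then 1 else -1

/-- Frequencies labelled `l`. -/
def labFib (N : ℕ) (c q : ℝ) (l : Fin (n + 1) → ℤ) (m : Fin (n + 1)) : Finset ℤ :=
  (fr N).filter fun a => label c q a = l m

/-- The normalised phase. -/
def nphase (n N : ℕ) : (Fin (n + 1) → ℤ) →+ ℝ[X] := scalePhase (phase n) (1 / (16 * N)) 0 1

theorem dv_nphase (N : ℕ) (m : ℕ) (ξ : Fin (n + 1) → ℤ) (x : ℝ) :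
    dv m (nphase n N ξ) x = 1 / (16 * N) * dv m (phase n ξ) x := by
  rw [nphase, dv_scalePhase, one_pow, one_mul, one_mul, zero_add]

theorem natDegree_nphase_le (N : ℕ) (ξ : Fin (n + 1) → ℤ) : (nphase n N ξ).natDegree ≤ n := by
  have : (nphase n N ξ) = C (1 / (16 * N : ℝ)) * (phase n ξ).comp (C 0 + C 1 * Polynomial.X) := rfl
  rw [this, C_0, zero_add, C_1, one_mul, comp_X]
  exact (natDegree_C_mul_le _ _).trans (natDegree_phase_le ξ)

theorem labSize_nonneg {N : ℕ} {c q : ℝ} (hc : 0 < c) (hq : 1 < q) (l : Fin (n + 1) → ℤ) (m : ℕ) :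
    0 ≤ labSize n N c q l m := by
  unfold labSize; split_ifs
  · norm_num
  · have := zero_lt_one.trans hq
    positivity

theorem det_mem_boxed {N K T : ℕ} (hN : 0 < N) {c q : ℝ} (hc : 0 < c) (hq : 1 < q) (hqK : q = 1 + 1 / (K : ℝ) ^ n)
    (hK : 1 ≤ K) (hcM : c * (K ^ T : ℕ) ^ n < 16 * N) (Hv : Finset (Fin (n + 1) → ℤ))
    (l : Fin (n + 1) → ℤ) (j : ℕ) :
    det n N Hv (labFib N c q l) j ∈
      Spec tch (Boxed n (nphase n N) n.factorial K T (labSize n N c q l) (labSign n l) j) := by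
  unfold det
  have hN' : (0 : ℝ) < N := by exact_mod_cast hN
  have hK' : (1 : ℝ) ≤ K := by exact_mod_cast hK
  refine Submodule.sum_mem _ fun b hb => Submodule.smul_mem _ _ (Spec.mem_of ?_)
  rw [Fintype.mem_piFinset] at hb
  refine ⟨natDegree_nphase_le _ _, fun m hm => ?_⟩
  obtain ⟨m', rfl⟩ : ∃ m' : Fin (n + 1), (m' : ℕ) = m := ⟨⟨m, by omega⟩, rfl⟩
  have hof : Fin.ofNat (n + 1) (m' : ℕ) = m' := by ext; simp [Fin.ofNat, Nat.mod_eq_of_lt m'.2]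
  have hfac : (m'.val.factorial : ℝ) ≤ n.factorial := by exact_mod_cast Nat.factorial_le hm
  have hbm := hb m'
  simp only [labFib, Finset.mem_filter, fr, Finset.mem_Ioo] at hbm
  obtain ⟨hb1, hb2⟩ := label_bounds hc hq hbm.2
  have hbN : |(b m' : ℝ)| ≤ N := by
    rw [abs_le]; constructor
    · exact_mod_cast hbm.1.1.le
    · exact_mod_cast hbm.1.2.le
  rw [dv_nphase, dv_phase_shiftF]
  set f : ℝ := (m'.val.factorial : ℝ) with hf
  have hf0 : 0 < f := by rw [hf]; exact_mod_cast Nat.factorial_pos _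
  have hx : m'.val ≠ 0 → labSize n N c q l m' = c * q ^ (l m').natAbs / (16 * N) := fun h => by
    rw [labSize, if_neg h, hof]
  constructor
  · rw [show 1 / (16 * (N : ℝ)) * (f * b m') = f * (b m' / (16 * N)) by ring, abs_mul, abs_of_pos hf0]
    refine mul_le_mul hfac ?_ (abs_nonneg _) (by positivity)
    rw [abs_div, abs_of_pos (show 0 < 16 * (N : ℝ) by positivity), div_le_iff₀ (by positivity)]
    by_cases h0 : m'.val = 0
    · rw [labSize, if_pos h0]; linarith
    · rw [hx h0, div_mul_cancel₀ _ (by positivity)]; exact hb1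
  · intro h1 h2
    rw [hx (by omega)] at h2 ⊢
    have hl : l m' ≠ 0 := by
      intro h
      rw [h, Int.natAbs_zero, pow_zero, mul_one, div_mul_eq_mul_div, le_div_iff₀ (by positivity), one_mul] at h2
      have : (K : ℝ) ^ (T * m') ≤ (K ^ T : ℕ) ^ n := by
        push_cast; rw [← pow_mul]
        exact pow_le_pow_right₀ hK' (Nat.mul_le_mul_left _ hm)
      nlinarith
    have h3 := hb2 hl
    rw [labSign, hof]
    set σ : ℝ := if 0 ≤ l m' then 1 else -1
    rw [show 1 / (16 * (N : ℝ)) * (f * b m') - σ * (f * (c * q ^ (l m').natAbs / (16 * N))) =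
      f / (16 * N) * (b m' - σ * (c * q ^ (l m').natAbs)) by ring, abs_mul,
      abs_of_pos (show 0 < f / (16 * N) by positivity)]
    have hK0 : (0 : ℝ) < K := by linarith
    calc f / (16 * N) * |b m' - σ * (c * q ^ (l m').natAbs)|
        ≤ f / (16 * N) * (c * q ^ (l m').natAbs * (q - 1)) := by gcongr
      _ = f * (c * q ^ (l m').natAbs / (16 * N)) / K ^ n := by
          rw [hqK]; field_simp; ring
      _ ≤ _ := by
          have := zero_lt_one.trans hq
          gcongr

theorem spec_natural_bounds {N K T : ℕ} (hN : 0 < N) (hK : 1 ≤ K) {x σ : ℕ → ℝ} (hx : ∀ m, 0 ≤ x m)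
    (F : ℕ → C(Fin (n + 1) → UnitAddCircle, ℂ)) (c : ℂ)
    (hF : ∀ j : ℕ, F j ∈ Spec tch (Boxed n (nphase n N) n.factorial K T x σ j)) :
    c • blk F (K ^ T) 0 ∈ Spec tch {ξ : Fin (n + 1) → ℤ | ∀ s,
      |(ξ s : ℝ)| ≤ 2 ^ (n + 1) * n.factorial * (16 * N * domSize n x K T / ((K ^ T : ℕ) : ℝ) ^ (s : ℕ))} := by
  refine Submodule.smul_mem _ _ (Submodule.sum_mem _ fun j hj => Spec.mono ?_ (hF (0 + j)))
  intro ξ hξ s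
  have hN' : (0 : ℝ) < N := by exact_mod_cast hN
  have hM : (0 : ℝ) < ((K ^ T : ℕ) : ℝ) := by exact_mod_cast Nat.pow_pos hK
  have h1 := dv_taylor (n := n) (p := nphase n N ξ) (u := ((0 + j : ℕ) : ℝ)) (y := 0) (r := ((K ^ T : ℕ) : ℝ))
    (V := n.factorial * domSize n x K T) hξ.1 hM
    (mul_nonneg (by positivity) (domSize_nonneg hx K T)) (by
      rw [zero_sub, abs_neg, Nat.abs_cast]
      rw [Finset.mem_range] at hj
      exact_mod_cast (by omega : 0 + j ≤ K ^ T)) (fun i hi => by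
      have h2 := (hξ.2 i hi).1
      have h3 := le_domSize x K T hi
      calc _ ≤ n.factorial * x i * ((K ^ T : ℕ) : ℝ) ^ i := by gcongr
        _ = n.factorial * (x i * K ^ (T * i)) := by push_cast; rw [← pow_mul]; ring
        _ ≤ _ := by gcongr) s
  rw [dv_nphase, dv_phase_zero, abs_mul, abs_mul, Nat.abs_cast, abs_of_pos (by positivity)] at h1
  have hf1 : (1 : ℝ) ≤ s.val.factorial := by exact_mod_cast Nat.factorial_pos _
  have h5 : |(ξ s : ℝ)| * ((K ^ T : ℕ) : ℝ) ^ (s : ℕ) / (16 * N) ≤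
      2 ^ (n + 1) * (n.factorial * domSize n x K T) := by
    refine le_trans ?_ h1
    rw [show 1 / (16 * (N : ℝ)) * (s.val.factorial * |(ξ s : ℝ)|) * ((K ^ T : ℕ) : ℝ) ^ (s : ℕ) =
      s.val.factorial * (|(ξ s : ℝ)| * ((K ^ T : ℕ) : ℝ) ^ (s : ℕ) / (16 * N)) by ring]
    exact le_mul_of_one_le_left (by positivity) hf1
  rw [div_le_iff₀ (by positivity)] at h5
  rw [← mul_div_assoc, le_div_iff₀ (by positivity)]
  linarith

end Piece

section DetectorMoment

variable {n : ℕ}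

/-- The decoupling inequalities on the torus at scale `1/K`, with total gain at most `Q`. -/
def DecAt (n d K P : ℕ) (Q : ℝ) : Prop :=
  ∀ m, 1 ≤ m → m ≤ n → ∃ q : ℝ, q * (K : ℝ) ^ (m * (d + 1)) ≤ Q ∧
    ∀ (S : Setup (tch (d := Fin (n + 1))) m (2 ^ (n + 2) * n.factorial)) (T : Fam S), S.δ = 1 / K →
      ∫ x, (S.δ * ‖T.sum x‖) ^ P * ‖S.H x‖ ^ 2 ∂torM (Fin (n + 1)) ≤
        q * (S.δ * T.W (torM (Fin (n + 1))) P)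

theorem labSize_le_one {N : ℕ} (hN : 0 < N) {c q : ℝ} (hc : 0 < c) (hq : 1 < q) (hq2 : q ≤ 2)
    (hcN : c ≤ 8 * N) {l : Fin (n + 1) → ℤ}
    (hl : ∀ m, l m ∈ Finset.Icc (-(scaleIdx c q N : ℤ)) (scaleIdx c q N)) (m : ℕ) :
    labSize n N c q l m ≤ 1 := by
  unfold labSize
  have hN' : (0 : ℝ) < N := by exact_mod_cast hN
  split_ifs
  · rfl
  · rw [div_le_one (by positivity)]
    have h1 := hl (Fin.ofNat (n + 1) m)
    rw [Finset.mem_Icc] at h1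
    exact (mul_pow_scaleIdx_le hc hq hq2 hcN (by omega)).trans (by linarith)

theorem piece_integral_le {d K T N P : ℕ} (hd : d ≤ n) (hP : 2 ≤ P) (hN : 0 < N) (hK : 1 ≤ K) {c q : ℝ}
    (hc : 0 < c) (hq : 1 < q) (hq2 : q ≤ 2) (hqK : q = 1 + 1 / (K : ℝ) ^ n) (hcN : c ≤ 8 * N)
    (hcM : c * (K ^ T : ℕ) ^ n < 16 * N) {Q : ℝ} (hQ1 : 1 ≤ Q) (hQ : DecAt n d K P Q)
    {Hv : ℕ → Finset (Fin (n + 1) → ℤ)}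
    (hHv : ∀ j, Hv j ⊆ Fintype.piFinset fun _ => Finset.Ico (-8 * N : ℤ) (8 * N)) {Hm : ℝ}
    (hHm : ∀ j, ((Hv j).card : ℝ) ≤ Hm) {l : Fin (n + 1) → ℤ}
    (hl : ∀ m, l m ∈ Finset.Icc (-(scaleIdx c q N : ℤ)) (scaleIdx c q N)) :
    domSize n (labSize n N c q l) K T ^ (d + 1) *
      ∫ x, ‖(((1 / ((K ^ T : ℕ) : ℝ) : ℝ) : ℂ) •
        blk (fun j => det n N (Hv j) (labFib N c q l) j) (K ^ T) 0) x‖ ^ P ∂torM (Fin (n + 1)) ≤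
      Q ^ T * (K : ℝ) ^ (n * (n + 1) * ((n + 1) * n)) *
        (((24 * lg (16 * N)) ^ (n + 1)) ^ (P - 1) * (Hm * (1 / (N : ℝ)) ^ (n + 1))) := by
  have hx := labSize_nonneg (N := N) hc hq l
  have hK' : (1 : ℝ) ≤ K := by exact_mod_cast hK
  have hM : (0 : ℝ) < ((K ^ T : ℕ) : ℝ) := by exact_mod_cast Nat.pow_pos hK
  have hfac : (1 : ℝ) ≤ n.factorial := by exact_mod_cast Nat.factorial_pos n
  have hl0 : (0 : ℝ) ≤ 24 * lg (16 * N) := mul_nonneg (by norm_num) (lg_nonneg _)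
  set F : ℕ → C(Fin (n + 1) → UnitAddCircle, ℂ) := fun j => det n N (Hv j) (labFib N c q l) j with hF
  have h1 := multiscale (tchars (Fin (n + 1))) hd (by omega : 1 ≤ P) (Φ := nphase n N) (A := n.factorial)
    hfac hx (by simp [labSize]) (σ := labSign n l)
    (fun m => by unfold labSign; split_ifs <;> simp) hK (F := F) (T := T)
    (fun j => det_mem_boxed hN hc hq hqK hK hcM (Hv j) l j) hQ1 hQ T le_rfl 0
  rw [blkMom_eq] at h1
  refine h1.trans ?_
  have h2 : domSize n (labSize n N c q l) K 0 ≤ 1 := by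
    unfold domSize
    refine Finset.sup'_le _ _ fun m _ => ?_
    rw [zero_mul, pow_zero, mul_one]
    exact labSize_le_one hN hc hq hq2 hcN hl m
  have h3 := domSize_nonneg (n := n) hx K 0
  have hHm0 : 0 ≤ Hm := le_trans (Nat.cast_nonneg _) (hHm 0)
  have h4 : 1 / ((K ^ T : ℕ) : ℝ) * ∑ j ∈ Finset.range (K ^ T), blkMom (torM (Fin (n + 1))) F P 1 (0 + j) ≤
      ((24 * lg (16 * N)) ^ (n + 1)) ^ (P - 1) * (Hm * (1 / (N : ℝ)) ^ (n + 1)) := by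
    rw [one_div, inv_mul_le_iff₀ hM]
    refine (Finset.sum_le_card_nsmul _ _ (((24 * lg (16 * N)) ^ (n + 1)) ^ (P - 1) *
      (Hm * (1 / (N : ℝ)) ^ (n + 1))) fun j _ => ?_).trans (by simp)
    rw [blkMom_one]
    refine (integral_norm_det_pow_le hN (hHv _) (fun m => ordConnected_label hc hq N (l m))
      (fun m => Finset.filter_subset _ _) _ hP).trans ?_
    gcongr
    exact hHm _
  have h5 : domSize n (labSize n N c q l) K 0 ^ (d + 1) ≤ 1 := pow_le_one₀ h3 h2
  have h6 : 0 ≤ 1 / ((K ^ T : ℕ) : ℝ) *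
      ∑ j ∈ Finset.range (K ^ T), blkMom (torM (Fin (n + 1))) F P 1 (0 + j) :=
    mul_nonneg (by positivity) (Finset.sum_nonneg fun _ _ => blkMom_nonneg _ _ _ _)
  calc _ ≤ Q ^ T * (K : ℝ) ^ (n * (n + 1) * ((n + 1) * n)) * 1 * (1 / ((K ^ T : ℕ) : ℝ) *
        ∑ j ∈ Finset.range (K ^ T), blkMom (torM (Fin (n + 1))) F P 1 (0 + j)) := by
        gcongr
        exact domSum_le _ _ _ _
    _ ≤ _ := by
        rw [mul_one]
        gcongr

/-- The loss in the large sieve. -/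
def sieveConst (n h : ℕ) : ℝ := (h + 1) * 2 ^ (n + 1) * n.factorial

theorem one_le_sieveConst (n h : ℕ) : 1 ≤ sieveConst n h := by
  have hfac : (1 : ℝ) ≤ n.factorial := by exact_mod_cast Nat.factorial_pos n
  have : (1 : ℝ) ≤ 2 ^ (n + 1) := one_le_pow₀ (by norm_num)
  unfold sieveConst
  have h1 : (1 : ℝ) ≤ h + 1 := by linarith [(Nat.cast_nonneg h : (0 : ℝ) ≤ h)]
  exact one_le_mul_of_one_le_of_one_le (one_le_mul_of_one_le_of_one_le h1 this) hfac

/-- An upper bound for all logarithmic factors. -/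
def logBd (n h N M : ℕ) : ℝ := 1 + 2 * Real.log (3 * (sieveConst n h * (16 * N * M ^ n)))

theorem lg_le_logBd {n h N M m : ℕ} (h1 : (m : ℝ) + 1 ≤ 3 * (sieveConst n h * (16 * N * M ^ n))) :
    lg m ≤ logBd n h N M := by
  refine (lg_le m).trans ?_
  unfold logBd
  gcongr

theorem piece_sum_le {ι : Type*} {d k h K T N : ℕ} (hkd : k + d = n) (hN : 0 < N) (hK : 1 ≤ K)
    (hMN : (K ^ T) ^ n ≤ 16 * N) {c q : ℝ}
    (hc : 0 < c) (hq : 1 < q) (hq2 : q ≤ 2) (hqK : q = 1 + 1 / (K : ℝ) ^ n) (hcN : c ≤ 8 * N)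
    (hcM : c * (K ^ T : ℕ) ^ n < 16 * N) {Q : ℝ} (hQ1 : 1 ≤ Q) (hQ : DecAt n d K (2 * h + 2) Q)
    {Hv : ℕ → Finset (Fin (n + 1) → ℤ)}
    (hHv : ∀ j, Hv j ⊆ Fintype.piFinset fun _ => Finset.Ico (-8 * N : ℤ) (8 * N)) {Hm : ℝ}
    (hHm : ∀ j, ((Hv j).card : ℝ) ≤ Hm) {l : Fin (n + 1) → ℤ}
    (hl : ∀ m, l m ∈ Finset.Icc (-(scaleIdx c q N : ℤ)) (scaleIdx c q N))
    (F : Finset ι) (y : ι → Fin (n + 1) → ℝ) (hy : ∀ w ∈ F, ∀ i, |y w i| ≤ 1 / 4) {E : ℝ} (hE0 : 0 < E)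
    (hE : ∀ R : ℝ, 1 ≤ R → R ≤ ((K ^ T : ℕ) : ℝ) ^ n → ∀ w ∈ F,
      ((F.filter fun w' => ∀ i : Fin (n + 1),
        |y w i - y w' i| * (16 * N * R / ((K ^ T : ℕ) : ℝ) ^ (i : ℕ)) ≤ 1).card : ℝ) * R ^ k ≤ E) :
    ∑ w ∈ F, ‖(((1 / ((K ^ T : ℕ) : ℝ) : ℝ) : ℂ) •
        blk (fun j => det n N (Hv j) (labFib N c q l) j) (K ^ T) 0) (tpt (y w))‖ ^ (2 * h + 2) ≤
      (288 * sieveConst n h * logBd n h N (K ^ T)) ^ (n + 1) *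
        ((24 * logBd n h N (K ^ T)) ^ (n + 1)) ^ (2 * h + 1) * (K : ℝ) ^ (n * (n + 1) * ((n + 1) * n)) *
        (E * Hm * Q ^ T / ((K ^ T : ℕ) : ℝ) ^ (n * (n + 1) / 2)) := by
  have hx := labSize_nonneg (N := N) hc hq l
  have hK' : (1 : ℝ) ≤ K := by exact_mod_cast hK
  have hN' : (0 : ℝ) < N := by exact_mod_cast hN
  set M : ℕ := K ^ T with hMdef
  have hM1 : (1 : ℝ) ≤ (M : ℝ) := by exact_mod_cast Nat.pow_pos hK
  have hM : (0 : ℝ) < (M : ℝ) := by linarith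
  have hMN' : (M : ℝ) ^ n ≤ 16 * N := by exact_mod_cast hMN
  have hfac : (1 : ℝ) ≤ n.factorial := by exact_mod_cast Nat.factorial_pos n
  have hHm0 : 0 ≤ Hm := le_trans (Nat.cast_nonneg _) (hHm 0)
  set R := domSize n (labSize n N c q l) K T with hR
  have hR1 : 1 ≤ R := by
    have := le_domSize (n := n) (labSize n N c q l) K T (Nat.zero_le n)
    simpa [labSize] using this
  have hR2 : R ≤ (M : ℝ) ^ n := by
    rw [hR]; unfold domSize
    refine Finset.sup'_le _ _ fun m hm => ?_
    rw [Finset.mem_range] at hm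
    calc labSize n N c q l m * (K : ℝ) ^ (T * m) ≤ 1 * (K : ℝ) ^ (T * n) := by
          have := labSize_le_one hN hc hq hq2 hcN hl m
          gcongr
          omega
      _ = _ := by rw [hMdef, one_mul]; push_cast; rw [pow_mul]
  have hR0 : 0 < R := by linarith
  set f := (((1 / (M : ℝ) : ℝ) : ℂ) • blk (fun j => det n N (Hv j) (labFib N c q l) j) M 0) with hf
  set C0 := sieveConst n h with hC0
  have hC1 : 1 ≤ C0 := one_le_sieveConst n h
  set ℓ := logBd n h N M with hℓ
  set B : Fin (n + 1) → ℝ := fun s =>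
    2 ^ (n + 1) * n.factorial * (16 * N * R / (M : ℝ) ^ (s : ℕ)) with hB
  have hspec : f ∈ Spec tch {ξ : Fin (n + 1) → ℤ | ∀ s, |(ξ s : ℝ)| ≤ B s} :=
    spec_natural_bounds hN hK hx _ _ fun j => det_mem_boxed hN hc hq hqK hK hcM (Hv j) l j
  have hsieve := sieve_pow (n := n) (B := B) (fun s => by positivity) hspec h F y hy
    (Mx := E / R ^ k) (by positivity) (fun w hw => by
      rw [le_div_iff₀ (by positivity)]
      refine le_trans (mul_le_mul_of_nonneg_right ?_ (by positivity)) (hE R hR1 hR2 w hw)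
      refine Nat.cast_le.2 (Finset.card_le_card fun w' hw' => ?_)
      rw [Finset.mem_filter] at hw' ⊢
      refine ⟨hw'.1, fun i => le_trans ?_ (hw'.2 i)⟩
      refine mul_le_mul_of_nonneg_left ?_ (abs_nonneg _)
      exact le_mul_of_one_le_left (by positivity)
        (one_le_mul_of_one_le_of_one_le (one_le_pow₀ (by norm_num : (1 : ℝ) ≤ 2)) hfac))
  refine hsieve.trans ?_
  have hpiece_int := piece_integral_le (P := 2 * h + 2) (show d ≤ n by omega) (by omega) hN hK hc hq hq2 hqK hcN hcM
    hQ1 hQ hHv hHm hl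
  rw [← hMdef, ← hf, ← hR] at hpiece_int
  set I := ∫ x, ‖f x‖ ^ (2 * h + 2) ∂torM (Fin (n + 1)) with hI
  have hI0 : 0 ≤ I := integral_nonneg fun _ => by positivity
  have hlgN : lg (16 * N) ≤ ℓ := by
    refine lg_le_logBd ?_
    push_cast
    have h1 : (1 : ℝ) ≤ 16 * N := by
      have : (1 : ℝ) ≤ N := by exact_mod_cast hN
      linarith
    have h2 : 16 * (N : ℝ) * 1 ≤ 16 * N * (M : ℝ) ^ n := by
      gcongr; exact one_le_pow₀ hM1
    have h3 : 16 * (N : ℝ) * (M : ℝ) ^ n ≤ sieveConst n h * (16 * N * (M : ℝ) ^ n) :=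
      le_mul_of_one_le_left (by positivity) hC1
    linarith
  have hℓ0 : 0 ≤ ℓ := (lg_nonneg _).trans hlgN
  have hHB : ∀ s, (h + 1) * B s = C0 * (16 * N * R / (M : ℝ) ^ (s : ℕ)) := fun s => by
    simp only [hB, hC0, sieveConst]; ring
  have hlow : ∀ s : Fin (n + 1), 1 ≤ 16 * N * R / (M : ℝ) ^ (s : ℕ) := fun s => by
    rw [one_le_div (by positivity)]
    calc (M : ℝ) ^ (s : ℕ) ≤ (M : ℝ) ^ n := pow_le_pow_right₀ hM1 (Nat.le_of_lt_succ s.2)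
      _ ≤ 16 * N * 1 := by linarith
      _ ≤ _ := by gcongr
  have hprod : ∏ i : Fin (n + 1), (9 * (⌈(h + 1) * B i⌉₊ : ℝ) * lg ⌈(h + 1) * B i⌉₊) ≤
      (288 * C0 * ℓ) ^ (n + 1) * N ^ (n + 1) * R ^ (n + 1) / (M : ℝ) ^ (n * (n + 1) / 2) := by
    calc _ ≤ ∏ i : Fin (n + 1), (288 * C0 * ℓ * N * R / (M : ℝ) ^ (i : ℕ)) := by
          refine Finset.prod_le_prod (fun i _ => mul_nonneg (by positivity) (lg_nonneg _)) fun i _ => ?_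
          have h1 : 1 ≤ C0 * (16 * N * R / (M : ℝ) ^ (i : ℕ)) :=
            one_le_mul_of_one_le_of_one_le hC1 (hlow i)
          have h2 : (⌈(h + 1) * B i⌉₊ : ℝ) ≤ 2 * (C0 * (16 * N * R / (M : ℝ) ^ (i : ℕ))) := by
            rw [hHB]
            have := (Nat.ceil_lt_add_one (zero_le_one.trans h1)).le
            linarith
          have h3 : lg ⌈(h + 1) * B i⌉₊ ≤ ℓ := by
            refine lg_le_logBd ?_
            have h4 : C0 * (16 * N * R / (M : ℝ) ^ (i : ℕ)) ≤ C0 * (16 * N * M ^ n) := by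
              gcongr
              refine (div_le_self (by positivity) (one_le_pow₀ hM1)).trans ?_
              gcongr
            linarith
          calc _ ≤ 9 * (2 * (C0 * (16 * N * R / (M : ℝ) ^ (i : ℕ)))) * ℓ := by
                have := lg_nonneg ⌈(h + 1) * B i⌉₊
                gcongr
            _ = _ := by ring
      _ = _ := by
          rw [Finset.prod_div_distrib, Finset.prod_const, Finset.card_univ, Fintype.card_fin,
            Finset.prod_pow_eq_pow_sum, Fin.sum_univ_eq_sum_range (fun i => i) (n + 1), Finset.sum_range_id,
            mul_pow, mul_pow, show (n + 1) * (n + 1 - 1) = n * (n + 1) by rw [Nat.add_sub_cancel]; ring]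
  set Z : ℝ := Q ^ T * (K : ℝ) ^ (n * (n + 1) * ((n + 1) * n)) *
        (((24 * lg (16 * N)) ^ (n + 1)) ^ (2 * h + 2 - 1) * (Hm * (1 / (N : ℝ)) ^ (n + 1))) with hZ
  have hRR : R ^ (n + 1) = R ^ k * R ^ (d + 1) := by rw [← pow_add]; congr 1; omega
  calc E / R ^ k * (∏ i : Fin (n + 1), (9 * (⌈(h + 1) * B i⌉₊ : ℝ) * lg ⌈(h + 1) * B i⌉₊)) * I
      ≤ E / R ^ k * ((288 * C0 * ℓ) ^ (n + 1) * N ^ (n + 1) * R ^ (n + 1) / (M : ℝ) ^ (n * (n + 1) / 2)) *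
          I := by gcongr
    _ = E * (288 * C0 * ℓ) ^ (n + 1) * N ^ (n + 1) / (M : ℝ) ^ (n * (n + 1) / 2) * (R ^ (d + 1) * I) := by
        rw [hRR]; field_simp
    _ ≤ E * (288 * C0 * ℓ) ^ (n + 1) * N ^ (n + 1) / (M : ℝ) ^ (n * (n + 1) / 2) * Z := by gcongr
    _ ≤ E * (288 * C0 * ℓ) ^ (n + 1) * N ^ (n + 1) / (M : ℝ) ^ (n * (n + 1) / 2) *
        (Q ^ T * (K : ℝ) ^ (n * (n + 1) * ((n + 1) * n)) *
        (((24 * ℓ) ^ (n + 1)) ^ (2 * h + 1) * (Hm * (1 / (N : ℝ)) ^ (n + 1)))) := by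
        have := lg_nonneg (16 * N)
        rw [hZ, show 2 * h + 2 - 1 = 2 * h + 1 by omega]
        gcongr
    _ = _ := by
        rw [one_div, inv_pow]
        field_simp

end DetectorMoment

section Heavy

variable {n : ℕ}

/-- The total loss in the moment estimate. -/
def totalLoss (n h N K T : ℕ) : ℝ :=
  (((2 * (n * T * K ^ (n + 1)) + 1 : ℕ) : ℝ) ^ (n + 1)) ^ (2 * h + 2) *
    ((288 * sieveConst n h * logBd n h N (K ^ T)) ^ (n + 1) *
      ((24 * logBd n h N (K ^ T)) ^ (n + 1)) ^ (2 * h + 1) * (K : ℝ) ^ (n * (n + 1) * ((n + 1) * n)))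

theorem detector_moment {ι : Type*} {d k h K T N : ℕ} (hkd : k + d = n) (hN : 0 < N) (hK : 1 ≤ K)
    (hMN : (K ^ T) ^ n ≤ 16 * N) {Q : ℝ} (hQ1 : 1 ≤ Q) (hQ : DecAt n d K (2 * h + 2) Q)
    {Hv : ℕ → Finset (Fin (n + 1) → ℤ)}
    (hHv : ∀ j, Hv j ⊆ Fintype.piFinset fun _ => Finset.Ico (-8 * N : ℤ) (8 * N)) {Hm : ℝ}
    (hHm : ∀ j, ((Hv j).card : ℝ) ≤ Hm)
    (F : Finset ι) (y : ι → Fin (n + 1) → ℝ) (hy : ∀ w ∈ F, ∀ i, |y w i| ≤ 1 / 4) {E : ℝ} (hE0 : 0 < E)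
    (hE : ∀ R : ℝ, 1 ≤ R → R ≤ ((K ^ T : ℕ) : ℝ) ^ n → ∀ w ∈ F,
      ((F.filter fun w' => ∀ i : Fin (n + 1),
        |y w i - y w' i| * (16 * N * R / ((K ^ T : ℕ) : ℝ) ^ (i : ℕ)) ≤ 1).card : ℝ) * R ^ k ≤ E) :
    ∑ w ∈ F, (1 / ((K ^ T : ℕ) : ℝ) *
      ‖∑ j ∈ Finset.range (K ^ T), det n N (Hv j) (fun _ => fr N) j (tpt (y w))‖) ^ (2 * h + 2) ≤
      totalLoss n h N K T * (E * Hm * Q ^ T / ((K ^ T : ℕ) : ℝ) ^ (n * (n + 1) / 2)) := by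
  have hK' : (1 : ℝ) ≤ K := by exact_mod_cast hK
  have hN' : (0 : ℝ) < N := by exact_mod_cast hN
  have hM1 : (1 : ℝ) ≤ ((K ^ T : ℕ) : ℝ) := by exact_mod_cast Nat.pow_pos hK
  have hM : (0 : ℝ) < ((K ^ T : ℕ) : ℝ) := by linarith
  set c : ℝ := 8 * N / ((K ^ T : ℕ) : ℝ) ^ n with hc
  set q : ℝ := 1 + 1 / (K : ℝ) ^ n with hqd
  have hc0 : 0 < c := by positivity
  have hKn : 1 ≤ (K : ℝ) ^ n := one_le_pow₀ hK'
  have hq : 1 < q := by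
    have : 0 < 1 / (K : ℝ) ^ n := by positivity
    linarith
  have hq2 : q ≤ 2 := by
    have : 1 / (K : ℝ) ^ n ≤ 1 := (div_le_one (by positivity)).2 hKn
    linarith
  have hcN : c ≤ 8 * N := div_le_self (by positivity) (one_le_pow₀ hM1)
  have hcM' : c * ((K ^ T : ℕ) : ℝ) ^ n = 8 * N := div_mul_cancel₀ _ (by positivity)
  have hcM : c * ((K ^ T : ℕ) : ℝ) ^ n < 16 * N := by rw [hcM']; linarith
  set J := scaleIdx c q N with hJ
  have hJ1 : J ≤ n * T * K ^ (n + 1) := by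
    refine scaleIdx_card_le hK ?_ hc0 hqd.ge
    have : c * (K : ℝ) ^ (n * T) = 8 * N := by
      rw [← hcM']; push_cast; rw [← pow_mul, mul_comm T n]
    rw [this]; linarith
  set Λ : Finset (Fin (n + 1) → ℤ) := Fintype.piFinset fun _ => Finset.Icc (-(J : ℤ)) J with hΛ
  have hcard : Λ.card = (2 * J + 1) ^ (n + 1) := by
    rw [hΛ, Fintype.card_piFinset, Finset.prod_const, Finset.card_univ, Fintype.card_fin, Int.card_Icc]
    congr 1; omega
  set W : ℝ := ((2 * (n * T * K ^ (n + 1)) + 1 : ℕ) : ℝ) ^ (n + 1) with hW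
  have hcard' : (Λ.card : ℝ) ≤ W := by
    rw [hcard, hW]; exact_mod_cast Nat.pow_le_pow_left (by omega) _
  have hW0 : 0 ≤ W := by positivity
  set Bd : ℝ := (288 * sieveConst n h * logBd n h N (K ^ T)) ^ (n + 1) *
        ((24 * logBd n h N (K ^ T)) ^ (n + 1)) ^ (2 * h + 1) * (K : ℝ) ^ (n * (n + 1) * ((n + 1) * n)) *
        (E * Hm * Q ^ T / ((K ^ T : ℕ) : ℝ) ^ (n * (n + 1) / 2)) with hBd
  set f : (Fin (n + 1) → ℤ) → C(Fin (n + 1) → UnitAddCircle, ℂ) := fun l =>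
    (((1 / ((K ^ T : ℕ) : ℝ) : ℝ) : ℂ) • blk (fun j => det n N (Hv j) (labFib N c q l) j) (K ^ T) 0) with hf
  have hpiece : ∀ l ∈ Λ, ∑ w ∈ F, ‖f l (tpt (y w))‖ ^ (2 * h + 2) ≤ Bd := fun l hl =>
    piece_sum_le hkd hN hK hMN hc0 hq hq2 hqd hcN hcM hQ1 hQ hHv hHm
      (fun m => Fintype.mem_piFinset.1 hl m) F y hy hE0 hE
  have hΛne : Λ.Nonempty := ⟨0, Fintype.mem_piFinset.2 fun _ => by simp⟩
  have hBd0 : 0 ≤ Bd := le_trans (Finset.sum_nonneg fun _ _ => by positivity) (hpiece _ hΛne.choose_spec)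
  have hsplit : ∀ w, 1 / ((K ^ T : ℕ) : ℝ) *
      ‖∑ j ∈ Finset.range (K ^ T), det n N (Hv j) (fun _ => fr N) j (tpt (y w))‖ ≤
      1 * ∑ l ∈ Λ, ‖f l (tpt (y w))‖ := by
    intro w
    have h1 : ∑ j ∈ Finset.range (K ^ T), det n N (Hv j) (fun _ => fr N) j (tpt (y w)) =
        ∑ l ∈ Λ, blk (fun j => det n N (Hv j) (labFib N c q l) j) (K ^ T) 0 (tpt (y w)) := by
      simp only [blk, ContinuousMap.sum_apply, zero_add]
      rw [Finset.sum_comm]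
      refine Finset.sum_congr rfl fun j _ => ?_
      rw [det_fr_eq_sum (Hv j) j (label c q) (Finset.Icc (-(J : ℤ)) J) fun a ha => label_mem hc0 hq ha,
        ContinuousMap.sum_apply]
      rfl
    rw [h1, one_mul]
    calc _ ≤ 1 / ((K ^ T : ℕ) : ℝ) *
          ∑ l ∈ Λ, ‖blk (fun j => det n N (Hv j) (labFib N c q l) j) (K ^ T) 0 (tpt (y w))‖ := by
          gcongr; exact norm_sum_le _ _
      _ = _ := by
          rw [Finset.mul_sum]
          refine Finset.sum_congr rfl fun l _ => ?_
          rw [hf, ContinuousMap.smul_apply, norm_smul, Complex.norm_real, Real.norm_of_nonneg (by positivity)]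
  calc ∑ w ∈ F, (1 / ((K ^ T : ℕ) : ℝ) *
      ‖∑ j ∈ Finset.range (K ^ T), det n N (Hv j) (fun _ => fr N) j (tpt (y w))‖) ^ (2 * h + 2)
      ≤ ∑ w ∈ F, W ^ (2 * h + 1) * (1 * ∑ l ∈ Λ, ‖f l (tpt (y w))‖ ^ (2 * h + 2)) := by
        refine Finset.sum_le_sum fun w _ => ?_
        refine (pow_le_pow_left₀ (by positivity) (hsplit w) _).trans ?_
        exact avg_pow_le Λ (fun l => ‖f l (tpt (y w))‖) (fun _ _ => norm_nonneg _) zero_le_one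
          (by rw [one_mul]; exact hcard') (by omega)
    _ = W ^ (2 * h + 1) * ∑ l ∈ Λ, ∑ w ∈ F, ‖f l (tpt (y w))‖ ^ (2 * h + 2) := by
        rw [← Finset.mul_sum]; simp only [one_mul]; rw [Finset.sum_comm]
    _ ≤ W ^ (2 * h + 1) * (Λ.card * Bd) := by
        gcongr
        refine (Finset.sum_le_card_nsmul _ _ _ hpiece).trans ?_
        rw [nsmul_eq_mul]
    _ ≤ W ^ (2 * h + 1) * (W * Bd) := by gcongr
    _ = _ := by rw [totalLoss, ← hW, hBd]; ring

/-- The cell containing the re-centred point. -/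
def cellIdx (n N j : ℕ) (y : Fin (n + 1) → ℝ) (m : Fin (n + 1)) : ℤ := ⌊16 * N * locc n j y m⌋

theorem heavy_moment {ι : Type*} {d k h K T N : ℕ} (hkd : k + d = n) (hN : 0 < N) (hK : 1 ≤ K)
    (hMN : (K ^ T) ^ n ≤ 16 * N) {Q : ℝ} (hQ1 : 1 ≤ Q) (hQ : DecAt n d K (2 * h + 2) Q)
    {Hv : ℕ → Finset (Fin (n + 1) → ℤ)}
    (hHv : ∀ j, Hv j ⊆ Fintype.piFinset fun _ => Finset.Ico (-8 * N : ℤ) (8 * N)) {Hm : ℝ}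
    (hHm : ∀ j, ((Hv j).card : ℝ) ≤ Hm)
    (F : Finset ι) (hF : F.Nonempty) (y : ι → Fin (n + 1) → ℝ) (hy : ∀ w ∈ F, ∀ i, |y w i| ≤ 1 / 4)
    {E : ℝ} (hE0 : 0 < E)
    (hE : ∀ R : ℝ, 1 ≤ R → R ≤ ((K ^ T : ℕ) : ℝ) ^ n → ∀ w ∈ F,
      ((F.filter fun w' => ∀ i : Fin (n + 1),
        |y w i - y w' i| * (16 * N * R / ((K ^ T : ℕ) : ℝ) ^ (i : ℕ)) ≤ 1).card : ℝ) * R ^ k ≤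
          E * F.card) :
    (1 / 4 ^ (n + 1) * (1 / ((K ^ T : ℕ) : ℝ) * ∑ j ∈ Finset.range (K ^ T),
      ((F.filter fun w => cellIdx n N j (y w) ∈ Hv j).card : ℝ) / F.card)) ^ (2 * h + 2) ≤
      totalLoss n h N K T * (E * Hm * Q ^ T / ((K ^ T : ℕ) : ℝ) ^ (n * (n + 1) / 2)) := by
  have hFc : (0 : ℝ) < F.card := by exact_mod_cast hF.card_pos
  have hN' : (0 : ℝ) < N := by exact_mod_cast hN
  have h1 := detector_moment hkd hN hK hMN hQ1 hQ hHv hHm F y hy (mul_pos hE0 hFc) hE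
  have hlow : ∀ w ∈ F, 1 / 4 ^ (n + 1) * (1 / ((K ^ T : ℕ) : ℝ) * ∑ j ∈ Finset.range (K ^ T),
      (if cellIdx n N j (y w) ∈ Hv j then (1 : ℝ) else 0)) ≤
      1 / ((K ^ T : ℕ) : ℝ) *
      ‖∑ j ∈ Finset.range (K ^ T), det n N (Hv j) (fun _ => fr N) j (tpt (y w))‖ := by
    intro w _
    rw [mul_left_comm, Finset.mul_sum]
    refine mul_le_mul_of_nonneg_left ?_ (by positivity)
    have h2 : ∑ j ∈ Finset.range (K ^ T), det n N (Hv j) (fun _ => fr N) j (tpt (y w)) =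
        ((∑ j ∈ Finset.range (K ^ T), ‖det n N (Hv j) (fun _ => fr N) j (tpt (y w))‖ : ℝ) : ℂ) := by
      rw [Complex.ofReal_sum]
      refine Finset.sum_congr rfl fun j _ => ?_
      rw [det_fr_tpt, Complex.norm_real, Real.norm_eq_abs, abs_of_nonneg]
      exact Finset.sum_nonneg fun _ _ => Finset.prod_nonneg fun _ _ => by positivity
    rw [h2, Complex.norm_real, Real.norm_of_nonneg (Finset.sum_nonneg fun _ _ => norm_nonneg _)]
    refine Finset.sum_le_sum fun j _ => ?_
    split_ifs with hc
    · rw [mul_one, ← one_div_pow]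
      refine det_fr_lower hN hc fun m => ?_
      have h3 := Int.floor_le (16 * N * locc n j (y w) m)
      have h4 := Int.lt_floor_add_one (16 * N * locc n j (y w) m)
      rw [show locc n j (y w) m - (cellIdx n N j (y w) m : ℝ) / (16 * N) =
        (16 * N * locc n j (y w) m - ⌊16 * N * locc n j (y w) m⌋) / (16 * N) by
          rw [cellIdx]; field_simp, abs_of_nonneg (div_nonneg (by linarith) (by positivity))]
      gcongr
      linarith
    · rw [mul_zero]; exact norm_nonneg _
  have hcount : 1 / ((K ^ T : ℕ) : ℝ) * ∑ j ∈ Finset.range (K ^ T),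
      ((F.filter fun w => cellIdx n N j (y w) ∈ Hv j).card : ℝ) / F.card =
      1 / (F.card : ℝ) * ∑ w ∈ F, (1 / ((K ^ T : ℕ) : ℝ) * ∑ j ∈ Finset.range (K ^ T),
      (if cellIdx n N j (y w) ∈ Hv j then (1 : ℝ) else 0)) := by
    rw [← Finset.mul_sum, Finset.sum_comm, ← Finset.sum_div]
    simp only [Finset.card_filter]
    push_cast
    ring
  have h5 := avg_pow_le F (fun w => 1 / 4 ^ (n + 1) * (1 / ((K ^ T : ℕ) : ℝ) *
    ∑ j ∈ Finset.range (K ^ T), (if cellIdx n N j (y w) ∈ Hv j then (1 : ℝ) else 0)))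
    (fun w _ => mul_nonneg (by positivity) (mul_nonneg (by positivity)
      (Finset.sum_nonneg fun _ _ => by split_ifs <;> norm_num)))
    (c := 1 / F.card) (K := 1) (by positivity) (by rw [one_div_mul_cancel hFc.ne'])
    (P := 2 * h + 2) (by omega)
  rw [hcount, mul_left_comm, Finset.mul_sum]
  refine h5.trans ?_
  rw [one_pow, one_mul, one_div, inv_mul_le_iff₀ hFc]
  calc _ ≤ _ := Finset.sum_le_sum fun w hw => pow_le_pow_left₀ (mul_nonneg (by positivity)
        (mul_nonneg (by positivity) (Finset.sum_nonneg fun _ _ => by split_ifs <;> norm_num)))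
          (hlow w hw) _
    _ ≤ _ := h1
    _ = _ := by ring

end Heavy

section Geometry

open Polynomial

variable {n : ℕ}

theorem uAct_apply (r : ℝ) (w : EuclideanSpace ℝ (Fin (n + 1))) (i : Fin (n + 1)) :
    uAct n r w i = ∑ l : Fin (n + 1), w l *
      (if (i : ℕ) ≤ l then r ^ ((l : ℕ) - i) / (((l : ℕ) - i).factorial : ℝ) else 0) := by
  simp [uAct, xiD]

theorem aAct_apply (t : ℝ) (w : EuclideanSpace ℝ (Fin (n + 1))) (i : Fin (n + 1)) :
    aAct n t w i = Real.exp ((((n : ℝ) - 2 * (i.1 : ℝ)) * t) / 2) * w i := by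
  simp [aAct]

/-- The polynomial whose derivatives are the coordinates of the unipotent orbit. -/
def orbitPoly (v : EuclideanSpace ℝ (Fin (n + 1))) : ℝ[X] :=
  ∑ l : Fin (n + 1), C (v l / (l : ℕ).factorial) * Polynomial.X ^ (l : ℕ)

theorem dv_orbitPoly (v : EuclideanSpace ℝ (Fin (n + 1))) (i : Fin (n + 1)) (r : ℝ) :
    dv i (orbitPoly v) r = uAct n r v i := by
  rw [uAct_apply, dv, orbitPoly, iterate_derivative_sum, eval_finsetSum]
  refine Finset.sum_congr rfl fun l _ => ?_
  rw [iterate_derivative_C_mul, iterate_derivative_X_pow_eq_natCast_mul]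
  simp only [eval_mul, eval_C, eval_natCast, eval_pow, eval_X]
  split_ifs with h
  · have h1 : (((l : ℕ) - i).factorial : ℝ) * ((l : ℕ).descFactorial i : ℝ) = (l : ℕ).factorial := by
      exact_mod_cast Nat.factorial_mul_descFactorial h
    have h2 : ((l : ℕ).factorial : ℝ) ≠ 0 := by exact_mod_cast Nat.factorial_ne_zero _
    have h3 : (((l : ℕ) - i).factorial : ℝ) ≠ 0 := by exact_mod_cast Nat.factorial_ne_zero _
    field_simp
    rw [← h1]; ring
  · rw [Nat.descFactorial_eq_zero_iff_lt.2 (by omega)]; simp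

theorem natDegree_orbitPoly_le (v : EuclideanSpace ℝ (Fin (n + 1))) : (orbitPoly v).natDegree ≤ n := by
  refine natDegree_sum_le_of_forall_le _ _ fun s _ => ?_
  exact (natDegree_C_mul_X_pow_le _ _).trans (Nat.le_of_lt_succ s.2)

theorem abs_uAct_sub_le {M : ℝ} (hM : 0 < M) {t δ r r' : ℝ} (hMt : M ≤ Real.exp t) (hr : |r' - r| ≤ 1 / M)
    {w w' x : EuclideanSpace ℝ (Fin (n + 1))} (h : ‖aAct n t (uAct n r w) - x‖ ≤ δ)
    (h' : ‖aAct n t (uAct n r w') - x‖ ≤ δ) (i : Fin (n + 1)) :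
    M ^ (n - i : ℕ) * |uAct n r' w i - uAct n r' w' i| ≤
      2 ^ (n + 2) * (δ * Real.exp (n * t / 2)) := by
  have hδ : 0 ≤ δ := (norm_nonneg _).trans h
  have hsub : ∀ (s : ℝ) (l : Fin (n + 1)), uAct n s (w - w') l = uAct n s w l - uAct n s w' l := by
    intro s l
    rw [uAct_apply, uAct_apply, uAct_apply, ← Finset.sum_sub_distrib]
    refine Finset.sum_congr rfl fun p _ => ?_
    rw [PiLp.sub_apply]; ring
  set V : ℝ := 2 * (δ * Real.exp (n * t / 2)) / M ^ n with hV
  have key : ∀ l : Fin (n + 1), |uAct n r (w - w') l| * (1 / M) ^ (l : ℕ) ≤ V := by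
    intro l
    have hl : (l : ℕ) ≤ n := Nat.le_of_lt_succ l.2
    have h1 : |aAct n t (uAct n r w) l - aAct n t (uAct n r w') l| ≤ 2 * δ := by
      have h2 := (PiLp.norm_apply_le (aAct n t (uAct n r w) - x) l).trans h
      have h3 := (PiLp.norm_apply_le (aAct n t (uAct n r w') - x) l).trans h'
      rw [PiLp.sub_apply, Real.norm_eq_abs] at h2 h3
      calc _ = |(aAct n t (uAct n r w) l - x l) - (aAct n t (uAct n r w') l - x l)| := by congr 1; ring
        _ ≤ _ := abs_sub _ _
        _ ≤ _ := by linarith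
    rw [aAct_apply, aAct_apply, ← mul_sub, ← hsub, abs_mul, abs_of_pos (Real.exp_pos _)] at h1
    have hexp : Real.exp ((((n : ℝ) - 2 * (l.1 : ℝ)) * t) / 2) * Real.exp (n * t / 2) =
        Real.exp t ^ (n - l : ℕ) := by
      rw [← Real.exp_add, ← Real.exp_nat_mul]
      congr 1
      push_cast [hl]
      ring
    rw [hV, one_div, inv_pow, ← div_eq_mul_inv, div_le_div_iff₀ (by positivity) (by positivity)]
    calc |uAct n r (w - w') l| * M ^ n = M ^ (n - l : ℕ) * |uAct n r (w - w') l| * M ^ (l : ℕ) := by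
          rw [mul_comm (M ^ (n - l : ℕ)), mul_assoc, ← pow_add]; congr 2; omega
      _ ≤ Real.exp t ^ (n - l : ℕ) * |uAct n r (w - w') l| * M ^ (l : ℕ) := by gcongr
      _ = Real.exp (n * t / 2) * (Real.exp ((((n : ℝ) - 2 * (l.1 : ℝ)) * t) / 2) *
            |uAct n r (w - w') l|) * M ^ (l : ℕ) := by rw [← hexp]; ring
      _ ≤ Real.exp (n * t / 2) * (2 * δ) * M ^ (l : ℕ) := by gcongr
      _ = _ := by ring
  have h1 := dv_taylor (p := orbitPoly (w - w')) (u := r) (y := r') (r := 1 / M) (V := V)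
    (natDegree_orbitPoly_le _) (by positivity) (by positivity) hr (fun l hl => by
      have := key ⟨l, by omega⟩
      rwa [← dv_orbitPoly] at this) i
  rw [dv_orbitPoly, hsub] at h1
  have hi : (i : ℕ) ≤ n := Nat.le_of_lt_succ i.2
  calc M ^ (n - i : ℕ) * |uAct n r' w i - uAct n r' w' i|
      = M ^ n * (|uAct n r' w i - uAct n r' w' i| * (1 / M) ^ (i : ℕ)) := by
        rw [one_div, inv_pow]
        have h2 : M ^ n = M ^ (n - i : ℕ) * M ^ (i : ℕ) := by rw [← pow_add]; congr 1; omega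
        rw [h2]; field_simp
    _ ≤ M ^ n * (2 ^ (n + 1) * V) := by gcongr
    _ = _ := by rw [hV]; field_simp; ring

/-- Rescaled coordinates. -/
def rescale (n N M : ℕ) (ρ : ℝ) (w : EuclideanSpace ℝ (Fin (n + 1))) (s : Fin (n + 1)) : ℝ :=
  (-1) ^ (s : ℕ) * (s : ℕ).factorial * (M : ℝ) ^ (s : ℕ) * w s.rev /
    (2 ^ (n + 2) * n.factorial * ρ * (16 * N))

theorem locc_rescale {N M : ℕ} (hN : 0 < N) (hM : 0 < M) {ρ : ℝ} (hρ : 0 < ρ) (j : ℕ)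
    (w : EuclideanSpace ℝ (Fin (n + 1))) (m : Fin (n + 1)) :
    16 * N * locc n j (rescale n N M ρ w) m =
      (-1) ^ (m : ℕ) * (m : ℕ).factorial * (M : ℝ) ^ (m : ℕ) * uAct n (j / M) w m.rev /
        (2 ^ (n + 2) * n.factorial * ρ) := by
  have hN' : (0 : ℝ) < N := by exact_mod_cast hN
  have hM' : (0 : ℝ) < M := by exact_mod_cast hM
  have hf : (0 : ℝ) < n.factorial := by exact_mod_cast Nat.factorial_pos n
  rw [locc, uAct_apply, ← Equiv.sum_comp Fin.revPerm (fun l : Fin (n + 1) => w l *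
      (if (m.rev : ℕ) ≤ l then ((j : ℝ) / M) ^ ((l : ℕ) - m.rev) / (((l : ℕ) - m.rev).factorial : ℝ) else 0)),
    Finset.mul_sum, Finset.mul_sum, Finset.sum_div]
  refine Finset.sum_congr rfl fun s _ => ?_
  simp only [Fin.revPerm_apply, Fin.val_rev, rescale]
  have hs := s.2
  have hm := m.2
  split_ifs with h
  · have hsm : (s : ℕ) ≤ m := by omega
    rw [show n + 1 - ((s : ℕ) + 1) - (n + 1 - ((m : ℕ) + 1)) = m - s by omega]
    have h1 : ((m : ℕ).choose s : ℝ) * (s : ℕ).factorial * ((m : ℕ) - s).factorial = (m : ℕ).factorial := by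
      exact_mod_cast Nat.choose_mul_factorial_mul_factorial hsm
    have h3 : (((m : ℕ) - s).factorial : ℝ) ≠ 0 := by exact_mod_cast Nat.factorial_ne_zero _
    have h4 : (M : ℝ) ^ (m : ℕ) = (M : ℝ) ^ (s : ℕ) * (M : ℝ) ^ ((m : ℕ) - s) := by
      rw [← pow_add]; congr 1; omega
    have h5 : (-1 : ℝ) ^ (m : ℕ) = (-1) ^ (s : ℕ) * (-1) ^ ((m : ℕ) - s) := by
      rw [← pow_add]; congr 1; omega
    rw [← h1, h4, h5, div_pow, neg_pow (j : ℝ)]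
    field_simp
  · rw [Nat.choose_eq_zero_of_lt (by omega)]
    simp

end Geometry

section Cells

variable {n : ℕ}

theorem abs_cellIdx_sub_le {N M : ℕ} (hN : 0 < N) (hM : 0 < M) {t δ r : ℝ} (hδ : 0 < δ)
    (hMt : (M : ℝ) ≤ Real.exp t) {j : ℕ} (hr : |(j : ℝ) / M - r| ≤ 1 / M)
    {w w' x : EuclideanSpace ℝ (Fin (n + 1))} (h : ‖aAct n t (uAct n r w) - x‖ ≤ δ)
    (h' : ‖aAct n t (uAct n r w') - x‖ ≤ δ) (m : Fin (n + 1)) :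
    |cellIdx n N j (rescale n N M (δ * Real.exp (n * t / 2)) w) m -
      cellIdx n N j (rescale n N M (δ * Real.exp (n * t / 2)) w') m| ≤ 1 := by
  have hM' : (0 : ℝ) < M := by exact_mod_cast hM
  have hf : (0 : ℝ) < n.factorial := by exact_mod_cast Nat.factorial_pos n
  have hm := m.2
  set ρ := δ * Real.exp (n * t / 2) with hρ
  have hρ0 : 0 < ρ := by positivity
  have h1 := abs_uAct_sub_le hM' hMt hr h h' m.rev
  rw [← hρ, show n - (m.rev : ℕ) = m by rw [Fin.val_rev]; omega] at h1
  have h2 : ((m : ℕ).factorial : ℝ) ≤ n.factorial := by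
    exact_mod_cast Nat.factorial_le (by omega)
  have h3 : |16 * N * locc n j (rescale n N M ρ w) m - 16 * N * locc n j (rescale n N M ρ w') m| ≤ 1 := by
    rw [locc_rescale hN hM hρ0, locc_rescale hN hM hρ0, ← sub_div, ← mul_sub, abs_div, abs_mul, abs_mul,
      abs_mul, abs_pow, abs_neg, abs_one, one_pow, one_mul, Nat.abs_cast, abs_pow, Nat.abs_cast,
      abs_of_pos (show 0 < 2 ^ (n + 2) * (n.factorial : ℝ) * ρ by positivity), div_le_one (by positivity),
      mul_assoc]
    calc _ ≤ (n.factorial : ℝ) * (2 ^ (n + 2) * ρ) := by gcongr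
      _ = _ := by ring
  rw [abs_le] at h3 ⊢
  unfold cellIdx
  constructor
  · have := Int.floor_mono (show 16 * N * locc n j (rescale n N M ρ w') m ≤
      16 * N * locc n j (rescale n N M ρ w) m + (1 : ℤ) by push_cast; linarith)
    rw [Int.floor_add_intCast] at this
    omega
  · have := Int.floor_mono (show 16 * N * locc n j (rescale n N M ρ w) m ≤
      16 * N * locc n j (rescale n N M ρ w') m + (1 : ℤ) by push_cast; linarith)
    rw [Int.floor_add_intCast] at this
    omega

theorem abs_coord_le {w : EuclideanSpace ℝ (Fin (n + 1))} (hw : ‖w‖ ≤ 1) (i : Fin (n + 1)) : |w i| ≤ 1 := by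
  have := (PiLp.norm_apply_le w i).trans hw
  rwa [Real.norm_eq_abs] at this

theorem abs_uAct_le {w : EuclideanSpace ℝ (Fin (n + 1))} (hw : ‖w‖ ≤ 1) {r : ℝ} (hr0 : 0 ≤ r) (hr1 : r ≤ 1)
    (i : Fin (n + 1)) : |uAct n r w i| ≤ n + 1 := by
  rw [uAct_apply]
  calc _ ≤ ∑ l : Fin (n + 1), |w l * (if (i : ℕ) ≤ l then r ^ ((l : ℕ) - i) /
        (((l : ℕ) - i).factorial : ℝ) else 0)| := Finset.abs_sum_le_sum_abs _ _
    _ ≤ ∑ l : Fin (n + 1), (1 : ℝ) := by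
        refine Finset.sum_le_sum fun l _ => ?_
        rw [abs_mul]
        refine mul_le_one₀ (abs_coord_le hw l) (abs_nonneg _) ?_
        split_ifs with h
        · have h1 : (1 : ℝ) ≤ ((l : ℕ) - i).factorial := by exact_mod_cast Nat.factorial_pos _
          rw [abs_of_nonneg (by positivity), div_le_one (by positivity)]
          exact (pow_le_one₀ hr0 hr1).trans h1
        · simp
    _ = _ := by simp

theorem abs_rescale_le {N M : ℕ} (hN : 0 < N) (hM : 0 < M) {ρ : ℝ} (hρ : 0 < ρ) (hNM : (M : ℝ) ^ n ≤ N * ρ)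
    {w : EuclideanSpace ℝ (Fin (n + 1))} (hw : ‖w‖ ≤ 1) (s : Fin (n + 1)) :
    |rescale n N M ρ w s| ≤ 1 / 4 := by
  have hN' : (0 : ℝ) < N := by exact_mod_cast hN
  have hM' : (1 : ℝ) ≤ M := by exact_mod_cast hM
  have hs := s.2
  have h2 : ((s : ℕ).factorial : ℝ) ≤ n.factorial := by
    exact_mod_cast Nat.factorial_le (by omega)
  have hf : (0 : ℝ) < n.factorial := by exact_mod_cast Nat.factorial_pos n
  unfold rescale
  rw [abs_div, abs_mul, abs_mul, abs_mul, abs_pow, abs_neg, abs_one, one_pow, one_mul, Nat.abs_cast,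
    abs_pow, Nat.abs_cast,
      abs_of_pos (show 0 < 2 ^ (n + 2) * (n.factorial : ℝ) * ρ * (16 * N) by positivity),
      div_le_iff₀ (by positivity)]
  have h3 : (1 : ℝ) ≤ 2 ^ (n + 2) := one_le_pow₀ (by norm_num)
  calc _ ≤ (n.factorial : ℝ) * (M : ℝ) ^ n * 1 := by
        gcongr
        · omega
        · exact abs_coord_le hw _
    _ ≤ 1 * (n.factorial : ℝ) * (N * ρ) * 1 := by rw [one_mul]; gcongr
    _ ≤ 2 ^ (n + 2) * (n.factorial : ℝ) * (N * ρ) * 4 := by gcongr; norm_num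
    _ = _ := by ring

theorem cellIdx_mem {N M : ℕ} (hN : 0 < N) (hM : 0 < M) {ρ : ℝ} (hρ : 0 < ρ) (hNM : (M : ℝ) ^ n ≤ N * ρ)
    {w : EuclideanSpace ℝ (Fin (n + 1))} (hw : ‖w‖ ≤ 1) {j : ℕ} (hj : j ≤ M) :
    cellIdx n N j (rescale n N M ρ w) ∈ Fintype.piFinset fun _ => Finset.Ico (-8 * N : ℤ) (8 * N) := by
  have hN' : (0 : ℝ) < N := by exact_mod_cast hN
  have hM' : (1 : ℝ) ≤ M := by exact_mod_cast hM
  rw [Fintype.mem_piFinset]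
  intro m
  have hm := m.2
  have h2 : ((m : ℕ).factorial : ℝ) ≤ n.factorial := by
    exact_mod_cast Nat.factorial_le (by omega)
  have hf : (0 : ℝ) < n.factorial := by exact_mod_cast Nat.factorial_pos n
  have h3 : ((n : ℝ) + 1) ≤ 2 ^ (n + 2) := by
    exact_mod_cast (show n + 1 ≤ 2 ^ (n + 2) from (by omega : n + 1 ≤ n + 2).trans Nat.lt_two_pow_self.le)
  have h4 : |16 * N * locc n j (rescale n N M ρ w) m| ≤ N := by
    rw [locc_rescale hN hM hρ, abs_div, abs_mul, abs_mul, abs_mul, abs_pow, abs_neg, abs_one, one_pow, one_mul,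
      Nat.abs_cast, abs_pow, Nat.abs_cast,
      abs_of_pos (show 0 < 2 ^ (n + 2) * (n.factorial : ℝ) * ρ by positivity), div_le_iff₀ (by positivity)]
    calc _ ≤ (n.factorial : ℝ) * (M : ℝ) ^ n * (n + 1) := by
          gcongr
          · omega
          · refine abs_uAct_le hw (by positivity) ?_ _
            rw [div_le_one (by positivity)]
            exact_mod_cast hj
      _ ≤ (n.factorial : ℝ) * (N * ρ) * 2 ^ (n + 2) := by gcongr
      _ = _ := by ring
  rw [abs_le] at h4
  unfold cellIdx
  rw [Finset.mem_Ico, Int.le_floor, Int.floor_lt]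
  push_cast
  constructor <;> linarith

theorem norm_sub_le_of_rescale {N M : ℕ} (hN : 0 < N) (hM : 0 < M) {ρ R : ℝ} (hρ : 0 < ρ) (hR : 0 < R)
    {w w' : EuclideanSpace ℝ (Fin (n + 1))}
    (h : ∀ i : Fin (n + 1), |rescale n N M ρ w i - rescale n N M ρ w' i| *
      (16 * N * R / (M : ℝ) ^ (i : ℕ)) ≤ 1) :
    ‖w - w'‖ ≤ (n + 1) * (2 ^ (n + 2) * n.factorial) * ρ / R := by
  have hN' : (0 : ℝ) < N := by exact_mod_cast hN
  have hM' : (0 : ℝ) < M := by exact_mod_cast hM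
  have hf : (0 : ℝ) < n.factorial := by exact_mod_cast Nat.factorial_pos n
  have h1 : ∀ l, |(w - w') l| ≤ (2 ^ (n + 2) * n.factorial) * ρ / R := by
    intro l
    have h2 := h l.rev
    have h3 : (1 : ℝ) ≤ (l.rev : ℕ).factorial := by exact_mod_cast Nat.factorial_pos _
    unfold rescale at h2
    rw [Fin.rev_rev, ← sub_div, ← mul_sub, abs_div, abs_mul, abs_mul, abs_mul, abs_pow, abs_neg, abs_one,
      one_pow, one_mul, Nat.abs_cast, abs_pow, Nat.abs_cast,
      abs_of_pos (show 0 < 2 ^ (n + 2) * (n.factorial : ℝ) * ρ * (16 * N) by positivity)] at h2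
    rw [le_div_iff₀ hR, PiLp.sub_apply]
    have h4 : ((l.rev : ℕ).factorial : ℝ) * (|w l - w' l| * R) / (2 ^ (n + 2) * n.factorial * ρ) ≤ 1 := by
      refine le_trans (le_of_eq ?_) h2
      field_simp
    rw [div_le_one (by positivity)] at h4
    refine le_trans ?_ h4
    exact le_mul_of_one_le_left (by positivity) h3
  have h5 : ‖w - w'‖ ≤ ∑ l, |(w - w') l| := by
    rw [EuclideanSpace.norm_eq, Real.sqrt_le_left (Finset.sum_nonneg fun _ _ => abs_nonneg _)]
    simp only [Real.norm_eq_abs]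
    exact Finset.sum_sq_le_sq_sum_of_nonneg fun _ _ => abs_nonneg _
  refine h5.trans ((Finset.sum_le_sum fun l _ => h1 l).trans (le_of_eq ?_))
  simp
  ring

theorem mass_eq {V : Type*} (F : Finset V) (A : Set V) [DecidablePred (· ∈ A)] :
    mass F A = ((F.filter (· ∈ A)).card : ℝ) / F.card := by
  unfold mass
  congr 2
  rw [Nat.card_coe_set_eq, ← Set.ncard_coe_finset]
  congr 1
  ext x
  simp [and_comm]

theorem card_filter_rescale_mul_le {N M : ℕ} (hN : 0 < N) (hM : 0 < M) {δ₀ ρ α C : ℝ} {k : ℕ} (hρ : 0 < ρ)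
    (hC : 1 ≤ C) (hα : (k : ℝ) ≤ α) (hα1 : α ≤ n + 1)
    (hδM : δ₀ * (M : ℝ) ^ n ≤ ρ)
    {F : Finset (EuclideanSpace ℝ (Fin (n + 1)))} (hF : F.Nonempty)
    (hreg : ∀ (x : EuclideanSpace ℝ (Fin (n + 1))) (δ : ℝ), δ ∈ Set.Icc δ₀ 1 →
          mass F (closedBall x δ) ≤ C * δ ^ α)
    {R : ℝ} (hR1 : 1 ≤ R) (hRM : R ≤ (M : ℝ) ^ n) (w : EuclideanSpace ℝ (Fin (n + 1))) :
    ((F.filter fun w' => ∀ i : Fin (n + 1), |rescale n N M ρ w i - rescale n N M ρ w' i| *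
      (16 * N * R / (M : ℝ) ^ (i : ℕ)) ≤ 1).card : ℝ) * R ^ k ≤
      C * ((n + 1) * (2 ^ (n + 2) * n.factorial)) ^ (n + 1) * ρ ^ α * F.card := by
  classical
  have hM' : (0 : ℝ) < M := by exact_mod_cast hM
  have hR0 : 0 < R := by linarith
  have hFc : (0 : ℝ) < F.card := by exact_mod_cast hF.card_pos
  set c : ℝ := (n + 1) * (2 ^ (n + 2) * n.factorial) with hc
  have hc1 : 1 ≤ c := by
    have hf : (1 : ℝ) ≤ n.factorial := by exact_mod_cast Nat.factorial_pos n
    have h3 : (1 : ℝ) ≤ 2 ^ (n + 2) := one_le_pow₀ (by norm_num)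
    have h4 : (1 : ℝ) ≤ (n : ℝ) + 1 := by linarith [(Nat.cast_nonneg n : (0 : ℝ) ≤ n)]
    exact one_le_mul_of_one_le_of_one_le h4 (one_le_mul_of_one_le_of_one_le h3 hf)
  have hα0 : 0 ≤ α := (Nat.cast_nonneg k).trans hα
  have hmain : ((F.filter fun w' => ∀ i : Fin (n + 1), |rescale n N M ρ w i - rescale n N M ρ w' i| *
      (16 * N * R / (M : ℝ) ^ (i : ℕ)) ≤ 1).card : ℝ) ≤ C * (c * ρ / R) ^ α * F.card := by
    by_cases h1 : c * ρ / R ≤ 1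
    · have h2 := hreg w (c * ρ / R) ⟨?_, h1⟩
      · rw [mass_eq, div_le_iff₀ hFc] at h2
        refine le_trans ?_ h2
        refine Nat.cast_le.2 (Finset.card_le_card fun w' hw' => ?_)
        rw [Finset.mem_filter] at hw' ⊢
        refine ⟨hw'.1, ?_⟩
        rw [mem_closedBall, dist_comm, dist_eq_norm]
        exact norm_sub_le_of_rescale hN hM hρ hR0 hw'.2
      · rw [le_div_iff₀ hR0]
        have h7 : 0 ≤ ρ := hρ.le
        rcases le_or_gt δ₀ 0 with h | h
        · nlinarith [mul_nonneg (sub_nonneg.2 hc1) h7]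
        · nlinarith [mul_nonneg (sub_nonneg.2 hc1) h7]
    · push Not at h1
      calc _ ≤ (F.card : ℝ) := Nat.cast_le.2 (Finset.card_filter_le _ _)
        _ = 1 * 1 * F.card := by ring
        _ ≤ _ := by
          gcongr
          exact Real.one_le_rpow h1.le hα0
  calc _ ≤ C * (c * ρ / R) ^ α * F.card * R ^ k := by gcongr
    _ = C * (c ^ α * ρ ^ α) * F.card * (R ^ k / R ^ α) := by
        rw [Real.div_rpow (by positivity) hR0.le, Real.mul_rpow (by positivity) hρ.le]; ring
    _ ≤ C * (c ^ (n + 1) * ρ ^ α) * F.card * 1 := by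
        gcongr
        · rw [← Real.rpow_natCast]
          refine Real.rpow_le_rpow_of_exponent_le hc1 ?_
          push_cast; exact hα1
        · rw [div_le_one (by positivity), ← Real.rpow_natCast]
          exact Real.rpow_le_rpow_of_exponent_le hR1 hα
    _ = _ := by ring

end Cells

section Exceptional

variable {n : ℕ}

/-- The cell at scale `j` of a rescaled point. -/
def cell (n N M : ℕ) (ρ : ℝ) (j : ℕ) (w : EuclideanSpace ℝ (Fin (n + 1))) : Fin (n + 1) → ℤ :=
  cellIdx n N j (rescale n N M ρ w)

open Classical in
/-- The points of `F` whose cell contains a proportion of `F` larger than `θ`. -/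
def heavyPts (n N M : ℕ) (ρ θ : ℝ) (F : Finset (EuclideanSpace ℝ (Fin (n + 1)))) (j : ℕ) :
    Finset (EuclideanSpace ℝ (Fin (n + 1))) :=
  F.filter fun w => θ * F.card < ((F.filter fun w' => cell n N M ρ j w' = cell n N M ρ j w).card : ℝ)

theorem light_card_le {N M : ℕ} (hN : 0 < N) (hM : 0 < M) {t δ θ r : ℝ} (hδ : 0 < δ) (hθ : 0 ≤ θ)
    (hMt : (M : ℝ) ≤ Real.exp t) {j : ℕ} (hr : |(j : ℝ) / M - r| ≤ 1 / M)
    (F : Finset (EuclideanSpace ℝ (Fin (n + 1)))) {G : Finset (EuclideanSpace ℝ (Fin (n + 1)))}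
    {x : EuclideanSpace ℝ (Fin (n + 1))} (hGF : G ⊆ F)
    (hG : ∀ w ∈ G, w ∉ heavyPts n N M (δ * Real.exp (n * t / 2)) θ F j ∧ ‖aAct n t (uAct n r w) - x‖ ≤ δ) :
    (G.card : ℝ) ≤ 3 ^ (n + 1) * (θ * F.card) := by
  classical
  set ρ := δ * Real.exp (n * t / 2) with hρ
  rcases G.eq_empty_or_nonempty with rfl | ⟨w₀, hw₀⟩
  · simp; positivity
  set P : Finset (Fin (n + 1) → ℤ) := Fintype.piFinset fun m =>
    Finset.Icc (cell n N M ρ j w₀ m - 1) (cell n N M ρ j w₀ m + 1) with hP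
  have hmaps : ∀ w ∈ G, cell n N M ρ j w ∈ P := by
    intro w hw
    rw [hP, Fintype.mem_piFinset]
    intro m
    have := abs_le.1 (abs_cellIdx_sub_le hN hM hδ hMt hr (hG w hw).2 (hG w₀ hw₀).2 m)
    rw [Finset.mem_Icc]
    unfold cell
    constructor <;> linarith [this.1, this.2]
  have hPc : P.card = 3 ^ (n + 1) := by
    rw [hP, Fintype.card_piFinset]
    simp only [Int.card_Icc]
    rw [Finset.prod_congr rfl (g := fun _ => 3) (fun m _ => by omega)]
    simp
  rw [Finset.card_eq_sum_card_fiberwise hmaps]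
  push_cast
  calc _ ≤ ∑ _e ∈ P, θ * (F.card : ℝ) := by
        refine Finset.sum_le_sum fun e _ => ?_
        rcases (G.filter fun w => cell n N M ρ j w = e).eq_empty_or_nonempty with h | ⟨w, hw⟩
        · rw [h]; simp; positivity
        · rw [Finset.mem_filter] at hw
          have h1 := (hG w hw.1).1
          rw [heavyPts, Finset.mem_filter, not_and, not_lt] at h1
          refine le_trans ?_ (h1 (hGF hw.1))
          rw [hw.2]
          exact Nat.cast_le.2 (Finset.card_le_card (Finset.filter_subset_filter _ hGF))
    _ = _ := by rw [Finset.sum_const, nsmul_eq_mul, hPc]; push_cast; ring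

theorem exists_exceptional {N M : ℕ} (hN : 0 < N) (hM : 0 < M) {t δ θ η : ℝ} (hδ : 0 < δ) (hθ : 0 ≤ θ)
    (hη : 0 < η) (hMt : (M : ℝ) ≤ Real.exp t) {F : Finset (EuclideanSpace ℝ (Fin (n + 1)))}
    (hF : F.Nonempty)
    (havg : 1 / (M : ℝ) * ∑ j ∈ Finset.range M,
      ((heavyPts n N M (δ * Real.exp (n * t / 2)) θ F j).card : ℝ) / F.card ≤ η ^ 2) :
    ∃ 𝓔 : Set ℝ, 𝓔 ⊆ Set.Icc 0 1 ∧ volume 𝓔 ≤ ENNReal.ofReal η ∧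
      ∀ r ∈ Set.Icc (0 : ℝ) 1 \ 𝓔, ∃ F' : Finset (EuclideanSpace ℝ (Fin (n + 1))), F' ⊆ F ∧
        mass F ((F : Set (EuclideanSpace ℝ (Fin (n + 1)))) \ (F' : Set _)) ≤ η ∧
        ∀ x : EuclideanSpace ℝ (Fin (n + 1)),
          mass F {w' | w' ∈ F' ∧ ‖aAct n t (uAct n r w') - x‖ ≤ δ} ≤ 3 ^ (n + 1) * θ := by
  classical
  set ρ := δ * Real.exp (n * t / 2) with hρ
  have hM' : (0 : ℝ) < M := by exact_mod_cast hM
  have hFc : (0 : ℝ) < F.card := by exact_mod_cast hF.card_pos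
  set bad := (Finset.range M).filter fun j => η < ((heavyPts n N M ρ θ F j).card : ℝ) / F.card with hbad
  have hbadc : (bad.card : ℝ) * (1 / M) ≤ η := by
    have h1 : (bad.card : ℝ) * η ≤ ∑ j ∈ Finset.range M, ((heavyPts n N M ρ θ F j).card : ℝ) / F.card := by
      calc (bad.card : ℝ) * η = ∑ _j ∈ bad, η := by simp
        _ ≤ ∑ j ∈ bad, ((heavyPts n N M ρ θ F j).card : ℝ) / F.card :=
          Finset.sum_le_sum fun j hj => (Finset.mem_filter.1 hj).2.le
        _ ≤ _ := Finset.sum_le_sum_of_subset_of_nonneg (Finset.filter_subset _ _) fun _ _ _ => by positivity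
    refine le_of_mul_le_mul_right ?_ hη
    calc _ = 1 / (M : ℝ) * (bad.card * η) := by ring
      _ ≤ _ := by gcongr
      _ ≤ η ^ 2 := havg
      _ = _ := by ring
  refine ⟨Set.Icc 0 1 ∩ ⋃ j ∈ bad, Set.Icc ((j : ℝ) / M) ((j : ℝ) / M + 1 / M), Set.inter_subset_left, ?_, ?_⟩
  · calc _ ≤ volume (⋃ j ∈ bad, Set.Icc ((j : ℝ) / M) ((j : ℝ) / M + 1 / M)) :=
          measure_mono Set.inter_subset_right
      _ ≤ ∑ j ∈ bad, volume (Set.Icc ((j : ℝ) / M) ((j : ℝ) / M + 1 / M)) := measure_biUnion_finset_le _ _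
      _ = ENNReal.ofReal (bad.card * (1 / M)) := by
          simp only [Real.volume_Icc, add_sub_cancel_left]
          rw [Finset.sum_const, ENNReal.ofReal_mul (by positivity), ENNReal.ofReal_natCast, nsmul_eq_mul]
      _ ≤ _ := ENNReal.ofReal_le_ofReal hbadc
  · intro r hr
    obtain ⟨⟨hr0, hr1⟩, hrE⟩ := hr
    obtain ⟨j, hj, hj1, hj2⟩ : ∃ j ∈ Finset.range M, (j : ℝ) / M ≤ r ∧ r ≤ (j : ℝ) / M + 1 / M := by
      rcases hr1.lt_or_eq with h | h
      · refine ⟨⌊r * M⌋₊, ?_, ?_, ?_⟩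
        · rw [Finset.mem_range, Nat.floor_lt (by positivity)]
          nlinarith
        · rw [div_le_iff₀ hM']
          exact Nat.floor_le (by positivity)
        · rw [← add_div, le_div_iff₀ hM']
          exact (Nat.lt_floor_add_one _).le
      · refine ⟨M - 1, by rw [Finset.mem_range]; omega, ?_, ?_⟩
        · rw [h, div_le_one hM']
          exact_mod_cast Nat.sub_le _ _
        · rw [← add_div, le_div_iff₀ hM', h]
          rw [Nat.cast_sub hM]; push_cast; linarith
    have hjb : j ∉ bad := fun hb => hrE ⟨⟨hr0, hr1⟩, Set.mem_biUnion hb ⟨hj1, hj2⟩⟩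
    rw [hbad, Finset.mem_filter, not_and, not_lt] at hjb
    have hjr : |(j : ℝ) / M - r| ≤ 1 / M := by rw [abs_le]; constructor <;> linarith
    refine ⟨F \ heavyPts n N M ρ θ F j, Finset.sdiff_subset, ?_, fun x => ?_⟩
    · rw [mass_eq]
      refine le_trans ?_ (hjb hj)
      gcongr
      intro w hw
      simp only [Finset.mem_filter, Set.mem_sdiff, Finset.mem_coe, Finset.mem_sdiff, not_and, not_not] at hw
      exact hw.2.2 hw.1
    · rw [mass_eq, div_le_iff₀ hFc, mul_assoc]
      refine light_card_le hN hM hδ hθ hMt hjr F (x := x) (Finset.filter_subset _ _) fun w hw => ?_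
      simp only [Finset.mem_filter, Set.mem_ofPred_eq, Finset.mem_sdiff] at hw
      exact ⟨hw.2.1.2, hw.2.2⟩

theorem heavy_avg_le {d k h K T N : ℕ} (hkd : k + d = n) (hN : 0 < N) (hK : 1 ≤ K)
    {Q : ℝ} (hQ1 : 1 ≤ Q) (hQ : DecAt n d K (2 * h + 2) Q) {δ₀ ρ α C θ : ℝ} (hρ : 0 < ρ)
    (hρ1 : ρ ≤ 1) (hC : 1 ≤ C) (hα : (k : ℝ) ≤ α) (hα1 : α ≤ n + 1) (hθ : 0 < θ)
    (hδM : δ₀ * ((K ^ T : ℕ) : ℝ) ^ n ≤ ρ) (hNM : ((K ^ T : ℕ) : ℝ) ^ n ≤ N * ρ)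
    {F : Finset (EuclideanSpace ℝ (Fin (n + 1)))} (hF : F.Nonempty) (hF1 : ∀ w ∈ F, ‖w‖ ≤ 1)
    (hreg : ∀ (x : EuclideanSpace ℝ (Fin (n + 1))) (δ : ℝ), δ ∈ Set.Icc δ₀ 1 →
          mass F (closedBall x δ) ≤ C * δ ^ α) :
    (1 / 4 ^ (n + 1) * (1 / ((K ^ T : ℕ) : ℝ) * ∑ j ∈ Finset.range (K ^ T),
      ((heavyPts n N (K ^ T) ρ θ F j).card : ℝ) / F.card)) ^ (2 * h + 2) ≤
    totalLoss n h N K T * (C * ((n + 1) * (2 ^ (n + 2) * n.factorial)) ^ (n + 1) * ρ ^ α *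
      (1 / θ) * Q ^ T / ((K ^ T : ℕ) : ℝ) ^ (n * (n + 1) / 2)) := by
  classical
  have hM : 0 < K ^ T := by positivity
  have hFc : (0 : ℝ) < F.card := by exact_mod_cast hF.card_pos
  set Hv : ℕ → Finset (Fin (n + 1) → ℤ) := fun j =>
    (Fintype.piFinset fun _ => Finset.Ico (-8 * N : ℤ) (8 * N)).filter fun c =>
      θ * F.card < ((F.filter fun w' => cell n N (K ^ T) ρ j w' = c).card : ℝ) with hHv
  have hcard : ∀ j, ((Hv j).card : ℝ) ≤ 1 / θ := by
    intro j
    rw [le_div_iff₀ hθ]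
    refine le_of_mul_le_mul_right ?_ hFc
    calc ((Hv j).card : ℝ) * θ * F.card = ∑ _c ∈ Hv j, θ * F.card := by simp; ring
      _ ≤ ∑ c ∈ Hv j, ((F.filter fun w' => cell n N (K ^ T) ρ j w' = c).card : ℝ) :=
        Finset.sum_le_sum fun c hc => (Finset.mem_filter.1 hc).2.le
      _ = ((F.filter fun w' => cell n N (K ^ T) ρ j w' ∈ Hv j).card : ℝ) := by
        rw [← Nat.cast_sum, Finset.card_eq_sum_card_fiberwise (f := cell n N (K ^ T) ρ j) (t := Hv j)]
        · congr 1
          refine Finset.sum_congr rfl fun c hc => ?_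
          rw [Finset.filter_filter]
          congr 1
          refine Finset.filter_congr fun w _ => ?_
          constructor
          · rintro rfl; exact ⟨hc, rfl⟩
          · exact fun h => h.2
        · intro w hw
          exact (Finset.mem_filter.1 hw).2
      _ ≤ 1 * F.card := by rw [one_mul]; exact Nat.cast_le.2 (Finset.card_filter_le _ _)
  have hNM' : (K ^ T) ^ n ≤ 16 * N := by
    have h1 : ((K ^ T : ℕ) : ℝ) ^ n ≤ 16 * N := by
      refine hNM.trans ?_
      nlinarith [(Nat.cast_nonneg N : (0 : ℝ) ≤ N)]
    exact_mod_cast h1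
  have := heavy_moment (T := T) hkd hN hK hNM' hQ1 hQ (Hv := Hv) (fun j => Finset.filter_subset _ _) hcard
    F hF (rescale n N (K ^ T) ρ) (fun w hw i => abs_rescale_le hN hM hρ hNM (hF1 w hw) i)
    (E := C * ((n + 1) * (2 ^ (n + 2) * n.factorial)) ^ (n + 1) * ρ ^ α) (by positivity)
    (fun R hR1 hRM w hw => by
      have := card_filter_rescale_mul_le (N := N) hN hM hρ hC hα hα1 hδM hF hreg hR1 hRM w
      convert this using 4)
  have hsub : ∀ j ∈ Finset.range (K ^ T), ((heavyPts n N (K ^ T) ρ θ F j).card : ℝ) / F.card ≤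
      ((F.filter fun w => cellIdx n N j (rescale n N (K ^ T) ρ w) ∈ Hv j).card : ℝ) / F.card := by
    intro j hj
    refine div_le_div_of_nonneg_right (Nat.cast_le.2 (Finset.card_le_card fun w hw => ?_)) hFc.le
    rw [heavyPts, Finset.mem_filter] at hw
    refine Finset.mem_filter.2 ⟨hw.1, Finset.mem_filter.2
      ⟨cellIdx_mem hN hM hρ hNM (hF1 w hw.1) (Finset.mem_range.1 hj).le, ?_⟩⟩
    convert hw.2 using 3
    rfl
  have hsum := Finset.sum_le_sum hsub
  refine (pow_le_pow_left₀ ?_ ?_ _).trans this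
  · exact mul_nonneg (by positivity) (mul_nonneg (by positivity) (Finset.sum_nonneg fun _ _ => by positivity))
  · exact mul_le_mul_of_nonneg_left (mul_le_mul_of_nonneg_left hsum (by positivity)) (by positivity)

end Exceptional

section Numerics

theorem exists_decAt (n : ℕ) {ε : ℝ} (hε : 0 < ε) :
    ∃ (h : ℕ) (A : ℝ), 1 ≤ A ∧ ∀ d K : ℕ, 1 ≤ K →
      DecAt n d K (2 * h + 2) (A * ((K : ℝ) ^ (d * (d + 1) / 2) * (K : ℝ) ^ ε)) := by
  have h0 : ∀ m : ℕ, ∃ h₀ : ℕ, ∀ h ≥ h₀, 1 ≤ m →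
      Dec (torM (Fin (n + 1))) tch m (2 * h + 2) (m * (m + 1) / 2 - ε) := by
    intro m
    by_cases hm : 1 ≤ m
    · obtain ⟨h₀, hh⟩ := decoupling (tchars (Fin (n + 1))) m hm hε
      exact ⟨h₀, fun h hh' _ => hh h hh'⟩
    · exact ⟨0, fun _ _ h => absurd h hm⟩
  choose h₀ hh₀ using h0
  set h := (Finset.range (n + 1)).sup h₀ with hdef
  have hB : (1 : ℝ) ≤ 2 ^ (n + 2) * n.factorial := by
    have hf : (1 : ℝ) ≤ n.factorial := by exact_mod_cast Nat.factorial_pos n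
    exact one_le_mul_of_one_le_of_one_le (one_le_pow₀ (by norm_num)) hf
  have h1 : ∀ m : ℕ, ∃ c : ℝ, 0 ≤ c ∧ (1 ≤ m → m ≤ n →
      ∀ (S : Setup (tch (d := Fin (n + 1))) m (2 ^ (n + 2) * n.factorial)) (T : Fam S),
      ∫ x, (S.δ * ‖T.sum x‖) ^ (2 * h + 2) * ‖S.H x‖ ^ 2 ∂torM (Fin (n + 1)) ≤
        c * S.δ ^ ((m : ℝ) * (m + 1) / 2 - ε) * (S.δ * T.W (torM (Fin (n + 1))) (2 * h + 2))) := by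
    intro m
    by_cases hm : 1 ≤ m ∧ m ≤ n
    · obtain ⟨c, hc, hc'⟩ := hh₀ m h (Finset.le_sup (f := h₀) (Finset.mem_range.2 (by omega))) hm.1 _ hB
      exact ⟨c, hc, fun _ _ => hc'⟩
    · exact ⟨0, le_rfl, fun h1 h2 => absurd ⟨h1, h2⟩ hm⟩
  choose c hc0 hc using h1
  refine ⟨h, 1 + ∑ m ∈ Finset.range (n + 1), c m, ?_, fun d K hK m hm1 hmn => ?_⟩
  · linarith [Finset.sum_nonneg fun m (_ : m ∈ Finset.range (n + 1)) => hc0 m]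
  have hK' : (1 : ℝ) ≤ K := by exact_mod_cast hK
  have hK0 : (0 : ℝ) < K := by linarith
  refine ⟨c m * (1 / (K : ℝ)) ^ ((m : ℝ) * (m + 1) / 2 - ε), ?_, fun S T hS => ?_⟩
  · have hcm : c m ≤ 1 + ∑ m ∈ Finset.range (n + 1), c m := by
      have := Finset.single_le_sum (f := c) (fun i _ => hc0 i) (Finset.mem_range.2 (show m < n + 1 by omega))
      linarith
    rw [mul_assoc]
    refine mul_le_mul hcm ?_ (by positivity) ((hc0 m).trans hcm)
    rw [one_div, Real.inv_rpow hK0.le, ← Real.rpow_neg hK0.le, ← Real.rpow_natCast, ← Real.rpow_natCast,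
      ← Real.rpow_add hK0, ← Real.rpow_add hK0]
    refine Real.rpow_le_rpow_of_exponent_le hK' ?_
    have h2 : ((d * (d + 1) / 2 : ℕ) : ℝ) = (d : ℝ) * (d + 1) / 2 := by
      rw [Nat.cast_div (Nat.even_mul_succ_self d).two_dvd (by norm_num)]; push_cast; ring
    rw [h2]
    push_cast
    have h3 : (0 : ℝ) ≤ ((d : ℝ) - m) * (d + 1 - m) := by
      rcases le_or_gt m d with h | h
      · have : (m : ℝ) ≤ d := by exact_mod_cast h
        exact mul_nonneg (by linarith) (by linarith)
      · have : (d : ℝ) + 1 ≤ m := by exact_mod_cast h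
        exact mul_nonneg_of_nonpos_of_nonpos (by linarith) (by linarith)
    nlinarith
  · rw [← hS]
    exact hc m hm1 hmn S T

theorem powers_collect (a b c u : ℝ) (p q r e : ℕ) :
    ((a * u ^ p) ^ p) ^ q * ((b * u) ^ p * ((c * u) ^ p) ^ r * u ^ e) =
      (a ^ p) ^ q * (b ^ p * (c ^ p) ^ r) * u ^ (p * p * q + p + p * r + e) := by
  simp only [mul_pow, ← pow_mul, pow_add]
  ring

theorem totalLoss_le {n : ℕ} (hn : 1 ≤ n) (h : ℕ) {κ : ℝ} (hκ : 0 < κ) :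
    ∃ (T : ℕ) (A : ℝ), 1 ≤ T ∧ 1 ≤ A ∧ ∀ (t X : ℝ) (K N : ℕ), 0 ≤ t → Real.exp (n * t / 2) ≤ X → 1 ≤ K →
      (K : ℝ) ≤ Real.exp (t / T) → 0 < N → (N : ℝ) ≤ 2 * X ^ 3 →
      totalLoss n h N K T ≤ A * X ^ κ := by
  set b : ℕ := (n + 1) * (n + 1) * (2 * h + 2) + (n + 1) + (n + 1) * (2 * h + 1) + n * (n + 1) * ((n + 1) * n)
    with hb
  have hb0 : (0 : ℝ) < b := by
    have : 0 < b := by rw [hb]; positivity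
    exact_mod_cast this
  set τ : ℝ := κ / b with hτ
  have hτ0 : 0 < τ := by positivity
  set T : ℕ := ⌈2 / τ⌉₊ + 1 with hT
  have hT0 : (0 : ℝ) < T := by rw [hT]; positivity
  have hTτ : 2 / (T : ℝ) ≤ τ := by
    rw [div_le_iff₀ hT0, ← div_le_iff₀' hτ0]
    rw [hT]; push_cast
    linarith [Nat.le_ceil (2 / τ)]
  have hs := one_le_sieveConst n h
  set s := sieveConst n h with hsd
  have hlog0 : 0 ≤ Real.log (96 * s) := Real.log_nonneg (by linarith)
  set A₁ : ℝ := 1 + 2 * Real.log (96 * s) + 10 / τ with hA₁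
  have hτ10 : 0 < 10 / τ := by positivity
  have hA₁1 : 1 ≤ A₁ := by linarith
  have hn' : (1 : ℝ) ≤ n := by exact_mod_cast hn
  have hT1 : (1 : ℝ) ≤ T := by exact_mod_cast (show 1 ≤ T by omega)
  refine ⟨T, ((3 * (n * T)) ^ (n + 1)) ^ (2 * h + 2) * ((288 * s * A₁) ^ (n + 1) *
    ((24 * A₁) ^ (n + 1)) ^ (2 * h + 1)), by omega, ?_, ?_⟩
  · have hnT : 1 ≤ (n : ℝ) * T := one_le_mul_of_one_le_of_one_le hn' hT1
    have hsA : 1 ≤ s * A₁ := one_le_mul_of_one_le_of_one_le hs hA₁1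
    refine one_le_mul_of_one_le_of_one_le (one_le_pow₀ (one_le_pow₀ (by linarith)))
      (one_le_mul_of_one_le_of_one_le (one_le_pow₀ (by nlinarith)) (one_le_pow₀ (one_le_pow₀ (by linarith))))
  intro t X K N ht hX hK hKe hN hNX
  have hX1 : 1 ≤ X := (Real.one_le_exp (by positivity)).trans hX
  have hX0 : 0 < X := by linarith
  have hK' : (1 : ℝ) ≤ K := by exact_mod_cast hK
  have hN' : (1 : ℝ) ≤ N := by exact_mod_cast hN
  set u := X ^ τ with hu
  have hu1 : 1 ≤ u := Real.one_le_rpow hX1 hτ0.le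
  have hKu : (K : ℝ) ≤ u := by
    refine hKe.trans ?_
    calc Real.exp (t / T) = Real.exp (t / 2) ^ (2 / (T : ℝ)) := by
          rw [← Real.exp_mul]; congr 1; field_simp
      _ ≤ X ^ (2 / (T : ℝ)) := by
          refine Real.rpow_le_rpow (Real.exp_pos _).le ((Real.exp_le_exp.2 ?_).trans hX) (by positivity)
          nlinarith
      _ ≤ _ := Real.rpow_le_rpow_of_exponent_le hX1 hTτ
  have hMX : (((K ^ T : ℕ) : ℝ)) ^ n ≤ X ^ 2 := by
    calc (((K ^ T : ℕ) : ℝ)) ^ n ≤ (Real.exp (t / T) ^ T) ^ n := by push_cast; gcongr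
      _ = Real.exp (n * t / 2) ^ 2 := by
          rw [← Real.exp_nat_mul, ← Real.exp_nat_mul, ← Real.exp_nat_mul]; congr 1; push_cast; field_simp
      _ ≤ _ := by gcongr
  have hM1 : (1 : ℝ) ≤ ((K ^ T : ℕ) : ℝ) ^ n := by
    push_cast; exact one_le_pow₀ (one_le_pow₀ hK')
  have hNM1 : (1 : ℝ) ≤ N * ((K ^ T : ℕ) : ℝ) ^ n := one_le_mul_of_one_le_of_one_le hN' hM1
  have hLB0 : 0 ≤ logBd n h N (K ^ T) := by
    have : 0 ≤ Real.log (3 * (s * (16 * N * ((K ^ T : ℕ) : ℝ) ^ n))) := by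
      refine Real.log_nonneg ?_
      nlinarith [one_le_mul_of_one_le_of_one_le hs hNM1]
    unfold logBd
    linarith
  have hLB : logBd n h N (K ^ T) ≤ A₁ * u := by
    have h1 : Real.log (3 * (s * (16 * N * ((K ^ T : ℕ) : ℝ) ^ n))) ≤ Real.log (96 * s) + 5 * Real.log X := by
      rw [← Real.log_rpow hX0 5, ← Real.log_mul (by positivity) (by positivity)]
      refine Real.log_le_log (by positivity) ?_
      rw [show (X : ℝ) ^ (5 : ℝ) = X ^ 3 * X ^ 2 by
        rw [← pow_add, ← Real.rpow_natCast]; norm_num]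
      calc _ ≤ 3 * (s * (16 * (2 * X ^ 3) * X ^ 2)) := by gcongr
        _ = _ := by ring
    have h2 : Real.log X ≤ u / τ := Real.log_le_rpow_div hX0.le hτ0
    calc logBd n h N (K ^ T) ≤ 1 + 2 * (Real.log (96 * s) + 5 * (u / τ)) := by
          unfold logBd; linarith
      _ = (1 + 2 * Real.log (96 * s)) * 1 + 10 / τ * u := by ring
      _ ≤ (1 + 2 * Real.log (96 * s)) * u + 10 / τ * u := by gcongr
      _ = _ := by rw [hA₁]; ring
  have hf : ((2 * (n * T * K ^ (n + 1)) + 1 : ℕ) : ℝ) ≤ 3 * (n * T) * u ^ (n + 1) := by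
    have hnT : 1 ≤ (n : ℝ) * T * K ^ (n + 1) :=
      one_le_mul_of_one_le_of_one_le (one_le_mul_of_one_le_of_one_le hn' hT1) (one_le_pow₀ hK')
    push_cast
    calc 2 * ((n : ℝ) * T * K ^ (n + 1)) + 1 ≤ 3 * (n * T) * K ^ (n + 1) := by linarith
      _ ≤ _ := by gcongr
  have huX : u ^ b = X ^ κ := by
    rw [hu, ← Real.rpow_natCast, ← Real.rpow_mul hX0.le, hτ]
    congr 1; field_simp
  unfold totalLoss
  rw [← hsd]
  calc _ ≤ ((3 * (n * T) * u ^ (n + 1)) ^ (n + 1)) ^ (2 * h + 2) *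
      ((288 * s * (A₁ * u)) ^ (n + 1) * ((24 * (A₁ * u)) ^ (n + 1)) ^ (2 * h + 1) *
        u ^ (n * (n + 1) * ((n + 1) * n))) := by gcongr
    _ = _ := by
      rw [← huX, hb, show 288 * s * (A₁ * u) = 288 * s * A₁ * u by ring,
        show 24 * (A₁ * u) = 24 * A₁ * u by ring]
      exact powers_collect _ _ _ _ _ _ _ _

end Numerics

section Assembly

theorem triangle_cast (m : ℕ) : ((m * (m + 1) / 2 : ℕ) : ℝ) = (m : ℝ) * (m + 1) / 2 := by
  rw [Nat.cast_div (Nat.even_mul_succ_self m).two_dvd (by norm_num)]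
  push_cast
  ring

theorem energy_balance {n k d T K : ℕ} (hkd : k + d = n) (hT : 1 ≤ T) (hK : 1 ≤ K) {t δ α ε ε' B C c : ℝ}
    (hδ : 0 < δ) (hKl : Real.exp (t / T) / 2 ≤ K) (hKu : (K : ℝ) ≤ Real.exp (t / T))
    (hε' : 0 ≤ ε') (hB : 1 ≤ B) (hC : 0 < C) (hc : 0 ≤ c) :
    C * c * (δ * Real.exp (n * t / 2)) ^ α *
      (1 / (C * Real.exp (-(t * ((2 * (n : ℝ) - k + 1) * k - n * α)) / 2) * δ ^ (α - ε))) *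
      (B * ((K : ℝ) ^ (d * (d + 1) / 2) * (K : ℝ) ^ ε')) ^ T / ((K ^ T : ℕ) : ℝ) ^ (n * (n + 1) / 2) ≤
    c * B ^ T * 2 ^ (T * (n * (n + 1) / 2)) * Real.exp (ε' * t) * δ ^ ε := by
  have hT0 : (0 : ℝ) < T := by exact_mod_cast hT
  have hK0 : (0 : ℝ) < K := by exact_mod_cast hK
  have hdn : d * (d + 1) / 2 ≤ n * (n + 1) / 2 := by
    apply Nat.div_le_div_right
    have : d ≤ n := by omega
    gcongr
  obtain ⟨p, hp⟩ := Nat.exists_eq_add_of_le hdn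
  have hpS : (p : ℝ) = (2 * (n : ℝ) - k + 1) * k / 2 := by
    have h1 : ((n * (n + 1) / 2 : ℕ) : ℝ) = ((d * (d + 1) / 2 : ℕ) : ℝ) + p := by exact_mod_cast hp
    rw [triangle_cast, triangle_cast] at h1
    have h2 : (n : ℝ) = k + d := by exact_mod_cast hkd.symm
    rw [h2] at h1 ⊢
    linarith
  have h1 : C * c * (δ * Real.exp (n * t / 2)) ^ α *
      (1 / (C * Real.exp (-(t * ((2 * (n : ℝ) - k + 1) * k - n * α)) / 2) * δ ^ (α - ε))) =
      c * (Real.exp (t * p) * δ ^ ε) := by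
    rw [Real.mul_rpow hδ.le (Real.exp_pos _).le, ← Real.exp_mul, Real.rpow_sub hδ, hpS,
      show n * t / 2 * α = t * ((2 * (n : ℝ) - k + 1) * k / 2) +
        -(t * ((2 * (n : ℝ) - k + 1) * k - n * α)) / 2 by ring, Real.exp_add]
    have := Real.rpow_pos_of_pos hδ α
    have := Real.rpow_pos_of_pos hδ ε
    field_simp
  have h2 : ((K : ℝ) ^ ε') ^ T ≤ Real.exp (ε' * t) := by
    calc ((K : ℝ) ^ ε') ^ T ≤ ((Real.exp (t / T)) ^ ε') ^ T := by gcongr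
      _ = _ := by
        rw [← Real.exp_mul, ← Real.exp_nat_mul]
        congr 1
        field_simp
  have h3 : Real.exp (t * p) ≤ 2 ^ (T * (n * (n + 1) / 2)) * ((K : ℝ) ^ T) ^ p := by
    calc Real.exp (t * p) = ((2 * (Real.exp (t / T) / 2)) ^ T) ^ p := by
          rw [mul_div_cancel₀ _ (by norm_num), ← Real.exp_nat_mul, ← Real.exp_nat_mul]
          congr 1
          field_simp
      _ ≤ ((2 * (K : ℝ)) ^ T) ^ p := by gcongr
      _ = 2 ^ (T * p) * ((K : ℝ) ^ T) ^ p := by rw [mul_pow, mul_pow, ← pow_mul 2]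
      _ ≤ _ := by
          gcongr
          · norm_num
          · omega
  rw [h1, div_le_iff₀ (by positivity), hp]
  push_cast
  have hδε := Real.rpow_pos_of_pos hδ ε
  calc c * (Real.exp (t * p) * δ ^ ε) * (B * ((K : ℝ) ^ (d * (d + 1) / 2) * (K : ℝ) ^ ε')) ^ T
      = c * B ^ T * δ ^ ε * ((K : ℝ) ^ T) ^ (d * (d + 1) / 2) * Real.exp (t * p) * ((K : ℝ) ^ ε') ^ T := by
        rw [mul_pow, mul_pow, ← pow_mul, ← pow_mul, mul_comm T]
        ring
    _ ≤ c * B ^ T * δ ^ ε * ((K : ℝ) ^ T) ^ (d * (d + 1) / 2) *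
        (2 ^ (T * (n * (n + 1) / 2)) * ((K : ℝ) ^ T) ^ p) * Real.exp (ε' * t) := by gcongr
    _ = _ := by
        rw [hp, pow_add (((K : ℝ)) ^ T)]
        ring

theorem le_sq_of_pow_le {n h : ℕ} {a A ε t : ℝ} (hA : 1 ≤ A)
    (hpow : (1 / 4 ^ (n + 1) * a) ^ (2 * h + 2) ≤ A * Real.exp (-(ε * t / 4))) :
    a ≤ (4 ^ (n + 1) * A * Real.exp (-(ε * t / (16 * (h + 1))))) ^ 2 := by
  have h4 : (1 : ℝ) ≤ 4 ^ (n + 1) := one_le_pow₀ (by norm_num)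
  set u := Real.exp (-(ε * t / (16 * (h + 1)))) with hu
  have hu0 : 0 < u := Real.exp_pos _
  have hup : (u ^ 2) ^ (2 * h + 2) = Real.exp (-(ε * t / 4)) := by
    rw [hu, ← Real.exp_nat_mul, ← Real.exp_nat_mul]
    congr 1
    push_cast
    field_simp
    ring
  have h1 : (1 / 4 ^ (n + 1) * a) ^ (2 * h + 2) ≤ (A * u ^ 2) ^ (2 * h + 2) := by
    refine hpow.trans ?_
    rw [mul_pow, hup]
    gcongr
    exact le_self_pow₀ hA (by omega)
  have h2 := le_of_pow_le_pow_left₀ (by omega) (by positivity) h1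
  calc a = 4 ^ (n + 1) * (1 / 4 ^ (n + 1) * a) := by field_simp
    _ ≤ 4 ^ (n + 1) * (A * u ^ 2) := by gcongr
    _ = (4 ^ (n + 1) * 1) * (A * 1) * u ^ 2 := by ring
    _ ≤ (4 ^ (n + 1) * 4 ^ (n + 1)) * (A * A) * u ^ 2 := by gcongr
    _ = _ := by ring

theorem inv_rpow_mul_rpow_le {n : ℕ} (hn : 1 ≤ n) {δ t ε : ℝ} (hδ : 0 < δ) (ht : 0 ≤ t) (hε : 0 < ε)
    (hδup : δ ≤ Real.exp (-((n : ℝ) * t) / 2)) :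
    δ⁻¹ ^ (ε / 4) * δ ^ ε ≤ Real.exp (-(3 * ε * t / 8)) := by
  have hn' : (1 : ℝ) ≤ n := by exact_mod_cast hn
  have h1 : δ⁻¹ ^ (ε / 4) * δ ^ ε = δ ^ (3 * ε / 4) := by
    rw [Real.inv_rpow hδ.le, ← Real.rpow_neg hδ.le, ← Real.rpow_add hδ]
    congr 1; ring
  rw [h1]
  calc δ ^ (3 * ε / 4) ≤ Real.exp (-(t / 2)) ^ (3 * ε / 4) := by
        refine Real.rpow_le_rpow hδ.le (hδup.trans (Real.exp_le_exp.2 ?_)) (by positivity)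
        nlinarith
    _ = _ := by rw [← Real.exp_mul]; congr 1; ring

theorem exists_scales {n T : ℕ} (hT : 1 ≤ T) {δ₀ δ t : ℝ} (ht : 0 ≤ t) (hδ₀ : 0 < δ₀) (hδ : 0 < δ)
    (hδ1 : δ ≤ 1) (hδlow : Real.exp ((n : ℝ) * t / 2) * δ₀ ≤ δ)
    (hδup : δ ≤ Real.exp (-((n : ℝ) * t) / 2)) :
    ∃ K N : ℕ, δ * Real.exp (n * t / 2) ≤ 1 ∧ 1 ≤ K ∧ Real.exp (t / T) / 2 ≤ K ∧
      (K : ℝ) ≤ Real.exp (t / T) ∧ ((K ^ T : ℕ) : ℝ) ≤ Real.exp t ∧ 0 < N ∧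
      ((K ^ T : ℕ) : ℝ) ^ n ≤ N * (δ * Real.exp (n * t / 2)) ∧ Real.exp (n * t / 2) ≤ δ⁻¹ ∧
      (N : ℝ) ≤ 2 * δ⁻¹ ^ 3 ∧ δ₀ * ((K ^ T : ℕ) : ℝ) ^ n ≤ δ * Real.exp (n * t / 2) := by
  have hT0 : (0 : ℝ) < T := by exact_mod_cast hT
  set ρ := δ * Real.exp (n * t / 2) with hρ
  have hρ0 : 0 < ρ := by positivity
  have hρ1 : ρ ≤ 1 := by
    calc ρ ≤ Real.exp (-(n * t) / 2) * Real.exp (n * t / 2) := by rw [hρ]; gcongr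
      _ = 1 := by rw [← Real.exp_add, ← Real.exp_zero]; congr 1; ring
  set K : ℕ := ⌊Real.exp (t / T)⌋₊ with hK
  have hKu : (K : ℝ) ≤ Real.exp (t / T) := Nat.floor_le (Real.exp_pos _).le
  have hK1 : 1 ≤ K := (Nat.one_le_floor_iff _).2 (Real.one_le_exp (by positivity))
  have hK1' : (1 : ℝ) ≤ K := by exact_mod_cast hK1
  have hKl : Real.exp (t / T) / 2 ≤ K := by
    have := Nat.lt_floor_add_one (Real.exp (t / T))
    rw [← hK] at this
    linarith
  have hMt : ((K ^ T : ℕ) : ℝ) ≤ Real.exp t := by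
    push_cast
    calc (K : ℝ) ^ T ≤ Real.exp (t / T) ^ T := by gcongr
      _ = Real.exp t := by rw [← Real.exp_nat_mul]; congr 1; field_simp
  have hMn : ((K ^ T : ℕ) : ℝ) ^ n ≤ Real.exp (n * t / 2) * Real.exp (n * t / 2) := by
    calc ((K ^ T : ℕ) : ℝ) ^ n ≤ Real.exp t ^ n := by gcongr
      _ = _ := by rw [← Real.exp_nat_mul, ← Real.exp_add]; congr 1; ring
  have hM1 : (1 : ℝ) ≤ ((K ^ T : ℕ) : ℝ) ^ n := by
    push_cast; exact one_le_pow₀ (one_le_pow₀ hK1')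
  set N : ℕ := ⌈((K ^ T : ℕ) : ℝ) ^ n / ρ⌉₊ with hN
  have hN0 : 0 < N := Nat.ceil_pos.2 (by positivity)
  have hNM : ((K ^ T : ℕ) : ℝ) ^ n ≤ N * ρ := by
    rw [← div_le_iff₀ hρ0]; exact Nat.le_ceil _
  have hX : Real.exp (n * t / 2) ≤ δ⁻¹ := by
    rw [le_inv_comm₀ (Real.exp_pos _) hδ, ← Real.exp_neg]
    refine hδup.trans (le_of_eq ?_)
    congr 1; ring
  have hX1 : 1 ≤ δ⁻¹ := (one_le_inv₀ hδ).2 hδ1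
  have hNX : (N : ℝ) ≤ 2 * δ⁻¹ ^ 3 := by
    have h1 : (1 : ℝ) ≤ ((K ^ T : ℕ) : ℝ) ^ n / ρ := by
      rw [le_div_iff₀ hρ0]; linarith
    have h2 : (N : ℝ) < ((K ^ T : ℕ) : ℝ) ^ n / ρ + 1 := Nat.ceil_lt_add_one (by positivity)
    have h3 : ((K ^ T : ℕ) : ℝ) ^ n / ρ ≤ δ⁻¹ ^ 3 := by
      calc ((K ^ T : ℕ) : ℝ) ^ n / ρ ≤ Real.exp (n * t / 2) * Real.exp (n * t / 2) / ρ := by gcongr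
        _ = Real.exp (n * t / 2) * δ⁻¹ := by rw [hρ]; field_simp
        _ ≤ δ⁻¹ * δ⁻¹ := by gcongr
        _ ≤ δ⁻¹ * δ⁻¹ * δ⁻¹ := le_mul_of_one_le_right (by positivity) hX1
        _ = _ := by ring
    linarith
  have hδM : δ₀ * ((K ^ T : ℕ) : ℝ) ^ n ≤ ρ := by
    calc δ₀ * ((K ^ T : ℕ) : ℝ) ^ n ≤ δ₀ * (Real.exp (n * t / 2) * Real.exp (n * t / 2)) := by gcongr
      _ = Real.exp (n * t / 2) * δ₀ * Real.exp (n * t / 2) := by ring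
      _ ≤ _ := by rw [hρ]; gcongr
  exact ⟨K, N, hρ1, hK1, hKl, hKu, hMt, hN0, hNM, hX, hNX, hδM⟩

end Assembly

end Dcp


open Dcp

theorem stmt11 :
    ∀ n : ℕ, 1 ≤ n →
    ∀ ε : ℝ, 0 < ε →
    ∃ D c : ℝ, 1 ≤ D ∧ 0 < c ∧
      ∀ (α C δ₀ : ℝ) (F : Finset (EuclideanSpace ℝ (Fin (n + 1)))),
        0 < α → α < (n : ℝ) + 1 → 1 ≤ C → 0 < δ₀ → δ₀ ≤ 1 → F.Nonempty →
        (F : Set (EuclideanSpace ℝ (Fin (n + 1)))) ⊆ closedBall 0 1 →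
        (∀ (x : EuclideanSpace ℝ (Fin (n + 1))) (δ : ℝ), δ ∈ Set.Icc δ₀ 1 →
          mass F (closedBall x δ) ≤ C * δ ^ α) →
        ε < min α ((n : ℝ) + 1 - α) / (10 ^ 4 * (n : ℝ)) →
        ∀ δ t : ℝ, δ₀ ≤ δ → δ ≤ 1 / 100 → D ≤ t →
          Real.exp ((n : ℝ) * t / 2) * δ₀ ≤ δ → δ ≤ Real.exp (-((n : ℝ) * t) / 2) →
          ∃ 𝓔 : Set ℝ, 𝓔 ⊆ Set.Icc 0 1 ∧
            volume 𝓔 ≤ ENNReal.ofReal (D * Real.exp (-(c * ε ^ 2 * t))) ∧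
            ∀ r ∈ Set.Icc (0 : ℝ) 1 \ 𝓔,
              ∃ F' : Finset (EuclideanSpace ℝ (Fin (n + 1))), F' ⊆ F ∧
                mass F ((F : Set (EuclideanSpace ℝ (Fin (n + 1)))) \ (F' : Set _)) ≤
                  D * Real.exp (-(c * ε ^ 2 * t)) ∧
                ∀ x : EuclideanSpace ℝ (Fin (n + 1)),
                  mass F {w' | w' ∈ F' ∧ ‖aAct n t (uAct n r w') - x‖ ≤ δ} ≤
                    D * C *
                      Real.exp (-(t * ((2 * (n : ℝ) - (⌊α⌋ : ℝ) + 1) * (⌊α⌋ : ℝ) -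
                        (n : ℝ) * α)) / 2) * δ ^ (α - ε) := by
  intro n hn ε hε
  obtain ⟨h, B, hB, hdec⟩ := exists_decAt n (ε := ε / 8) (by positivity)
  obtain ⟨T, A, hT, hA, hloss⟩ := totalLoss_le hn h (κ := ε / 4) (by positivity)
  have hT0 : (0 : ℝ) < T := by exact_mod_cast hT
  have hn' : (1 : ℝ) ≤ n := by exact_mod_cast hn
  have hf : (1 : ℝ) ≤ n.factorial := by exact_mod_cast Nat.factorial_pos n
  set c₀ : ℝ := ((n + 1) * (2 ^ (n + 2) * n.factorial)) ^ (n + 1) with hc₀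
  have hc₀1 : 1 ≤ c₀ := one_le_pow₀ (one_le_mul_of_one_le_of_one_le (by linarith)
    (one_le_mul_of_one_le_of_one_le (one_le_pow₀ (by norm_num)) hf))
  set G : ℝ := c₀ * B ^ T * 2 ^ (T * (n * (n + 1) / 2)) with hG
  have hG1 : 1 ≤ G := one_le_mul_of_one_le_of_one_le
    (one_le_mul_of_one_le_of_one_le hc₀1 (one_le_pow₀ hB)) (one_le_pow₀ (by norm_num))
  have hAG : 1 ≤ A * G := one_le_mul_of_one_le_of_one_le hA hG1
  have h34 : (3 : ℝ) ^ (n + 1) ≤ 4 ^ (n + 1) * (A * G) := by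
    calc (3 : ℝ) ^ (n + 1) ≤ 4 ^ (n + 1) * 1 := by
          rw [mul_one]; exact pow_le_pow_left₀ (by norm_num) (by norm_num) _
      _ ≤ _ := by gcongr
  refine ⟨4 ^ (n + 1) * (A * G), 1 / (16 * (h + 1) * ε),
    one_le_mul_of_one_le_of_one_le (one_le_pow₀ (by norm_num)) hAG, by positivity, ?_⟩
  intro α C δ₀ F hα hαn hC hδ₀ _ hF hF1 hreg _ δ t hδ₀δ hδ1 hDt hδlow hδup
  have ht : 0 ≤ t := (by positivity : (0 : ℝ) ≤ 4 ^ (n + 1) * (A * G)).trans hDt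
  have hδ : 0 < δ := hδ₀.trans_le hδ₀δ
  have hce : 1 / (16 * ((h : ℝ) + 1) * ε) * ε ^ 2 * t = ε * t / (16 * (h + 1)) := by field_simp
  rw [hce]
  set k : ℕ := ⌊α⌋.toNat with hk
  have hkα : (⌊α⌋ : ℝ) = k := by
    have : ((⌊α⌋.toNat : ℤ)) = ⌊α⌋ := Int.toNat_of_nonneg (Int.floor_nonneg.2 hα.le)
    rw [hk]; exact_mod_cast this.symm
  have hkα' : (k : ℝ) ≤ α := hkα ▸ Int.floor_le α
  have hkn : k ≤ n := by
    have h1 : (k : ℝ) < n + 1 := hkα'.trans_lt hαn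
    have h2 : k < n + 1 := by exact_mod_cast h1
    omega
  obtain ⟨d, hd⟩ := Nat.exists_eq_add_of_le hkn
  rw [hkα]
  set ρ := δ * Real.exp (n * t / 2) with hρ
  have hρ0 : 0 < ρ := by positivity
  obtain ⟨K, N, hρ1, hK1, hKl, hKu, hMt, hN0, hNM, hX, hNX, hδM⟩ :=
    exists_scales (n := n) hT ht hδ₀ hδ (by linarith) hδlow hδup
  have hK1' : (1 : ℝ) ≤ K := by exact_mod_cast hK1
  rw [← hρ] at hρ1 hNM hδM
  set θ := C * Real.exp (-(t * ((2 * (n : ℝ) - k + 1) * k - n * α)) / 2) * δ ^ (α - ε) with hθ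
  have hδe := Real.rpow_pos_of_pos hδ (α - ε)
  have hθ0 : 0 < θ := by positivity
  set Q : ℝ := B * ((K : ℝ) ^ (d * (d + 1) / 2) * (K : ℝ) ^ (ε / 8)) with hQ
  have hQ1 : 1 ≤ Q := one_le_mul_of_one_le_of_one_le hB
    (one_le_mul_of_one_le_of_one_le (one_le_pow₀ hK1') (Real.one_le_rpow hK1' (by positivity)))
  have hF1' : ∀ w ∈ F, ‖w‖ ≤ 1 := fun w hw => mem_closedBall_zero_iff.1 (hF1 hw)
  have hheavy := heavy_avg_le (T := T) hd.symm hN0 hK1 hQ1 (hdec d K hK1) hρ0 hρ1 hC hkα' hαn.le hθ0 hδM hNM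
    hF hF1' hreg
  have hbal := energy_balance (n := n) (C := C) (c := c₀) (α := α) (ε := ε) (B := B) hd.symm hT hK1 hδ hKl hKu
    (by positivity : (0 : ℝ) ≤ ε / 8) hB (by linarith) (by linarith)
  rw [← hρ, ← hθ, ← hQ, ← hG] at hbal
  have hl := hloss t δ⁻¹ K N ht hX hK1 hKu hN0 hNX
  have hsmall : (1 / 4 ^ (n + 1) * (1 / ((K ^ T : ℕ) : ℝ) * ∑ j ∈ Finset.range (K ^ T),
      ((heavyPts n N (K ^ T) ρ θ F j).card : ℝ) / F.card)) ^ (2 * h + 2) ≤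
      A * G * Real.exp (-(ε * t / 4)) := by
    have hE0 : 0 ≤ C * c₀ * ρ ^ α * (1 / θ) * Q ^ T / ((K ^ T : ℕ) : ℝ) ^ (n * (n + 1) / 2) := by positivity
    have hδpow := inv_rpow_mul_rpow_le hn hδ ht hε hδup
    calc _ ≤ _ := hheavy
      _ ≤ A * δ⁻¹ ^ (ε / 4) * (G * Real.exp (ε / 8 * t) * δ ^ ε) :=
        mul_le_mul hl hbal hE0 (by positivity)
      _ = A * G * Real.exp (ε / 8 * t) * (δ⁻¹ ^ (ε / 4) * δ ^ ε) := by ring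
      _ ≤ A * G * Real.exp (ε / 8 * t) * Real.exp (-(3 * ε * t / 8)) := by gcongr
      _ = _ := by rw [mul_assoc (A * G), ← Real.exp_add]; congr 2; ring
  obtain ⟨𝓔, hE1, hE2, hE3⟩ := exists_exceptional hN0 (by positivity : 0 < K ^ T) hδ hθ0.le
    (η := 4 ^ (n + 1) * (A * G) * Real.exp (-(ε * t / (16 * (h + 1))))) (by positivity) hMt hF
    (le_sq_of_pow_le hAG hsmall)
  refine ⟨𝓔, hE1, hE2, fun r hr => ?_⟩
  obtain ⟨F', hF', hm, hx⟩ := hE3 r hr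
  refine ⟨F', hF', hm, fun x => (hx x).trans ?_⟩
  calc 3 ^ (n + 1) * θ ≤ 4 ^ (n + 1) * (A * G) * θ := by gcongr
    _ = _ := by rw [hθ]; ring
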